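/- arXiv:1008.0809 — 2 statements merged into one kernel-verified Lean document; each statement's English description precedes it below -/
import Mathlib

section
/- (Poonen) For every ε > 0 there exists a set W of prime numbers whose natural density exists and is greater than 1 − ε, such that ℤ is definable over the ring O_{ℚ,W} by a ∀∃-formula with a single universal quantifier: there exist k ∈ ℕ and a polynomial F with integer coefficients in 2 + k variables such that for every t ∈ O_{ℚ,W}, t ∈ ℤ if and only if for all x ∈ O_{ℚ,W} there exist y₁,…,y_k ∈ O_{ℚ,W} with F(t, x, y₁,…,y_k) = 0. -/
/-- The subring `O_{ℚ,S}` of `ℚ` consisting of all rationals whose reduced denominator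
is divisible only by primes belonging to `S`. -/
def ringOfPrimes (S : Set ℕ) : Subring ℚ where
  carrier := {x : ℚ | ∀ p : ℕ, p.Prime → p ∣ x.den → p ∈ S}
  zero_mem' := by intro p hp hdvd; rw [Rat.den_zero] at hdvd; exact absurd (Nat.dvd_one.mp hdvd) hp.ne_one
  one_mem' := by intro p hp hdvd; rw [Rat.den_one] at hdvd; exact absurd (Nat.dvd_one.mp hdvd) hp.ne_one
  add_mem' := by
    intro x y hx hy p hp hdvd
    have := hdvd.trans (Rat.add_den_dvd x y)
    rcases (Nat.Prime.dvd_mul hp).1 this with h | h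
    · exact hx p hp h
    · exact hy p hp h
  mul_mem' := by
    intro x y hx hy p hp hdvd
    have := hdvd.trans (Rat.mul_den_dvd x y)
    rcases (Nat.Prime.dvd_mul hp).1 this with h | h
    · exact hx p hp h
    · exact hy p hp h
  neg_mem' := by
    intro x hx p hp hdvd
    rw [Rat.neg_den] at hdvd
    exact hx p hp hdvd

open scoped Classical in
/-- The finset of primes `p ≤ X` belonging to `S`. -/
noncomputable def primesUpTo (S : Set ℕ) (X : ℕ) : Finset ℕ :=
  (Finset.range (X + 1)).filter fun p => p.Prime ∧ p ∈ S

/-- A set `S` of primes has natural density `d` if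
`#{p ∈ S : p ≤ X} / #{p prime : p ≤ X} → d` as `X → ∞`. -/
def HasNatDensity (S : Set ℕ) (d : ℝ) : Prop :=
  Filter.Tendsto
    (fun X : ℕ => ((primesUpTo S X).card : ℝ) / ((primesUpTo Set.univ X).card : ℝ))
    Filter.atTop (nhds d)

/-- `c` is represented by the binary form `u ^ 2 - κ * w ^ 2` over `ℚ`. -/
def NormForm (κ c : ℚ) : Prop := ∃ u w : ℚ, c = u ^ 2 - κ * w ^ 2

theorem NormForm.mul {κ c d : ℚ} (hc : NormForm κ c) (hd : NormForm κ d) :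
    NormForm κ (c * d) := by
  obtain ⟨u, w, rfl⟩ := hc
  obtain ⟨u', w', rfl⟩ := hd
  exact ⟨u * u' + κ * w * w', u * w' + w * u', by ring⟩

theorem NormForm.sq_mul {κ c : ℚ} (s : ℚ) (hc : NormForm κ c) : NormForm κ (c * s ^ 2) := by
  obtain ⟨u, w, rfl⟩ := hc
  exact ⟨u * s, w * s, by ring⟩

theorem NormForm.of_mul_sq {κ c s : ℚ} (hs : s ≠ 0) (hc : NormForm κ c) :
    NormForm (κ * s ^ 2) c := by
  obtain ⟨u, w, rfl⟩ := hc
  exact ⟨u, w / s, by field_simp⟩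

theorem NormForm.of_ternary {a : ℕ} (ha : ¬ IsSquare a) {b X Y Z : ℤ}
    (h : a * X ^ 2 + b * Y ^ 2 = Z ^ 2) (hne : X ≠ 0 ∨ Y ≠ 0 ∨ Z ≠ 0) :
    NormForm a b := by
  have hY : Y ≠ 0 := by
    rintro rfl
    have hX : X ≠ 0 := by
      rintro rfl
      have : Z ^ 2 = 0 := by linarith
      simp_all
    apply ha
    rw [← Rat.isSquare_natCast_iff]
    refine ⟨(Z : ℚ) / X, ?_⟩
    have hX' : (X : ℚ) ≠ 0 := by exact_mod_cast hX
    have h' : (a : ℚ) * X ^ 2 = Z ^ 2 := by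
      have : (a : ℤ) * X ^ 2 = Z ^ 2 := by linarith
      exact_mod_cast this
    field_simp
    linarith
  have hY' : (Y : ℚ) ≠ 0 := by exact_mod_cast hY
  have h' : (a : ℚ) * X ^ 2 + b * Y ^ 2 = Z ^ 2 := by exact_mod_cast h
  refine ⟨Z / Y, X / Y, ?_⟩
  field_simp
  linarith

theorem exists_small_ternary {a b : ℕ} (ha : 0 < a) (hb : 0 < b) {α β : ℤ}
    (hα : (b : ℤ) ∣ α ^ 2 - a) (hβ : (a : ℤ) ∣ β ^ 2 - b) :
    ∃ x y z : ℤ, (x ≠ 0 ∨ y ≠ 0 ∨ z ≠ 0) ∧ (a : ℤ) ∣ x ^ 2 - a * y ^ 2 - b * z ^ 2 ∧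
      (b : ℤ) ∣ x ^ 2 - a * y ^ 2 - b * z ^ 2 ∧
      x ^ 2 ≤ a * b ∧ y.natAbs ^ 2 ≤ b ∧ z.natAbs ^ 2 ≤ a := by
  have : NeZero a := ⟨ha.ne'⟩
  have : NeZero b := ⟨hb.ne'⟩
  set r := Nat.sqrt (a * b) with hr
  set s := Nat.sqrt b with hs
  set m := Nat.sqrt a with hm
  have hr1 : a * b < (r + 1) ^ 2 := Nat.lt_succ_sqrt' (a * b)
  have hs1 : b < (s + 1) ^ 2 := Nat.lt_succ_sqrt' b
  have hm1 : a < (m + 1) ^ 2 := Nat.lt_succ_sqrt' a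
  have hr0 : r ^ 2 ≤ a * b := Nat.sqrt_le' (a * b)
  have hs0 : s ^ 2 ≤ b := Nat.sqrt_le' b
  have hm0 : m ^ 2 ≤ a := Nat.sqrt_le' a
  have hcard : a * b < (r + 1) * ((s + 1) * (m + 1)) := by
    refine lt_of_pow_lt_pow_left₀ 2 (Nat.zero_le _) ?_
    have h1 : b * a < (s + 1) ^ 2 * (m + 1) ^ 2 := Nat.mul_lt_mul'' hs1 hm1
    have h2 := Nat.mul_lt_mul'' hr1 h1
    calc (a * b) ^ 2 = a * b * (b * a) := by ring
      _ < _ := h2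
      _ = _ := by ring
  let f : ℕ × ℕ × ℕ → ZMod a × ZMod b := fun v =>
    ((v.1 : ZMod a) - (β : ZMod a) * v.2.2, (v.1 : ZMod b) - (α : ZMod b) * v.2.1)
  obtain ⟨v, hv, v', hv', hne, hf⟩ := Finset.exists_ne_map_eq_of_card_lt_of_maps_to
    (s := Finset.range (r + 1) ×ˢ (Finset.range (s + 1) ×ˢ Finset.range (m + 1)))
    (t := (Finset.univ : Finset (ZMod a × ZMod b))) (f := f)
    (by simpa [Finset.card_univ, ZMod.card] using hcard) (fun _ _ => Finset.mem_coe.2 (Finset.mem_univ _))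
  obtain ⟨x₁, y₁, z₁⟩ := v
  obtain ⟨x₂, y₂, z₂⟩ := v'
  simp only [Finset.mem_product, Finset.mem_range, Nat.lt_succ_iff] at hv hv'
  simp only [f, Prod.mk.injEq] at hf
  obtain ⟨hf1, hf2⟩ := hf
  have key : ∀ {i j k : ℕ}, i ≤ k → j ≤ k → ((i : ℤ) - j).natAbs ≤ k := by
    intro i j k h1 h2; omega
  have hA : (a : ℤ) ∣ ((x₁ : ℤ) - x₂) - β * ((z₁ : ℤ) - z₂) := by
    rw [← ZMod.intCast_zmod_eq_zero_iff_dvd]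
    push_cast
    linear_combination hf1
  have hB : (b : ℤ) ∣ ((x₁ : ℤ) - x₂) - α * ((y₁ : ℤ) - y₂) := by
    rw [← ZMod.intCast_zmod_eq_zero_iff_dvd]
    push_cast
    linear_combination hf2
  refine ⟨(x₁ : ℤ) - x₂, (y₁ : ℤ) - y₂, (z₁ : ℤ) - z₂, ?_, ?_, ?_, ?_, ?_, ?_⟩
  · by_contra! h
    apply hne
    simp only [Prod.mk.injEq]
    omega
  · generalize (x₁ : ℤ) - x₂ = x at *
    generalize (y₁ : ℤ) - y₂ = y at *
    generalize (z₁ : ℤ) - z₂ = z at *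
    obtain ⟨k, hk⟩ := hA
    obtain ⟨l, hl⟩ := hβ
    exact ⟨k * (x + β * z) + l * z ^ 2 - y ^ 2, by
      linear_combination (x + β * z) * hk + z ^ 2 * hl⟩
  · generalize (x₁ : ℤ) - x₂ = x at *
    generalize (y₁ : ℤ) - y₂ = y at *
    generalize (z₁ : ℤ) - z₂ = z at *
    obtain ⟨k, hk⟩ := hB
    obtain ⟨l, hl⟩ := hα
    exact ⟨k * (x + α * y) + l * y ^ 2 - z ^ 2, by
      linear_combination (x + α * y) * hk + y ^ 2 * hl⟩
  · have h1 := key hv.1 hv'.1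
    have h2 := (Nat.pow_le_pow_left h1 2).trans hr0
    rw [← Int.natAbs_sq]
    exact_mod_cast h2
  · exact (Nat.pow_le_pow_left (key hv.2.1 hv'.2.1) 2).trans hs0
  · exact (Nat.pow_le_pow_left (key hv.2.2 hv'.2.2) 2).trans hm0

/-- A weak form of Legendre's theorem on ternary quadratic forms. -/
theorem NormForm.of_isSquare_mod {a b : ℕ} (ha : 0 < a) (hb : 0 < b) (hab : a.Coprime b)
    {α β : ℤ} (hα : (b : ℤ) ∣ α ^ 2 - a) (hβ : (a : ℤ) ∣ β ^ 2 - b) : NormForm a b := by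
  by_cases hsa : IsSquare a
  · obtain ⟨m, rfl⟩ := hsa
    have hm : (m : ℚ) ≠ 0 := by
      rintro h
      simp_all
    refine ⟨((b : ℚ) + 1) / 2, ((b : ℚ) - 1) / (2 * m), ?_⟩
    push_cast
    field_simp
    ring
  by_cases hsb : IsSquare b
  · obtain ⟨m, rfl⟩ := hsb
    exact ⟨m, 0, by push_cast; ring⟩
  obtain ⟨x, y, z, hne, hda, hdb, hx, hy, hz⟩ := exists_small_ternary ha hb hα hβ
  have hy' : y ^ 2 < b := by
    rw [← Int.natAbs_sq]
    have : y.natAbs ^ 2 ≠ b := fun h => hsb ⟨y.natAbs, by rw [← h, sq]⟩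
    exact_mod_cast lt_of_le_of_ne hy this
  have hz' : z ^ 2 < a := by
    rw [← Int.natAbs_sq]
    have : z.natAbs ^ 2 ≠ a := fun h => hsa ⟨z.natAbs, by rw [← h, sq]⟩
    exact_mod_cast lt_of_le_of_ne hz this
  have hx' : x ^ 2 < a * b := by
    refine lt_of_le_of_ne hx fun h => ?_
    have h' : a * b = x.natAbs ^ 2 := by
      rw [← Int.natAbs_sq] at h
      exact_mod_cast h.symm
    obtain ⟨d, hd⟩ := exists_eq_pow_of_mul_eq_pow (Nat.isUnit_iff.2 hab) h'

    exact hsa ⟨d, by rw [hd, sq]⟩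
  have ha' : (0 : ℤ) < a := by exact_mod_cast ha
  have hb' : (0 : ℤ) < b := by exact_mod_cast hb
  have hab' : IsCoprime (a : ℤ) b := Nat.isCoprime_iff_coprime.2 hab
  obtain ⟨k, hk⟩ := hab'.mul_dvd hda hdb
  have h1 : (a : ℤ) * y ^ 2 < a * b := by gcongr
  have h2 : (b : ℤ) * z ^ 2 < b * a := by gcongr
  have hk1 : k < 1 := by
    by_contra! h
    have : (a : ℤ) * b * 1 ≤ a * b * k := by gcongr
    nlinarith [mul_nonneg ha'.le (sq_nonneg y), mul_nonneg hb'.le (sq_nonneg z)]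
  have hk2 : -2 < k := by
    by_contra! h
    have : (a : ℤ) * b * k ≤ a * b * (-2) := by gcongr
    nlinarith [sq_nonneg x]
  obtain rfl | rfl : k = 0 ∨ k = -1 := by omega
  · exact NormForm.of_ternary hsa (X := y) (Y := z) (Z := x) (by linarith) (by tauto)
  · refine NormForm.of_ternary hsa (X := x * y + b * z) (Y := x * z - a * y)
      (Z := x ^ 2 + a * b) ?_ ?_
    · linear_combination (-(x ^ 2 + (a : ℤ) * b)) * hk
    · right; right
      positivity

theorem even_padicValInt_sq_sub_mul_sq {v : ℕ} [Fact v.Prime] {K : ℤ} (hK : jacobiSym K v = -1)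
    {x y : ℤ} (hxy : x ≠ 0 ∨ y ≠ 0) :
    x ^ 2 - K * y ^ 2 ≠ 0 ∧ Even (padicValInt v (x ^ 2 - K * y ^ 2)) := by
  induction hn : x.natAbs + y.natAbs using Nat.strong_induction_on generalizing x y with
  | _ n ih =>
    have hv := (Fact.out : v.Prime)
    have hv' : (v : ℤ) ≠ 0 := by exact_mod_cast hv.ne_zero
    by_cases hd : (v : ℤ) ∣ x ^ 2 - K * y ^ 2
    · obtain ⟨⟨x, rfl⟩, ⟨y, rfl⟩⟩ := jacobiSym.prime_dvd_of_eq_neg_one hK hd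
      have hxy' : x ≠ 0 ∨ y ≠ 0 := by
        rcases hxy with h | h
        · exact Or.inl (right_ne_zero_of_mul h)
        · exact Or.inr (right_ne_zero_of_mul h)
      have hlt : x.natAbs + y.natAbs < n := by
        rw [← hn, Int.natAbs_mul, Int.natAbs_mul, Int.natAbs_natCast]
        have : 0 < x.natAbs + y.natAbs := by omega
        nlinarith [hv.two_le]
      obtain ⟨h0, h1⟩ := ih _ hlt hxy' rfl
      have he : ((v : ℤ) * x) ^ 2 - K * (v * y) ^ 2 = v * v * (x ^ 2 - K * y ^ 2) := by ring
      rw [he]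
      refine ⟨mul_ne_zero (mul_ne_zero hv' hv') h0, ?_⟩
      rw [padicValInt.mul (mul_ne_zero hv' hv') h0, padicValInt.mul hv' hv']
      exact (Even.add_self _).add h1
    · refine ⟨fun h => hd (h ▸ dvd_zero _), ?_⟩
      rw [padicValInt.eq_zero_of_not_dvd hd]
      exact Even.zero

theorem even_padicValRat_sq_sub_mul_sq {v : ℕ} [Fact v.Prime] {K : ℤ} (hK : jacobiSym K v = -1)
    {u w : ℚ} (huw : u ≠ 0 ∨ w ≠ 0) :
    u ^ 2 - K * w ^ 2 ≠ 0 ∧ Even (padicValRat v (u ^ 2 - K * w ^ 2)) := by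
  have hu : (u.den : ℚ) ≠ 0 := by exact_mod_cast u.den_nz
  have hw : (w.den : ℚ) ≠ 0 := by exact_mod_cast w.den_nz
  have h1 : u * (u.den * w.den) = (u.num * w.den : ℤ) := by
    push_cast; rw [← Rat.mul_den_eq_num u]; ring
  have h2 : w * (u.den * w.den) = (w.num * u.den : ℤ) := by
    push_cast; rw [← Rat.mul_den_eq_num w]; ring
  have hd : (u.den * w.den : ℚ) ≠ 0 := mul_ne_zero hu hw
  obtain ⟨h0, he⟩ := even_padicValInt_sq_sub_mul_sq hK
    (x := u.num * w.den) (y := w.num * u.den) (by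
      rcases huw with h | h
      · left; simpa using h
      · right; simpa using h)
  have heq : (u ^ 2 - K * w ^ 2) * (u.den * w.den : ℚ) ^ 2 =
      (((u.num * w.den) ^ 2 - K * (w.num * u.den) ^ 2 : ℤ) : ℚ) := by
    push_cast at h1 h2 ⊢
    rw [← h1, ← h2]; ring
  have hne : u ^ 2 - K * w ^ 2 ≠ 0 := by
    intro h
    rw [h, zero_mul] at heq
    exact h0 (by exact_mod_cast heq.symm)
  refine ⟨hne, ?_⟩
  have hval := congrArg (padicValRat v) heq
  rw [padicValRat.mul hne (pow_ne_zero _ hd), padicValRat.pow _, padicValRat.of_int] at hval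
  have he' : Even ((padicValInt v ((u.num * w.den) ^ 2 - K * (w.num * u.den) ^ 2) : ℕ) : ℤ) := by
    exact_mod_cast he
  rw [← hval] at he'
  push_cast at he'
  rw [Int.even_add] at he'
  exact he'.2 (even_two_mul _)

theorem NormForm.even_padicValRat {v : ℕ} [Fact v.Prime] {K : ℤ} (hK : jacobiSym K v = -1)
    {c : ℚ} (hc0 : c ≠ 0) (hc : NormForm K c) : Even (padicValRat v c) := by
  obtain ⟨u, w, rfl⟩ := hc
  refine (even_padicValRat_sq_sub_mul_sq hK ?_).2
  by_contra! h
  simp [h.1, h.2] at hc0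

theorem jacobiSym_eq_one_of_pow_padicValNat {k : ℤ} {m : ℕ}
    (h : ∀ v : ℕ, v.Prime → v ∣ m → jacobiSym k v ^ padicValNat v m = 1) : jacobiSym k m = 1 := by
  rw [Nat.multiplicative_factorization' (jacobiSym k) _ (jacobiSym.zero_right k)
    (jacobiSym.one_right k)]
  · refine Finset.prod_eq_one fun v hv => ?_
    have hp := Nat.prime_of_mem_primeFactors (Nat.support_factorization m ▸ hv)
    have hd := Nat.dvd_of_mem_primeFactors (Nat.support_factorization m ▸ hv)
    simp only []
    rw [jacobiSym.pow_right, Nat.factorization_def _ hp]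
    exact h v hp hd
  · intro x y hxy
    rcases eq_or_ne x 0 with rfl | hx
    · simp_all [jacobiSym.zero_right, jacobiSym.one_right]
    rcases eq_or_ne y 0 with rfl | hy
    · simp_all [jacobiSym.zero_right, jacobiSym.one_right]
    exact jacobiSym.mul_right' k hx hy

/-- `a` is congruent to a square modulo `m`. -/
def IsSquareMod (m : ℕ) (a : ℤ) : Prop := ∃ α : ℤ, (m : ℤ) ∣ α ^ 2 - a

theorem NormForm.of_isSquareMod {a b : ℕ} (ha : 0 < a) (hb : 0 < b) (hab : a.Coprime b)
    (hα : IsSquareMod b a) (hβ : IsSquareMod a b) : NormForm a b := by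
  obtain ⟨α, hα⟩ := hα
  obtain ⟨β, hβ⟩ := hβ
  exact NormForm.of_isSquare_mod ha hb hab hα hβ

theorem IsSquareMod.mul {m n : ℕ} {a : ℤ} (hmn : m.Coprime n) (hm : IsSquareMod m a)
    (hn : IsSquareMod n a) : IsSquareMod (m * n) a := by
  obtain ⟨α, k, hk⟩ := hm
  obtain ⟨β, l, hl⟩ := hn
  have hc : IsCoprime (m : ℤ) n := Nat.isCoprime_iff_coprime.2 hmn
  obtain ⟨u, v, huv⟩ := hc
  refine ⟨β * (u * m) + α * (v * n), ?_⟩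
  push_cast
  have hc : IsCoprime (m : ℤ) n := Nat.isCoprime_iff_coprime.2 hmn
  have h1 : β * (u * m) + α * (v * n) = α + m * (u * (β - α)) := by
    linear_combination α * huv
  have h2 : β * (u * m) + α * (v * n) = β + n * (v * (α - β)) := by
    linear_combination β * huv
  refine hc.mul_dvd ?_ ?_
  · rw [h1]
    exact ⟨k + 2 * α * (u * (β - α)) + m * (u * (β - α)) ^ 2, by linear_combination hk⟩
  · rw [h2]
    exact ⟨l + 2 * β * (v * (α - β)) + n * (v * (α - β)) ^ 2, by linear_combination hl⟩

theorem IsSquareMod.of_modEq_sq {m a s : ℕ} (h : a ≡ s ^ 2 [MOD m]) : IsSquareMod m a :=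
  ⟨s, by exact_mod_cast (Nat.modEq_iff_dvd.1 h)⟩

theorem IsSquareMod.of_modEq_one {m a : ℕ} (h : a ≡ 1 [MOD m]) : IsSquareMod m a :=
  IsSquareMod.of_modEq_sq (s := 1) (by simpa using h)

theorem IsSquareMod.of_jacobiSym {q : ℕ} [Fact q.Prime] {a : ℤ} (h : jacobiSym a q = 1) :
    IsSquareMod q a := by
  obtain ⟨s, hs⟩ := ZMod.isSquare_of_jacobiSym_eq_one h
  obtain ⟨α, rfl⟩ := ZMod.intCast_surjective s
  refine ⟨α, ?_⟩
  rw [← ZMod.intCast_zmod_eq_zero_iff_dvd]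
  push_cast
  rw [hs]
  ring

theorem jacobiSym_of_modEq_one {g q : ℕ} (hg : Odd g) (hq : q % 4 = 1) (h : q ≡ 1 [MOD g]) :
    jacobiSym g q = 1 := by
  rw [jacobiSym.quadratic_reciprocity_one_mod_four' hg hq, jacobiSym.mod_left' (a₂ := 1),
    jacobiSym.one_left]
  exact_mod_cast congrArg (Nat.cast : ℕ → ℤ) h

theorem coprime_of_jacobiSym {a b : ℕ} (hb : b ≠ 0) (h : jacobiSym a b = 1) : a.Coprime b := by
  have : NeZero b := ⟨hb⟩
  by_contra hc
  have : jacobiSym a b = 0 := jacobiSym.eq_zero_iff_not_coprime.2 (by simpa using hc)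
  omega

theorem exists_prime_modEq {l e N ν : ℕ} (hl : l.Prime) (hl2 : l ≠ 2) (hN : Odd N)
    (hlN : ¬ l ∣ N) (hν : ν.Coprime l) (n : ℕ) :
    ∃ q > n, q.Prime ∧ q % 8 = 5 ∧ q ≡ 1 [MOD N] ∧ q ≡ ν [MOD l ^ e] := by
  have h8N : Nat.Coprime 8 N := (Nat.coprime_two_left.2 hN).pow_left 3
  have hlodd : Odd l := hl.odd_of_ne_two hl2
  have h8l : Nat.Coprime 8 (l ^ e) := ((Nat.coprime_two_left.2 hlodd).pow_left 3).pow_right e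
  have hNl : Nat.Coprime (8 * N) (l ^ e) :=
    h8l.mul_left (((Nat.Prime.coprime_iff_not_dvd hl).2 hlN).symm.pow_right e)
  obtain ⟨k, hk8, hkN⟩ := Nat.chineseRemainder h8N 5 1
  obtain ⟨j, hjk, hjl⟩ := Nat.chineseRemainder hNl k ν
  have hj8 : j ≡ 5 [MOD 8] := (hjk.of_mul_right N).trans hk8
  have hjN : j ≡ 1 [MOD N] := (hjk.of_mul_left 8).trans hkN
  have hcop : j.Coprime (8 * N * l ^ e) := by
    refine Nat.Coprime.mul_right (Nat.Coprime.mul_right ?_ ?_) ?_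
    · rw [Nat.Coprime, hj8.gcd_eq]
      decide
    · rw [Nat.Coprime, hjN.gcd_eq]
      simp
    · rw [Nat.Coprime, hjl.gcd_eq]
      exact hν.pow_right e
  have hN0 : N ≠ 0 := by rintro rfl; simp at hN
  obtain ⟨q, hqn, hq, hqj⟩ := Nat.forall_exists_prime_gt_and_modEq n
    (mul_ne_zero (mul_ne_zero (by norm_num) hN0) (pow_ne_zero e hl.ne_zero)) hcop
  refine ⟨q, hqn, hq, ?_, ?_, ?_⟩
  · exact ((hqj.of_mul_right _).of_mul_right _).trans hj8
  · exact ((hqj.of_mul_right _).of_mul_left _).trans hjN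
  · exact (hqj.of_mul_left _).trans hjl

theorem exists_jacobiSym_eq_neg_one {l : ℕ} (hl : l.Prime) (hl2 : l ≠ 2) :
    ∃ ν : ℕ, jacobiSym ν l = -1 := by
  have : Fact l.Prime := ⟨hl⟩
  obtain ⟨a, ha⟩ := FiniteField.exists_nonsquare (F := ZMod l) (by rwa [ZMod.ringChar_zmod_n])
  refine ⟨a.val, ?_⟩
  rw [ZMod.nonsquare_iff_jacobiSym_eq_neg_one]
  simpa using ha

theorem jacobiSym_two_mul_pow_mul {l e g q ν : ℕ} (hl : Odd l) (he : Odd e) (hg : Odd g)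
    (hν : jacobiSym ν l = -1) (hq8 : q % 8 = 5) (hqg : q ≡ 1 [MOD g])
    (hqν : q ≡ ν [MOD l ^ e]) : jacobiSym (2 * l ^ e * g : ℕ) q = 1 := by
  have hqo : Odd q := Nat.odd_iff.2 (by omega)
  have h2 : jacobiSym 2 q = -1 := by
    rw [jacobiSym.at_two hqo, ZMod.χ₈_nat_eq_if_mod_eight]
    simp [hq8]; omega
  have hl' : jacobiSym l q = -1 := by
    rw [jacobiSym.quadratic_reciprocity_one_mod_four' hl (by omega), ← hν]
    refine jacobiSym.mod_left' ?_
    have := hqν.of_dvd (dvd_pow_self l he.pos.ne')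
    exact_mod_cast congrArg (Nat.cast : ℕ → ℤ) this
  push_cast
  rw [jacobiSym.mul_left, jacobiSym.mul_left, jacobiSym.pow_left, h2, hl', he.neg_one_pow,
    jacobiSym_of_modEq_one hg (by omega) hqg]
  norm_num

theorem NormForm.of_modEq_one {q D : ℕ} (hq : q.Prime) (hq4 : q % 4 = 1) (hD : Odd D)
    (h : q ≡ 1 [MOD D]) : NormForm q D ∧ NormForm D q := by
  have : Fact q.Prime := ⟨hq⟩
  have hJ := jacobiSym_of_modEq_one hD hq4 h
  have hc := coprime_of_jacobiSym hq.ne_zero hJ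
  exact ⟨NormForm.of_isSquareMod hq.pos hD.pos hc.symm (.of_modEq_one h) (.of_jacobiSym hJ),
    NormForm.of_isSquareMod hD.pos hq.pos hc (.of_jacobiSym hJ) (.of_modEq_one h)⟩

theorem NormForm.neg_one {q : ℕ} (hq : q.Prime) (hq4 : q % 4 = 1) : NormForm q (-1) := by
  have : Fact q.Prime := ⟨hq⟩
  obtain ⟨c, d, hcd⟩ := Nat.Prime.sq_add_sq (p := q) (by omega)
  have hd : (d : ℚ) ≠ 0 := by
    rintro h
    have : d = 0 := by exact_mod_cast h
    subst this
    exact hq.prime.not_isSquare ⟨c, by rw [← hcd]; ring⟩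
  refine ⟨c / d, 1 / d, ?_⟩
  have : (c : ℚ) ^ 2 + d ^ 2 = q := by exact_mod_cast hcd
  rw [← this]
  field_simp
  ring

theorem NormForm.intCast {q : ℕ} {H : ℤ} (hq : q.Prime) (hq4 : q % 4 = 1) (hH : Odd H)
    (h : q ≡ 1 [MOD H.natAbs]) : NormForm q H := by
  have h1 := (NormForm.of_modEq_one hq hq4 (Int.natAbs_odd.2 hH) h).1
  rcases Int.natAbs_eq H with h' | h'
  · rw [h', Int.cast_natCast]
    exact h1
  · rw [h']
    have := h1.mul (NormForm.neg_one hq hq4)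
    simpa using this

theorem exists_primes_normForm {B C l : ℕ} (hB : Odd B) (hC : Odd C) (hBC : B.Coprime C)
    (hl : l.Prime) (hlB : Odd (padicValNat l B)) (t : ℤ) :
    ∃ q q' : ℕ, q.Prime ∧ q'.Prime ∧ q % 8 = 5 ∧ q' ≠ 2 ∧
      NormForm (2 * B / C * (q ^ 2 + 1) + q) q' ∧ NormForm (2 * B / C) (q * q') ∧
      NormForm q (1 - 2 * B / C * t ^ 2) := by
  obtain ⟨e, g₀, hlg, hBe⟩ := Nat.exists_eq_pow_mul_and_not_dvd hB.pos.ne' l hl.ne_one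
  have : Fact l.Prime := ⟨hl⟩
  have hg₀0 : g₀ ≠ 0 := by rintro rfl; simp at hlg
  have he : Odd e := by
    rwa [hBe, padicValNat.mul (pow_ne_zero _ hl.ne_zero) hg₀0, padicValNat.prime_pow,
      padicValNat.eq_zero_of_not_dvd hlg, add_zero] at hlB
  have hlB' : l ∣ B := hBe ▸ (dvd_pow_self l he.pos.ne').mul_right g₀
  have hlo : Odd l := hB.of_dvd_nat hlB'
  have hl2 : l ≠ 2 := by rintro rfl; revert hlo; decide
  have hlC : ¬ l ∣ C := fun h => hl.one_lt.ne' (Nat.dvd_one.1 (hBC ▸ Nat.dvd_gcd hlB' h))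
  have hg₀ : Odd g₀ := (Nat.odd_mul.1 (hBe ▸ hB)).2
  set g := g₀ * C with hg_def
  have hg : Odd g := hg₀.mul hC
  have hlg : ¬ l ∣ g := fun h => (hl.dvd_mul.1 h).elim hlg hlC
  obtain ⟨ν, hν⟩ := exists_jacobiSym_eq_neg_one hl hl2
  have hνl : ν.Coprime l := by
    have : NeZero l := ⟨hl.ne_zero⟩
    by_contra hc
    have : jacobiSym ν l = 0 := jacobiSym.eq_zero_iff_not_coprime.2 (by simpa using hc)
    omega
  set H : ℤ := C * (C - 2 * B * t ^ 2) with hH_def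
  have hH : Odd H := by
    refine Odd.mul (by exact_mod_cast hC) (Odd.sub_even (by exact_mod_cast hC) ?_)
    exact ⟨B * t ^ 2, by ring⟩
  have hlH : ¬ l ∣ H.natAbs := by
    intro h
    rw [Int.natAbs_mul] at h
    rcases hl.dvd_mul.1 h with h | h
    · exact hlC (by simpa using h)
    · rw [← Int.natCast_dvd, dvd_sub_left] at h
      · exact hlC (by exact_mod_cast h)
      · exact ((Int.natCast_dvd_natCast.2 hlB').mul_left 2).mul_right _
  obtain ⟨q, -, hq, hq8, hqN, hqν⟩ := exists_prime_modEq (e := e) hl hl2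
    (hg.mul (Int.natAbs_odd.2 hH)) (fun h => (hl.dvd_mul.1 h).elim hlg hlH) hνl 0
  have hqo : Odd q := Nat.odd_iff.2 (by omega)
  have hql : q ≠ l := by
    rintro rfl
    have h1 := hqν.of_dvd (dvd_pow_self q he.pos.ne')
    have h2 : q ∣ ν := (Nat.modEq_zero_iff_dvd.1 (h1.symm.trans (by simp [Nat.ModEq])))
    exact hl.one_lt.ne' (Nat.dvd_one.1 (hνl ▸ Nat.dvd_gcd h2 dvd_rfl))
  set K := C * (2 * B * (q ^ 2 + 1) + q * C) with hK_def
  have hK : Odd K := by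
    refine hC.mul (Even.add_odd ?_ (hqo.mul hC))
    exact ⟨B * (q ^ 2 + 1), by ring⟩
  have hlK : ¬ l ∣ K := by
    intro h
    rcases hl.dvd_mul.1 h with h | h
    · exact hlC h
    · rw [Nat.dvd_add_right ((hlB'.mul_left 2).mul_right _)] at h
      rcases hl.dvd_mul.1 h with h | h
      · exact hql ((Nat.prime_dvd_prime_iff_eq hl hq).1 h).symm
      · exact hlC h
  obtain ⟨q', hqq', hq', hq8', hqN', hqν'⟩ := exists_prime_modEq (e := e) hl hl2
    (hg.mul hK) (fun h => (hl.dvd_mul.1 h).elim hlg hlK) hνl q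
  have hC0 : (C : ℚ) ≠ 0 := by exact_mod_cast hC.pos.ne'
  refine ⟨q, q', hq, hq', hq8, by omega, ?_, ?_, ?_⟩
  · have h1 := (NormForm.of_modEq_one hq' (by omega) hK (hqN'.of_mul_left _)).2
    have h2 := h1.of_mul_sq (s := 1 / C) (by positivity)
    convert h2 using 1
    rw [hK_def]
    push_cast
    field_simp
  · have hG : 2 * l ^ e * g = 2 * B * C := by rw [hBe]; ring
    have : Fact q.Prime := ⟨hq⟩
    have : Fact q'.Prime := ⟨hq'⟩
    have hJ := jacobiSym_two_mul_pow_mul hlo he hg hν hq8 (hqN.of_mul_right _) hqν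
    have hJ' := jacobiSym_two_mul_pow_mul hlo he hg hν hq8' (hqN'.of_mul_right _) hqν'
    have hc := coprime_of_jacobiSym hq.ne_zero hJ
    have hc' := coprime_of_jacobiSym hq'.ne_zero hJ'
    have hqq : q.Coprime q' := (Nat.coprime_primes hq hq').2 hqq'.ne
    have h2l : (2 : ℕ).Coprime (l ^ e) := (Nat.coprime_two_left.2 hlo).pow_right e
    have h2lg : (2 * l ^ e).Coprime g :=
      (Nat.coprime_two_left.2 hg).mul_left (((Nat.Prime.coprime_iff_not_dvd hl).2 hlg).pow_left e)
    have hsq : IsSquareMod (2 * l ^ e * g) (q * q' : ℕ) := by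
      refine IsSquareMod.mul h2lg (IsSquareMod.mul h2l ?_ ?_) ?_
      · refine .of_modEq_one (Nat.odd_iff.1 (hqo.mul (Nat.odd_iff.2 (by omega))))
      · exact .of_modEq_sq (s := ν) (by rw [sq]; exact hqν.mul hqν')
      · exact .of_modEq_one (by simpa using (hqN.of_mul_right _).mul (hqN'.of_mul_right _))
    have h1 := NormForm.of_isSquareMod (a := 2 * l ^ e * g) (b := q * q')
      (by have := hl.pos; have := hg.pos; positivity) (mul_pos hq.pos hq'.pos)
      (hc.mul_right hc') (.mul hqq (.of_jacobiSym hJ) (.of_jacobiSym hJ')) hsq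
    rw [hG] at h1
    have h2 := h1.of_mul_sq (s := 1 / C) (by positivity)
    convert h2 using 1
    · push_cast
      field_simp
    · push_cast
      rfl
  · have h1 := NormForm.intCast hq (by omega) hH (hqN.of_mul_left _)
    have h2 := h1.sq_mul (1 / C)
    convert h2 using 1
    rw [hH_def]
    push_cast
    field_simp

theorem exists_odd_padicValNat_of_not_isSquare {n : ℕ} (h : ¬ IsSquare n) :
    ∃ l : ℕ, l.Prime ∧ Odd (padicValNat l n) := by
  have hn : n ≠ 0 := by rintro rfl; exact h (.zero)
  obtain ⟨s, b, hsb, hs⟩ := Nat.sq_mul_squarefree n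
  have hs1 : s ≠ 1 := by
    rintro rfl
    exact h ⟨b, by rw [← hsb]; ring⟩
  have hs0 : s ≠ 0 := hs.ne_zero
  have hb0 : b ≠ 0 := by rintro rfl; simp at hsb; omega
  have hl := Nat.minFac_prime hs1
  have : Fact s.minFac.Prime := ⟨hl⟩
  refine ⟨s.minFac, hl, ?_⟩
  have h1 : padicValNat s.minFac s = 1 := by
    rw [← Nat.factorization_def _ hl]
    have h2 := hs.natFactorization_le_one s.minFac
    have h3 := hl.factorization_pos_of_dvd hs0 s.minFac_dvd
    omega
  rw [← hsb, padicValNat.mul (pow_ne_zero _ hb0) hs0, padicValNat.pow, h1]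
  exact ⟨_, rfl⟩

theorem exists_normForm_of_int {x : ℚ} (hx : 0 < x) (hnum : Odd x.num) (hden : Odd x.den)
    (hsq : ¬ IsSquare x) (t : ℤ) :
    ∃ (a : ℚ) (q q' : ℕ), (a = 2 * x ∨ a = 2 / x) ∧ q.Prime ∧ q'.Prime ∧ q % 8 = 5 ∧ q' ≠ 2 ∧
      NormForm (a * (q ^ 2 + 1) + q) q' ∧ NormForm a (q * q') ∧
      NormForm q (1 - a * t ^ 2) := by
  obtain ⟨n, hn⟩ : ∃ n : ℕ, x.num = n := Int.eq_ofNat_of_zero_le (Rat.num_pos.2 hx).le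
  have hn_odd : Odd n := by rw [hn] at hnum; exact_mod_cast hnum
  have hxn : x = n / x.den := by
    conv_lhs => rw [← Rat.num_div_den x, hn]
    rfl
  have hcop : n.Coprime x.den := by simpa [hn] using x.reduced
  have hd0 : (x.den : ℚ) ≠ 0 := by exact_mod_cast x.den_nz
  have hn0 : (n : ℚ) ≠ 0 := by exact_mod_cast hn_odd.pos.ne'
  by_cases hns : IsSquare n
  · have hds : ¬ IsSquare x.den := by
      intro hds
      apply hsq
      rw [hxn]
      exact (Rat.isSquare_natCast_iff.2 hns).div (Rat.isSquare_natCast_iff.2 hds)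
    obtain ⟨l, hl, hlo⟩ := exists_odd_padicValNat_of_not_isSquare hds
    obtain ⟨q, q', h⟩ := exists_primes_normForm hden hn_odd hcop.symm hl hlo t
    refine ⟨2 * x.den / n, q, q', Or.inr ?_, h⟩
    have hxd := x.mul_den_eq_num
    rw [hn, Int.cast_natCast] at hxd
    field_simp
    linarith
  · obtain ⟨l, hl, hlo⟩ := exists_odd_padicValNat_of_not_isSquare hns
    obtain ⟨q, q', h⟩ := exists_primes_normForm hn_odd hden hcop hl hlo t
    refine ⟨2 * n / x.den, q, q', Or.inl ?_, h⟩
    have hxd := x.mul_den_eq_num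
    rw [hn, Int.cast_natCast] at hxd
    field_simp
    linarith

theorem jacobiSym_two_eq_neg_one {m : ℕ} (hm : m % 8 = 5) : jacobiSym 2 m = -1 := by
  rw [jacobiSym.at_two (Nat.odd_iff.2 (by omega)), ZMod.χ₈_nat_eq_if_mod_eight]
  simp [hm]; omega

theorem jacobiSym_eq_neg_one_of_mod_eight {p m : ℕ} (hp : Odd p) (hm : m % 8 = 5)
    (h : jacobiSym (2 * p) m = 1) : jacobiSym m p = -1 := by
  rw [jacobiSym.mul_left, jacobiSym_two_eq_neg_one hm] at h
  rw [jacobiSym.quadratic_reciprocity_one_mod_four (by omega) hp]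
  omega

theorem jacobiSym_two_mul_eq_neg_one {p m : ℕ} (hp : p % 4 = 1) (hm : (p * m) % 8 = 5)
    (h : jacobiSym (2 * p) m = 1) : jacobiSym (2 * m) p = -1 := by
  have hpm : Odd (p * m) := Nat.odd_iff.2 (by omega)
  obtain ⟨hpo, hmo⟩ := Nat.odd_mul.1 hpm
  have h2 : jacobiSym 2 p * jacobiSym 2 m = -1 := by
    rw [← jacobiSym.mul_right' _ hpo.pos.ne' hmo.pos.ne']
    exact jacobiSym_two_eq_neg_one hm
  rw [jacobiSym.mul_left, jacobiSym.quadratic_reciprocity_one_mod_four hp hmo] at h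
  rw [jacobiSym.mul_left]
  have h3 : jacobiSym 2 m ^ 2 = 1 := jacobiSym.sq_one (by
    simpa [Int.gcd] using Nat.coprime_two_left.2 hmo)
  linear_combination jacobiSym 2 p * jacobiSym 2 m * h + h2 - jacobiSym 2 p * jacobiSym (m : ℤ) p * h3

theorem not_normForm_of_jacobiSym {p m e : ℕ} {n t : ℤ} (hp : p.Prime) (hp2 : p ≠ 2)
    (hpm : ¬ p ∣ m) (hpt : ¬ (p : ℤ) ∣ t) (hM : p ^ e * m % 8 = 5)
    (he : Odd e → p % 4 = 1) (h : jacobiSym (2 * p) m = 1) :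
    ¬ NormForm (p ^ e * m : ℕ) (p * (p * n - 2 * t ^ 2)) := by
  intro hN
  have : Fact p.Prime := ⟨hp⟩
  have hp0 : (p : ℚ) ≠ 0 := by exact_mod_cast hp.ne_zero
  have hpo := hp.odd_of_ne_two hp2
  set g : ℤ := p * n - 2 * t ^ 2 with hg_def
  have hpt2 : ¬ (p : ℤ) ∣ 2 * t ^ 2 := by
    intro hd
    rcases (Nat.prime_iff_prime_int.1 hp).dvd_or_dvd hd with hd | hd
    · have := (Nat.prime_dvd_prime_iff_eq hp Nat.prime_two).1 (by exact_mod_cast hd)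
      exact hp2 this
    · exact hpt ((Nat.prime_iff_prime_int.1 hp).dvd_of_dvd_pow hd)
  have hpg : ¬ (p : ℤ) ∣ g := fun hd =>
    hpt2 ((dvd_sub_right (dvd_mul_right _ _)).1 hd)
  have hg0 : (g : ℚ) ≠ 0 := by
    have : g ≠ 0 := by rintro h; simp [h] at hpg
    exact_mod_cast this
  have hvg : padicValRat p (g : ℚ) = 0 := by
    rw [padicValRat.of_int, padicValInt.eq_zero_of_not_dvd hpg]; rfl
  have hgq : ((p : ℚ) * (p * n - 2 * t ^ 2)) = p * g := by rw [hg_def]; push_cast; ring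
  rw [hgq] at hN
  have hsq8 : ∀ f : ℕ, p ^ (2 * f) % 8 = 1 := by
    intro f
    have h1 : p ^ 2 % 8 = 1 := by
      have : p % 8 = 1 ∨ p % 8 = 3 ∨ p % 8 = 5 ∨ p % 8 = 7 := by
        have := Nat.odd_iff.1 hpo
        omega
      rw [Nat.pow_mod]
      rcases this with h | h | h | h <;> simp [h]
    rw [pow_mul, Nat.pow_mod, h1, one_pow, Nat.one_mod]
  have hm0 : (m : ℚ) ≠ 0 := by
    rintro h
    have : m = 0 := by exact_mod_cast h
    simp [this] at hpm
  rcases Nat.even_or_odd' e with ⟨f, rfl | rfl⟩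
  · have hm8 : m % 8 = 5 := by
      rw [Nat.mul_mod, hsq8] at hM
      omega
    have h1 := hN.of_mul_sq (s := 1 / (p : ℚ) ^ f) (by positivity)
    have h2 : ((p ^ (2 * f) * m : ℕ) : ℚ) * (1 / (p : ℚ) ^ f) ^ 2 = (m : ℤ) := by
      push_cast
      field_simp
      ring
    rw [h2] at h1
    have h3 := h1.even_padicValRat (jacobiSym_eq_neg_one_of_mod_eight hpo hm8 h)
      (mul_ne_zero hp0 hg0)
    rw [padicValRat.mul hp0 hg0, hvg, padicValRat.self hp.one_lt] at h3
    revert h3; decide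
  · have hm8 : (p * m) % 8 = 5 := by
      have : p ^ (2 * f + 1) * m = p ^ (2 * f) * (p * m) := by ring
      rw [this, Nat.mul_mod, hsq8] at hM
      omega
    have hp4 := he ⟨f, rfl⟩
    obtain ⟨u, w, huw⟩ := hN
    have hJ : jacobiSym (-(g * m)) p = -1 := by
      rw [← jacobiSym_two_mul_eq_neg_one hp4 hm8 h]
      have h1 : jacobiSym (-(g * m)) p = jacobiSym (2 * m * t ^ 2) p := by
        apply jacobiSym.mod_left'
        apply Int.ModEq.symm
        rw [Int.modEq_iff_dvd]
        exact ⟨- n * m, by rw [hg_def]; ring⟩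
      have h2 : jacobiSym (t ^ 2) p = 1 := by
        apply jacobiSym.sq_one'
        rw [Int.gcd_comm]
        exact (Int.isCoprime_iff_gcd_eq_one.1
          ((Nat.prime_iff_prime_int.1 hp).coprime_iff_not_dvd.2 hpt))
      rw [h1, jacobiSym.mul_left, h2, mul_one]
    obtain ⟨h1, h2⟩ := even_padicValRat_sq_sub_mul_sq hJ
      (u := (m : ℚ) * p ^ f * w) (w := 1) (Or.inr one_ne_zero)
    have h3 : ((m : ℚ) * p ^ f * w) ^ 2 - (-(g * m) : ℤ) * 1 ^ 2 = m * (u ^ 2 / p) := by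
      have : u ^ 2 = p * g + p ^ (2 * f + 1) * m * w ^ 2 := by
        push_cast at huw
        linarith
      rw [this]
      push_cast
      field_simp
      ring
    rw [h3] at h1 h2
    have hu : u ≠ 0 := by
      rintro rfl
      simp at h1
    have hvm : padicValRat p (m : ℚ) = 0 := by
      rw [padicValRat.of_nat, padicValNat.eq_zero_of_not_dvd hpm]; rfl
    rw [padicValRat.mul hm0 (by positivity), padicValRat.div (by positivity) hp0,
      padicValRat.pow, hvm, padicValRat.self hp.one_lt] at h2
    push_cast at h2
    rw [zero_add, Int.even_sub] at h2
    exact absurd (h2.1 (even_two_mul _)) (by decide)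

theorem num_mul_den_emod_eight {z w : ℚ} (hz : z = 8 * w + 5) (hw : Odd w.den)
    (hzd : Odd z.den) : z.num * z.den % 8 = 5 := by
  have h1 : z.num * (w.den : ℤ) = z.den * (8 * w.num + 5 * w.den) := by
    have h2 := z.mul_den_eq_num
    have h3 := w.mul_den_eq_num
    have : (z.num : ℚ) * w.den = z.den * (8 * w.num + 5 * w.den) := by
      rw [← h2, ← h3, hz]
      ring
    exact_mod_cast this
  have sq8 : ∀ {n : ℕ}, Odd n → ∃ i : ℤ, (n : ℤ) ^ 2 = 8 * i + 1 := by
    rintro n ⟨k, rfl⟩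
    obtain ⟨i, hi⟩ := Int.even_mul_succ_self (k : ℤ)
    exact ⟨i, by push_cast; linear_combination 4 * hi⟩
  obtain ⟨i, hi⟩ := sq8 hw
  obtain ⟨j, hj⟩ := sq8 hzd
  have : z.num * z.den = 8 * (w.num * w.den * z.den ^ 2 + 5 * j * (8 * i + 1) + 5 * i
      - z.num * z.den * i) + 5 := by
    linear_combination (z.den * w.den : ℤ) * h1 - (z.num * z.den : ℤ) * hi + 5 * (w.den : ℤ) ^ 2 * hj
      + 5 * (8 * j + 1) * hi
  omega

theorem even_padicValRat_iff {v N D : ℕ} [Fact v.Prime] (hN : N ≠ 0) (hD : D ≠ 0) :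
    Even (padicValRat v (N / D : ℚ)) ↔ Even (padicValNat v (N * D)) := by
  rw [padicValRat.div (by exact_mod_cast hN) (by exact_mod_cast hD), padicValRat.of_nat,
    padicValRat.of_nat, padicValNat.mul hN hD, Int.even_sub, Nat.even_add]
  simp

theorem jacobiSym_two_mul_eq_one_of_normForm {p v N D : ℕ} {g : ℤ} {z' : ℚ} (hv : v.Prime)
    (hv2p : ¬ v ∣ 2 * p) (hND : N.Coprime D) (hN : N ≠ 0) (hD : D ≠ 0)
    (hodd : Odd (padicValNat v (N * D))) (hz' : z' ≠ 0)
    (h1 : NormForm (2 * p * (N ^ 2 + D ^ 2) + g * N * D : ℤ) z')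
    (h2 : NormForm (2 * p : ℤ) (N / D * z')) : jacobiSym (2 * p) v = 1 := by
  have : Fact v.Prime := ⟨hv⟩
  have hcop : ∀ {k : ℕ}, ¬ v ∣ k → (k : ℤ).gcd v = 1 := by
    intro k hk
    simpa using ((Nat.Prime.coprime_iff_not_dvd hv).2 hk).symm
  by_contra hne
  have hJ : jacobiSym (2 * p) v = -1 := by
    have := jacobiSym.eq_one_or_neg_one (hcop hv2p)
    push_cast at this
    tauto
  have hN0 : (N : ℚ) ≠ 0 := by exact_mod_cast hN
  have hD0 : (D : ℚ) ≠ 0 := by exact_mod_cast hD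
  have hJK : jacobiSym (2 * p * (N ^ 2 + D ^ 2) + g * N * D : ℤ) v = -1 := by
    have hdvd : v ∣ N * D := by
      by_contra h
      rw [padicValNat.eq_zero_of_not_dvd h] at hodd
      revert hodd; decide
    have aux : ∀ k : ℕ, ¬ v ∣ k → jacobiSym (2 * p * k ^ 2) v = -1 := by
      intro k hk
      rw [jacobiSym.mul_left, hJ, jacobiSym.sq_one' (hcop hk), mul_one]
    rcases hv.dvd_mul.1 hdvd with h | h
    · rw [← aux D fun h' => hv.one_lt.ne' (Nat.dvd_one.1 (hND ▸ Nat.dvd_gcd h h'))]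
      apply jacobiSym.mod_left'
      apply Int.ModEq.symm
      rw [Int.modEq_iff_dvd]
      obtain ⟨k, rfl⟩ := h
      exact ⟨2 * p * k * (v * k) + g * k * D, by push_cast; ring⟩
    · rw [← aux N fun h' => hv.one_lt.ne' (Nat.dvd_one.1 (hND ▸ Nat.dvd_gcd h' h))]
      apply jacobiSym.mod_left'
      apply Int.ModEq.symm
      rw [Int.modEq_iff_dvd]
      obtain ⟨k, rfl⟩ := h
      exact ⟨2 * p * k * (v * k) + g * N * k, by push_cast; ring⟩
  have he1 := h1.even_padicValRat hJK hz'
  have he2 := h2.even_padicValRat hJ (mul_ne_zero (div_ne_zero hN0 hD0) hz')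
  rw [padicValRat.mul (div_ne_zero hN0 hD0) hz', Int.even_add, even_padicValRat_iff hN hD] at he2
  exact Nat.not_even_iff_odd.2 hodd (he2.2 he1)

theorem false_of_normForms_of_dvd_den {p : ℕ} (hp : p.Prime) (hp2 : p ≠ 2)
    {a z z' t w c d : ℚ} (ha : a = 2 * p ∨ a = 2 / p) (hz : z = 8 * w + 5) (hw : Odd w.den)
    (hzd : Odd z.den) (hcd : z = c ^ 2 + d ^ 2) (hz' : z' ≠ 0) (hpt : p ∣ t.den)
    (h1 : NormForm (a * (z ^ 2 + 1) + z) z') (h2 : NormForm a (z * z'))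
    (h3 : NormForm z (1 - a * t ^ 2)) : False := by
  have : Fact p.Prime := ⟨hp⟩
  have hp0 : (p : ℚ) ≠ 0 := by exact_mod_cast hp.ne_zero
  have hpo := hp.odd_of_ne_two hp2
  have hM8 := num_mul_den_emod_eight hz hw hzd
  have hz0 : 0 ≤ z := by rw [hcd]; positivity
  obtain ⟨N, hN⟩ : ∃ N : ℕ, z.num = N := Int.eq_ofNat_of_zero_le (Rat.num_nonneg.2 hz0)
  have hND : N.Coprime z.den := by simpa [hN] using z.reduced
  have hzND : z = N / z.den := by
    conv_lhs => rw [← Rat.num_div_den z, hN]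
    rfl
  generalize z.den = D at *
  rw [hN] at hM8
  have hM8' : N * D % 8 = 5 := by exact_mod_cast hM8
  have hMo : Odd (N * D) := Nat.odd_iff.2 (by omega)
  obtain ⟨hNo, hDo⟩ := Nat.odd_mul.1 hMo
  have hN0' := hNo.pos.ne'
  have hD0' := hDo.pos.ne'
  have hN0 : (N : ℚ) ≠ 0 := by exact_mod_cast hN0'
  have hD0 : (D : ℚ) ≠ 0 := by exact_mod_cast hD0'
  have h2p : NormForm (2 * p : ℤ) (N / D * z') := by
    rw [← hzND]
    rcases ha with rfl | rfl
    · exact_mod_cast h2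
    · convert h2.of_mul_sq hp0 using 1
      push_cast
      field_simp
  obtain ⟨g, hg⟩ : ∃ g : ℤ, NormForm (2 * p * (N ^ 2 + D ^ 2) + g * N * D : ℤ) z' := by
    rcases ha with rfl | rfl
    · refine ⟨1, ?_⟩
      convert h1.of_mul_sq hD0 using 1
      rw [hzND]
      push_cast
      field_simp
    · refine ⟨p ^ 2, ?_⟩
      convert h1.of_mul_sq (mul_ne_zero hp0 hD0) using 1
      rw [hzND]
      push_cast
      field_simp
  obtain ⟨e, m, hpm, hNDm⟩ := Nat.exists_eq_pow_mul_and_not_dvd hMo.pos.ne' p hp.ne_one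
  have hm0 : m ≠ 0 := by rintro rfl; simp at hpm
  have hmo : Odd m := (Nat.odd_mul.1 (hNDm ▸ hMo)).2
  have hJm : jacobiSym (2 * p) m = 1 := by
    refine jacobiSym_eq_one_of_pow_padicValNat fun v hv hvm => ?_
    have : Fact v.Prime := ⟨hv⟩
    have hvp : ¬ v ∣ p := by
      intro h
      exact hpm ((Nat.prime_dvd_prime_iff_eq hv hp).1 h ▸ hvm)
    have hv2p : ¬ v ∣ 2 * p := by
      intro h
      rcases hv.dvd_mul.1 h with h | h
      · rw [(Nat.prime_dvd_prime_iff_eq hv Nat.prime_two).1 h] at hvm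
        exact Nat.not_even_iff_odd.2 hmo (even_iff_two_dvd.2 hvm)
      · exact hvp h
    have hval : padicValNat v m = padicValNat v (N * D) := by
      rw [hNDm, padicValNat.mul (pow_ne_zero _ hp.ne_zero) hm0, padicValNat.pow,
        padicValNat.eq_zero_of_not_dvd hvp, mul_zero, zero_add]
    rcases Nat.even_or_odd (padicValNat v m) with he | ho
    · obtain ⟨k, hk⟩ := he
      rw [hk, ← two_mul, pow_mul, jacobiSym.sq_one, one_pow]
      exact_mod_cast (Int.gcd_natCast_natCast (2 * p) v).trans
        ((Nat.Prime.coprime_iff_not_dvd hv).2 hv2p).symm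
    · rw [jacobiSym_two_mul_eq_one_of_normForm hv hv2p hND hN0' hD0' (hval ▸ ho) hz' hg h2p,
        one_pow]
  have he4 : Odd e → p % 4 = 1 := by
    intro heo
    by_contra hp4
    have hp3 : p % 4 = 3 := by
      have := Nat.odd_iff.1 hpo
      omega
    have hJ : jacobiSym (-1) p = -1 := by
      rw [jacobiSym.at_neg_one hpo, ZMod.χ₄_nat_three_mod_four hp3]
    have hz1 : NormForm (-1 : ℤ) (N / D) := ⟨c, d, by rw [← hzND, hcd]; push_cast; ring⟩
    have := hz1.even_padicValRat hJ (div_ne_zero hN0 hD0)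
    rw [even_padicValRat_iff hN0' hD0', hNDm, padicValNat.mul (pow_ne_zero _ hp.ne_zero) hm0,
      padicValNat.prime_pow, padicValNat.eq_zero_of_not_dvd hpm, add_zero] at this
    exact Nat.not_even_iff_odd.2 heo this
  obtain ⟨s, hs⟩ := hpt
  have hpn : ¬ (p : ℤ) ∣ t.num := by
    intro h
    refine hp.one_lt.ne' (Nat.dvd_one.1 (t.reduced ▸ Nat.dvd_gcd (Int.natCast_dvd.1 h) ?_))
    exact hs ▸ dvd_mul_right _ _
  have hs0 : (s : ℚ) ≠ 0 := by
    intro h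
    have : s = 0 := by exact_mod_cast h
    exact t.den_nz (by rw [hs, this, mul_zero])
  have ht : t = t.num / (p * s) := by
    conv_lhs => rw [← Rat.num_div_den t, hs]
    push_cast
    rfl
  have h4 : NormForm (p ^ e * m : ℕ) (1 - a * t ^ 2) := by
    convert h3.of_mul_sq hD0 using 1
    rw [← hNDm, hzND]
    push_cast
    field_simp
  generalize t.num = k at *
  rcases ha with rfl | rfl
  · refine not_normForm_of_jacobiSym (n := s ^ 2) hp hp2 hpm hpn (hNDm ▸ hM8') he4 hJm ?_
    convert h4.sq_mul (p * s) using 1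
    rw [ht]
    push_cast
    field_simp
  · refine not_normForm_of_jacobiSym (n := (p * s) ^ 2) hp hp2 hpm hpn (hNDm ▸ hM8') he4 hJm ?_
    convert h4.sq_mul (p * (p * s)) using 1
    rw [ht]
    push_cast
    field_simp

/-- The set of odd prime numbers. -/
def oddPrimes : Set ℕ := {p | p.Prime ∧ p ≠ 2}

theorem hasNatDensity_oddPrimes : HasNatDensity oddPrimes 1 := by
  have hcard : ∀ X, (primesUpTo Set.univ X).card = Nat.primeCounting X := by
    intro X
    rw [Nat.primeCounting, Nat.primeCounting', Nat.count_eq_card_filter_range, primesUpTo]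
    congr 1
    ext p
    simp
  have hW : ∀ X, 2 ≤ X → (primesUpTo oddPrimes X).card + 1 = Nat.primeCounting X := by
    intro X hX
    have h2 : 2 ∈ primesUpTo Set.univ X := by
      simp only [primesUpTo, Finset.mem_filter, Finset.mem_range]
      exact ⟨by omega, Nat.prime_two, trivial⟩
    rw [← hcard, ← Finset.card_erase_add_one h2]
    congr 2
    ext p
    simp only [primesUpTo, Finset.mem_filter, Finset.mem_erase]
    simp only [oddPrimes, Set.mem_ofPred_eq, Set.mem_univ]
    tauto
  have htop : Filter.Tendsto (fun X : ℕ => (Nat.primeCounting X : ℝ)) Filter.atTop Filter.atTop :=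
    tendsto_natCast_atTop_atTop.comp Nat.tendsto_primeCounting
  have hlim : Filter.Tendsto (fun X : ℕ => 1 - (Nat.primeCounting X : ℝ)⁻¹) Filter.atTop
      (nhds (1 - 0)) := tendsto_const_nhds.sub htop.inv_tendsto_atTop
  rw [sub_zero] at hlim
  refine hlim.congr' ?_
  filter_upwards [Filter.eventually_ge_atTop 2, htop.eventually_gt_atTop 0] with X hX hpos
  rw [hcard, ← hW X hX]
  rw [← hW X hX] at hpos
  push_cast at hpos ⊢
  field_simp
  ring

theorem mem_ringOfPrimes_oddPrimes {x : ℚ} : x ∈ ringOfPrimes oddPrimes ↔ Odd x.den := by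
  change (∀ p : ℕ, p.Prime → p ∣ x.den → p ∈ oddPrimes) ↔ _
  constructor
  · intro h
    by_contra hodd
    exact (h 2 Nat.prime_two (even_iff_two_dvd.1 (Nat.not_odd_iff_even.1 hodd))).2 rfl
  · rintro h p hp hd
    refine ⟨hp, ?_⟩
    rintro rfl
    exact Nat.not_even_iff_odd.2 h (even_iff_two_dvd.2 hd)

theorem mem_ringOfPrimes_of_mul_eq {x : ℚ} {n : ℕ} {k : ℤ} (hn : Odd n) (h : x * n = k) :
    x ∈ ringOfPrimes oddPrimes := by
  have hn0 : (n : ℚ) ≠ 0 := by exact_mod_cast hn.pos.ne'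
  have hx : x = (k : ℚ) / ((n : ℤ) : ℚ) := by
    rw [eq_div_iff (by exact_mod_cast hn0)]
    exact_mod_cast h
  rw [mem_ringOfPrimes_oddPrimes]
  refine hn.of_dvd_nat ?_
  have := Rat.den_dvd k n
  rw [hx]
  exact_mod_cast this

/-- The polynomial defining `ℤ` in the ring of rationals with odd denominator. -/
def definingPoly {R : Type*} [CommRing R] (t x : R) (y : Fin 18 → R) : R :=
  (x + y 14 ^ 2 + y 15 ^ 2 + y 16 ^ 2 + y 17 ^ 2) * (x - y 14 ^ 2) * (x - 2 * y 14) *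
    (((y 0 - 2 * x) * (y 0 * x - 2)) ^ 2 + (y 1 - (8 * y 2 + 5)) ^ 2 +
      (y 1 - (y 3 ^ 2 + y 4 ^ 2)) ^ 2 + (y 5 * y 6 - 1) ^ 2 +
      (y 7 ^ 2 - (1 + y 14 ^ 2 + y 15 ^ 2 + y 16 ^ 2 + y 17 ^ 2)) ^ 2 +
      (y 5 * y 7 ^ 2 - (y 8 ^ 2 - (y 0 * (y 1 ^ 2 + 1) + y 1) * y 9 ^ 2)) ^ 2 +
      (y 1 * y 5 * y 7 ^ 2 - (y 10 ^ 2 - y 0 * y 11 ^ 2)) ^ 2 +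
      ((1 - y 0 * t ^ 2) * y 7 ^ 2 - (y 12 ^ 2 - y 1 * y 13 ^ 2)) ^ 2)

theorem map_definingPoly {R S G : Type*} [CommRing R] [CommRing S] [FunLike G R S]
    [RingHomClass G R S] (f : G) (t x : R) (y : Fin 18 → R) :
    f (definingPoly t x y) = definingPoly (f t) (f x) (fun i => f (y i)) := by
  simp [definingPoly, map_ofNat f]

theorem exists_aeval_definingPoly_iff {A : Subring ℚ} (t x : A) :
    (∃ y : Fin 18 → A, MvPolynomial.aeval (Sum.elim ![t, x] y)
      (definingPoly (MvPolynomial.X (Sum.inl 0)) (MvPolynomial.X (Sum.inl 1))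
        (fun i => MvPolynomial.X (Sum.inr i)) : MvPolynomial (Fin 2 ⊕ Fin 18) ℤ) = 0) ↔
    ∃ y : Fin 18 → ℚ, (∀ i, y i ∈ A) ∧ definingPoly (t : ℚ) x y = 0 := by
  have key : ∀ y : Fin 18 → A, MvPolynomial.aeval (Sum.elim ![t, x] y)
      (definingPoly (MvPolynomial.X (Sum.inl 0)) (MvPolynomial.X (Sum.inl 1))
        (fun i => MvPolynomial.X (Sum.inr i)) : MvPolynomial (Fin 2 ⊕ Fin 18) ℤ) = 0 ↔
      definingPoly (t : ℚ) x (fun i => (y i : ℚ)) = 0 := by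
    intro y
    rw [map_definingPoly]
    simp only [MvPolynomial.aeval_X, Sum.elim_inl, Sum.elim_inr, Matrix.cons_val_zero,
      Matrix.cons_val_one]
    rw [← Subring.subtype_apply t, ← Subring.subtype_apply x]
    change _ ↔ definingPoly (A.subtype t) (A.subtype x) (fun i => A.subtype (y i)) = 0
    rw [← map_definingPoly A.subtype, map_eq_zero_iff _ A.subtype_injective]
  constructor
  · rintro ⟨y, hy⟩
    exact ⟨fun i => y i, fun i => (y i).2, (key y).1 hy⟩
  · rintro ⟨y, hyA, hy⟩
    exact ⟨fun i => ⟨y i, hyA i⟩, (key _).2 hy⟩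

theorem isInt_of_forall_exists_definingPoly {t : ℚ} (ht : t ∈ ringOfPrimes oddPrimes)
    (h : ∀ x ∈ ringOfPrimes oddPrimes, ∃ y : Fin 18 → ℚ,
      (∀ i, y i ∈ ringOfPrimes oddPrimes) ∧ definingPoly t x y = 0) :
    ∃ n : ℤ, t = n := by
  by_contra hint
  have hden : t.den ≠ 1 := fun h1 => hint ⟨t.num, (Rat.den_eq_one_iff t).1 h1 |>.symm⟩
  obtain ⟨p, hp, hpt⟩ := Nat.exists_prime_and_dvd hden
  have hpo := (ht p hp hpt).2
  have hpodd := hp.odd_of_ne_two hpo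
  have hp0 : (0 : ℚ) < p := by exact_mod_cast hp.pos
  obtain ⟨y, hy, hP⟩ := h p (natCast_mem _ p)
  rw [definingPoly] at hP
  rcases mul_eq_zero.1 hP with hP | hP
  · rcases mul_eq_zero.1 hP with hP | hP
    · rcases mul_eq_zero.1 hP with hP | hP
      · exact absurd hP (by positivity)
      · exact hp.prime.not_isSquare (Rat.isSquare_natCast_iff.1 ⟨y 14, by linear_combination hP⟩)
    · have h14 := mem_ringOfPrimes_oddPrimes.1 (hy 14)
      have h1 : (p : ℚ) * (y 14).den = 2 * (y 14).num := by
        rw [← Rat.mul_den_eq_num]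
        linear_combination (y 14).den * hP
      have h2 : ((p * (y 14).den : ℕ) : ℤ) = 2 * (y 14).num := by
        push_cast
        exact_mod_cast h1
      have h3 := Nat.odd_iff.1 (hpodd.mul h14)
      omega
  · have sq_add : ∀ {u v : ℚ}, 0 ≤ u → u + v ^ 2 = 0 → u = 0 ∧ v = 0 := by
      intro u v hu huv
      have := sq_nonneg v
      exact ⟨by linarith, pow_eq_zero_iff two_ne_zero |>.1 (by linarith)⟩
    obtain ⟨hP, e8⟩ := sq_add (by positivity) hP
    obtain ⟨hP, e7⟩ := sq_add (by positivity) hP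
    obtain ⟨hP, e6⟩ := sq_add (by positivity) hP
    obtain ⟨hP, e5⟩ := sq_add (by positivity) hP
    obtain ⟨hP, e4⟩ := sq_add (by positivity) hP
    obtain ⟨hP, e3⟩ := sq_add (by positivity) hP
    obtain ⟨hP, e2⟩ := sq_add (by positivity) hP
    have e1 := pow_eq_zero_iff two_ne_zero |>.1 hP
    have hS : y 7 ≠ 0 := by
      intro h0
      rw [h0] at e5
      have : (0 : ℚ) < 1 + y 14 ^ 2 + y 15 ^ 2 + y 16 ^ 2 + y 17 ^ 2 := by positivity
      linarith
    have norm : ∀ {κ c u w : ℚ}, c * y 7 ^ 2 - (u ^ 2 - κ * w ^ 2) = 0 → NormForm κ c := by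
      intro κ c u w hc
      refine ⟨u / y 7, w / y 7, ?_⟩
      field_simp
      linarith
    refine false_of_normForms_of_dvd_den hp hpo (a := y 0) (z := y 1) (z' := y 5) (w := y 2) ?_
      (sub_eq_zero.1 e2) (mem_ringOfPrimes_oddPrimes.1 (hy 2)) (mem_ringOfPrimes_oddPrimes.1 (hy 1))
      (sub_eq_zero.1 e3) ?_ hpt (norm e6) (norm e7) (norm e8)
    · rcases mul_eq_zero.1 e1 with h1 | h1
      · exact Or.inl (sub_eq_zero.1 h1)
      · right
        rw [eq_div_iff hp0.ne']
        exact sub_eq_zero.1 h1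
    · rintro h0
      simp [h0] at e4

theorem exists_definingPoly_of_int (n : ℤ) {x : ℚ} (hx : x ∈ ringOfPrimes oddPrimes) :
    ∃ y : Fin 18 → ℚ, (∀ i, y i ∈ ringOfPrimes oddPrimes) ∧ definingPoly (n : ℚ) x y = 0 := by
  have hxd := mem_ringOfPrimes_oddPrimes.1 hx
  have hd0 : (x.den : ℚ) ≠ 0 := by exact_mod_cast x.den_nz
  have hxnd := x.mul_den_eq_num
  rcases le_or_gt x 0 with hx0 | hx0
  · obtain ⟨k, hk⟩ : ∃ k : ℕ, -x.num = k :=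
      Int.eq_ofNat_of_zero_le (by have := Rat.num_nonpos.2 hx0; omega)
    obtain ⟨a, b, c, d, habcd⟩ := Nat.sum_four_squares (k * x.den)
    have hmem : ∀ i : ℕ, (i : ℚ) / x.den ∈ ringOfPrimes oddPrimes := fun i =>
      mem_ringOfPrimes_of_mul_eq (k := i) hxd (by field_simp; simp)
    refine ⟨![0, 0, 0, 0, 0, 0, 0, 0, 0, 0, 0, 0, 0, 0, a / x.den, b / x.den, c / x.den,
      d / x.den], ?_, ?_⟩
    · intro i
      fin_cases i <;> first | exact zero_mem _ | exact hmem _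
    · have h1 : x + (a / x.den) ^ 2 + (b / x.den) ^ 2 + (c / x.den) ^ 2 + (d / x.den) ^ 2 = 0 := by
        have h2 : (a : ℚ) ^ 2 + b ^ 2 + c ^ 2 + d ^ 2 = k * x.den := by exact_mod_cast habcd
        have h3 : (x.num : ℚ) = - k := by
          have : x.num = -k := by omega
          rw [this]; push_cast; rfl
        rw [h3] at hxnd
        field_simp
        linear_combination h2 + x.den * hxnd
      rw [definingPoly]
      simp only [mul_eq_zero]
      exact Or.inl (Or.inl (Or.inl h1))
  by_cases hsq : IsSquare x
  · obtain ⟨s, rfl⟩ := hsq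
    refine ⟨![0, 0, 0, 0, 0, 0, 0, 0, 0, 0, 0, 0, 0, 0, s, 0, 0, 0], ?_, ?_⟩
    · have hs : s ∈ ringOfPrimes oddPrimes := by
        rw [mem_ringOfPrimes_oddPrimes]
        rw [Rat.mul_self_den] at hxd
        exact (Nat.odd_mul.1 hxd).1
      intro i
      fin_cases i <;> first | exact zero_mem _ | exact hs
    · rw [definingPoly]
      simp only [mul_eq_zero]
      refine Or.inl (Or.inl (Or.inr ?_))
      change s * s - s ^ 2 = 0
      ring
  rcases Int.even_or_odd x.num with hev | hodd
  · obtain ⟨k, hk⟩ := hev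
    refine ⟨![0, 0, 0, 0, 0, 0, 0, 0, 0, 0, 0, 0, 0, 0, x / 2, 0, 0, 0], ?_, ?_⟩
    · have hs : x / 2 ∈ ringOfPrimes oddPrimes := by
        refine mem_ringOfPrimes_of_mul_eq (k := k) hxd ?_
        rw [hk] at hxnd
        push_cast at hxnd
        linear_combination hxnd / 2
      intro i
      fin_cases i <;> first | exact zero_mem _ | exact hs
    · rw [definingPoly]
      simp only [mul_eq_zero]
      refine Or.inl (Or.inr ?_)
      change x - 2 * (x / 2) = 0
      ring
  obtain ⟨a, q, q', ha, hq, hq', hq8, hq2, ⟨u₁, v₁, h1⟩, ⟨u₂, v₂, h2⟩, ⟨u₃, v₃, h3⟩⟩ :=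
    exists_normForm_of_int hx0 hodd hxd hsq n
  have : Fact q.Prime := ⟨hq⟩
  obtain ⟨c, d, hcd⟩ := Nat.Prime.sq_add_sq (p := q) (by omega)
  obtain ⟨w, hw⟩ : ∃ w : ℕ, q = 8 * w + 5 := ⟨q / 8, by omega⟩
  set S : ℕ := u₁.den * v₁.den * u₂.den * v₂.den * u₃.den * v₃.den with hS
  have hS0 : S ≠ 0 := by positivity
  obtain ⟨s₁, s₂, s₃, s₄, hs⟩ := Nat.sum_four_squares (S ^ 2 - 1)
  have hs' : (S : ℚ) ^ 2 = 1 + s₁ ^ 2 + s₂ ^ 2 + s₃ ^ 2 + s₄ ^ 2 := by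
    have : S ^ 2 = 1 + s₁ ^ 2 + s₂ ^ 2 + s₃ ^ 2 + s₄ ^ 2 := by
      have : 0 < S ^ 2 := by positivity
      omega
    exact_mod_cast this
  have hmemS : ∀ u : ℚ, u.den ∣ S → u * S ∈ ringOfPrimes oddPrimes := by
    rintro u ⟨k, hk⟩
    rw [hk]
    push_cast
    rw [← mul_assoc, Rat.mul_den_eq_num]
    exact mul_mem (intCast_mem _ _) (natCast_mem _ _)
  have hq'0 : (q' : ℚ) ≠ 0 := by exact_mod_cast hq'.ne_zero
  have hr : (1 : ℚ) / q' ∈ ringOfPrimes oddPrimes :=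
    mem_ringOfPrimes_of_mul_eq (k := 1) (hq'.odd_of_ne_two hq2) (by field_simp; simp)
  have ha' : a ∈ ringOfPrimes oddPrimes := by
    rcases ha with rfl | rfl
    · exact mul_mem (ofNat_mem _ 2) hx
    · refine mem_ringOfPrimes_of_mul_eq (n := x.num.natAbs) (k := 2 * x.den)
        (Int.natAbs_odd.2 hodd) ?_
      rw [Nat.cast_natAbs, abs_of_pos (Rat.num_pos.2 hx0), ← hxnd]
      push_cast
      field_simp
  refine ⟨![a, q, w, c, d, q', 1 / q', S, u₁ * S, v₁ * S, u₂ * S, v₂ * S, u₃ * S, v₃ * S,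
    s₁, s₂, s₃, s₄], ?_, ?_⟩
  · intro i
    fin_cases i
    all_goals first
      | exact ha'
      | exact natCast_mem _ _
      | exact hr
      | (refine hmemS _ ?_
         rw [hS]
         repeat first
           | exact dvd_mul_left _ _
           | exact dvd_rfl
           | apply Dvd.dvd.mul_right)
  · rw [definingPoly]
    refine mul_eq_zero_of_right _ ?_
    have hcd' : (c : ℚ) ^ 2 + d ^ 2 = q := by exact_mod_cast hcd
    have hw' : (q : ℚ) = 8 * w + 5 := by exact_mod_cast hw
    have e1 : (a - 2 * x) * (a * x - 2) = 0 := by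
      rcases ha with rfl | rfl
      · ring
      · field_simp
        ring
    have e4 : (q' : ℚ) * (1 / q') - 1 = 0 := by
      field_simp
      ring
    change ((a - 2 * x) * (a * x - 2)) ^ 2 + ((q : ℚ) - (8 * w + 5)) ^ 2 +
      ((q : ℚ) - (c ^ 2 + d ^ 2)) ^ 2 + ((q' : ℚ) * (1 / q') - 1) ^ 2 +
      ((S : ℚ) ^ 2 - (1 + s₁ ^ 2 + s₂ ^ 2 + s₃ ^ 2 + s₄ ^ 2)) ^ 2 +
      (q' * (S : ℚ) ^ 2 - ((u₁ * S) ^ 2 - (a * (q ^ 2 + 1) + q) * (v₁ * S) ^ 2)) ^ 2 +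
      (q * q' * (S : ℚ) ^ 2 - ((u₂ * S) ^ 2 - a * (v₂ * S) ^ 2)) ^ 2 +
      ((1 - a * n ^ 2) * (S : ℚ) ^ 2 - ((u₃ * S) ^ 2 - q * (v₃ * S) ^ 2)) ^ 2 = 0
    rw [e1, e4, ← hw', hcd', ← hs', h2, h3, h1]
    ring

/-- (Poonen) For every `ε > 0` there is a set `W` of primes whose natural density
exists and is greater than `1 - ε`, such that `ℤ` is definable over `O_{ℚ,W}` by a
`∀∃`-formula with a single universal quantifier: there are `k ∈ ℕ` and a polynomial
`F` over `ℤ` in `2 + k` variables such that `t ∈ ℤ` iff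
`∀ x ∃ y₁ … y_k, F(t, x, y₁, …, y_k) = 0` holds in `O_{ℚ,W}`. -/
theorem poonen_one_universal_quantifier_big_ring (ε : ℝ) (hε : 0 < ε) :
    ∃ (W : Set ℕ) (d : ℝ), (∀ p ∈ W, p.Prime) ∧ HasNatDensity W d ∧ 1 - ε < d ∧
      ∃ (k : ℕ) (F : MvPolynomial (Fin 2 ⊕ Fin k) ℤ),
        ∀ t : ringOfPrimes W,
          (∃ n : ℤ, (t : ℚ) = (n : ℚ)) ↔
            ∀ x : ringOfPrimes W, ∃ y : Fin k → ringOfPrimes W,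
              MvPolynomial.aeval (Sum.elim ![t, x] y) F = 0 := by
  refine ⟨oddPrimes, 1, fun p hp => hp.1, hasNatDensity_oddPrimes, by linarith, 18,
    definingPoly (MvPolynomial.X (Sum.inl 0)) (MvPolynomial.X (Sum.inl 1))
      (fun i => MvPolynomial.X (Sum.inr i)), fun t => ?_⟩
  simp only [exists_aeval_definingPoly_iff]
  constructor
  · rintro ⟨n, hn⟩ x
    rw [hn]
    exact exists_definingPoly_of_int n x.2
  · intro h
    exact isInt_of_forall_exists_definingPoly t.2 fun x hx => h ⟨x, hx⟩
end

section
/- (Koenigsmann) ℤ is definable over ℚ by a ∀∃-formula with a single universal quantifier: there exist k ∈ ℕ and a polynomial F with rational coefficients in 2 + k variables such that for every t ∈ ℚ, t ∈ ℤ if and only if for all x ∈ ℚ there exist y₁,…,y_k ∈ ℚ with F(t, x, y₁,…,y_k) = 0. -/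
/-- `b` is a value of the norm form `x ^ 2 - a * y ^ 2` over `K`. -/
def IsNormForm {K : Type*} [Field K] (a b : K) : Prop := ∃ x y : K, x ^ 2 - a * y ^ 2 = b

namespace IsNormForm

variable {K : Type*} [Field K] {a b c : K}

theorem mul (hb : IsNormForm a b) (hc : IsNormForm a c) : IsNormForm a (b * c) := by
  obtain ⟨x, y, rfl⟩ := hb
  obtain ⟨z, w, rfl⟩ := hc
  exact ⟨x * z + a * y * w, x * w + y * z, by ring⟩

theorem sq (a c : K) : IsNormForm a (c ^ 2) := ⟨c, 0, by ring⟩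

theorem one (a : K) : IsNormForm a 1 := ⟨1, 0, by ring⟩

theorem neg_self (a : K) : IsNormForm a (-a) := ⟨0, 1, by ring⟩

theorem inv (hb : IsNormForm a b) : IsNormForm a b⁻¹ := by
  rcases eq_or_ne b 0 with rfl | h
  · simpa using hb
  · have := hb.mul (sq a b⁻¹)
    rwa [show b * b⁻¹ ^ 2 = b⁻¹ by field_simp] at this

theorem of_mul_left (hb : IsNormForm a b) (h : IsNormForm a (b * c)) (h0 : b ≠ 0) :
    IsNormForm a c := by
  have := hb.inv.mul h
  rwa [inv_mul_cancel_left₀ h0] at this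

theorem mul_sq_right_iff (hc : c ≠ 0) : IsNormForm a (b * c ^ 2) ↔ IsNormForm a b := by
  refine ⟨fun h ↦ (sq a c).of_mul_left (by rwa [mul_comm] at h) (pow_ne_zero 2 hc),
    fun h ↦ h.mul (sq a c)⟩

theorem mul_sq_left_iff (hc : c ≠ 0) : IsNormForm (a * c ^ 2) b ↔ IsNormForm a b := by
  constructor
  · rintro ⟨x, y, h⟩
    exact ⟨x, c * y, by rw [← h]; ring⟩
  · rintro ⟨x, y, h⟩
    exact ⟨x, y / c, by rw [← h]; field_simp⟩

theorem of_isSquare_right (h : IsSquare b) : IsNormForm a b := by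
  obtain ⟨r, rfl⟩ := h
  exact ⟨r, 0, by ring⟩

theorem of_isSquare_left [NeZero (2 : K)] (h : IsSquare a) (ha : a ≠ 0) : IsNormForm a b := by
  obtain ⟨r, rfl⟩ := h
  have hr : r ≠ 0 := by rintro rfl; simp at ha
  have h2 : (2 : K) ≠ 0 := NeZero.ne 2
  refine ⟨(b + 1) / 2, (b - 1) / (2 * r), ?_⟩
  field_simp
  ring

theorem symm [NeZero (2 : K)] (h : IsNormForm a b) (hb : b ≠ 0) : IsNormForm b a := by
  obtain ⟨x, y, h⟩ := h
  rcases eq_or_ne y 0 with rfl | hy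
  · exact of_isSquare_left ⟨x, by rw [← h]; ring⟩ hb
  · exact ⟨x / y, 1 / y, by rw [← h]; field_simp; ring⟩

theorem map {L : Type*} [Field L] (f : K →+* L) (h : IsNormForm a b) :
    IsNormForm (f a) (f b) := by
  obtain ⟨x, y, rfl⟩ := h
  exact ⟨f x, f y, by simp⟩

theorem iff_of_sq_sub {t d : K} (hb : b ≠ 0) (hd : d ≠ 0) (h : t ^ 2 - a = b * d) :
    IsNormForm a b ↔ IsNormForm a d := by
  have key : IsNormForm a (b * d) := ⟨t, 1, by rw [← h]; ring⟩
  exact ⟨fun hb' ↦ hb'.of_mul_left key hb,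
    fun hd' ↦ hd'.of_mul_left (by rwa [mul_comm] at key) hd⟩

end IsNormForm

theorem Int.exists_sq_mul_squarefree {n : ℤ} (hn : n ≠ 0) :
    ∃ c m : ℤ, c ≠ 0 ∧ Squarefree m ∧ n = m * c ^ 2 := by
  obtain ⟨a, b, hab, ha⟩ := Nat.sq_mul_squarefree n.natAbs
  have hb : b ≠ 0 := by rintro rfl; simp at hab; omega
  refine ⟨b, n.sign * a, by exact_mod_cast hb, ?_, ?_⟩
  · rw [← Int.squarefree_natAbs]
    simpa [Int.natAbs_mul, Int.natAbs_sign_of_ne_zero hn] using ha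
  · conv_lhs => rw [← Int.sign_mul_natAbs n, ← hab]
    push_cast; ring

theorem Rat.exists_sq_mul_squarefree {q : ℚ} (hq : q ≠ 0) :
    ∃ (c : ℚ) (m : ℤ), c ≠ 0 ∧ Squarefree m ∧ q = m * c ^ 2 := by
  obtain ⟨c, m, hc, hm, h⟩ := Int.exists_sq_mul_squarefree
    (n := q.num * q.den) (by simp [hq])
  refine ⟨c / q.den, m, by simp [hc], hm, ?_⟩
  have h' : (q.num : ℚ) * q.den = m * c ^ 2 := by exact_mod_cast h
  have hd : (q.den : ℚ) ≠ 0 := by simp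
  conv_lhs => rw [← Rat.num_div_den q]
  field_simp
  linear_combination h'

/-- A quadratic residue modulo every prime factor of a squarefree `n` is one modulo `n`. -/
theorem Nat.exists_sq_sub_of_squarefree (a : ℤ) (n : ℕ) (hn : Squarefree n)
    (h : ∀ p, p.Prime → p ∣ n → ∃ t : ℤ, (p : ℤ) ∣ t ^ 2 - a) : ∃ t : ℤ, (n : ℤ) ∣ t ^ 2 - a := by
  induction n using Nat.recOnMul with
  | zero => simp at hn
  | one => exact ⟨0, by simp⟩
  | prime p hp => exact h p hp dvd_rfl
  | mul m k ihm ihk =>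
    obtain ⟨hco, hm, hk⟩ := Nat.squarefree_mul_iff.1 hn
    obtain ⟨s, hs⟩ := ihm hm fun p hp hd ↦ h p hp (hd.mul_right _)
    obtain ⟨t, ht⟩ := ihk hk fun p hp hd ↦ h p hp (hd.mul_left _)
    have hco' : IsCoprime (m : ℤ) k := Nat.isCoprime_iff_coprime.2 hco
    obtain ⟨u, v, huv⟩ := id hco'
    refine ⟨s * (v * k) + t * (u * m), ?_⟩
    push_cast
    refine hco'.mul_dvd ?_ ?_
    · have : (s * (v * k) + t * (u * m)) ^ 2 - a = (s ^ 2 - a) + m * (u * (t - s) *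
          (2 * s + u * m * (t - s))) := by
        rw [show v * (k:ℤ) = 1 - u * m by linarith]; ring
      rw [this]; exact dvd_add hs (dvd_mul_right _ _)
    · have : (s * (v * k) + t * (u * m)) ^ 2 - a = (t ^ 2 - a) + k * (v * (s - t) *
          (2 * t + v * k * (s - t))) := by
        rw [show u * (m:ℤ) = 1 - v * k by linarith]; ring
      rw [this]; exact dvd_add ht (dvd_mul_right _ _)

section Padic

variable {p : ℕ} [hp : Fact p.Prime]

theorem Padic.norm_le_inv_of_norm_lt_one {x : ℚ_[p]} (hx : ‖x‖ < 1) : ‖x‖ ≤ (p : ℝ)⁻¹ := by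
  have := (Padic.norm_le_pow_iff_norm_lt_pow_add_one x (-1)).2 (by simpa using hx)
  simpa using this

theorem Padic.norm_sq_ne_inv (x : ℚ_[p]) : ‖x‖ ^ 2 ≠ (p : ℝ)⁻¹ := by
  intro h
  have hx : x ≠ 0 := by
    rintro rfl
    exact hp.out.ne_zero (by simpa using h.symm)
  rw [Padic.norm_eq_zpow_neg_valuation hx, ← zpow_natCast, ← zpow_mul, ← zpow_neg_one] at h
  have := zpow_right_injective₀ (by exact_mod_cast hp.out.pos) (by exact_mod_cast hp.out.ne_one) h
  push_cast at this
  omega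

theorem IsNormForm.exists_sq_sub_of_padic {a b : ℤ} (hb : Squarefree b) (hpb : (p : ℤ) ∣ b)
    (h : IsNormForm (a : ℚ_[p]) b) : ∃ t : ℤ, (p : ℤ) ∣ t ^ 2 - a := by
  have hp1 : (1 : ℝ) < p := by exact_mod_cast hp.out.one_lt
  have hbn : ‖(b : ℚ_[p])‖ = (p : ℝ)⁻¹ := by
    obtain ⟨c, rfl⟩ := hpb
    have hc : ¬ (p : ℤ) ∣ c := by
      intro hc
      have := hb p (mul_dvd_mul_left _ hc)
      exact (Nat.prime_iff_prime_int.1 hp.out).not_isUnit this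
    have : ‖(c : ℚ_[p])‖ = 1 := by
      refine le_antisymm (Padic.norm_int_le_one c) (not_lt.1 fun h ↦ hc ?_)
      exact (Padic.norm_intCast_lt_one_iff).1 h
    simp [this]
  obtain ⟨x, y, hxy⟩ := h
  have ha1 := Padic.norm_int_le_one (p := p) a
  by_cases hy : 1 ≤ ‖y‖
  · have hy0 : y ≠ 0 := by rintro rfl; simp at hy; linarith
    have e : (x / y) ^ 2 - a = b / y ^ 2 := by rw [← hxy]; field_simp
    have h1 : ‖(x / y) ^ 2 - a‖ < 1 := by
      rw [e, norm_div, hbn, norm_pow]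
      have : (p : ℝ)⁻¹ < 1 := inv_lt_one_of_one_lt₀ hp1
      have h3 : 1 ≤ ‖y‖ ^ 2 := one_le_pow₀ hy
      rw [div_lt_one (by positivity)]
      linarith
    have h2 : ‖x / y‖ ≤ 1 := by
      have h4 : ‖(x / y) ^ 2‖ ≤ 1 := by
        have := Padic.nonarchimedean ((x / y) ^ 2 - (a : ℚ_[p])) a
        rw [sub_add_cancel] at this
        exact this.trans (max_le h1.le ha1)
      rw [norm_pow] at h4
      exact (pow_le_one_iff_of_nonneg (norm_nonneg _) two_ne_zero).1 h4
    obtain ⟨t, ht⟩ := PadicInt.exists_mem_range (p := p) ⟨x / y, h2⟩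
    refine ⟨t, ?_⟩
    have ht2 : ‖x / y - t‖ < 1 := by
      have := ht.2
      rwa [IsLocalRing.mem_maximalIdeal, PadicInt.mem_nonunits, PadicInt.norm_def] at this
    rw [← Padic.norm_intCast_lt_one_iff]
    push_cast
    have e2 : ((t : ℚ_[p]) ^ 2 - a) = ((x / y) ^ 2 - a) + -((x / y - t) * (x / y + t)) := by ring
    rw [e2]
    refine lt_of_le_of_lt (Padic.nonarchimedean _ _) (max_lt h1 ?_)
    rw [norm_neg, norm_mul]
    refine mul_lt_one_of_nonneg_of_lt_one_left (norm_nonneg _) ht2 ?_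
    refine (Padic.nonarchimedean _ _).trans (max_le h2 ?_)
    exact_mod_cast Padic.norm_int_le_one (p := p) t
  · exfalso
    have hy := Padic.norm_le_inv_of_norm_lt_one (not_le.1 hy)
    have hay : ‖a * y ^ 2‖ < (p : ℝ)⁻¹ := by
      rw [norm_mul, norm_pow]
      have hpi : 0 < (p : ℝ)⁻¹ := by positivity
      have : (p : ℝ)⁻¹ < 1 := inv_lt_one_of_one_lt₀ hp1
      have h5 : ‖y‖ ^ 2 ≤ (p : ℝ)⁻¹ ^ 2 := by gcongr
      nlinarith [norm_nonneg (a : ℚ_[p]), sq_nonneg ‖y‖]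
    refine Padic.norm_sq_ne_inv x ?_
    rw [← norm_pow, show x ^ 2 = b + a * y ^ 2 by rw [← hxy]; ring,
      Padic.add_eq_max_of_ne (by rw [hbn]; exact hay.ne'), hbn, max_eq_left hay.le]

end Padic

theorem Int.exists_sq_sub_eq_mul {a b : ℤ} (hb : b ≠ 0) (h : ∃ t, b ∣ t ^ 2 - a) :
    ∃ t d : ℤ, t ^ 2 - a = b * d ∧ 2 * |t| ≤ |b| := by
  obtain ⟨t, c, h⟩ := h
  have hpos : 0 < b.natAbs := Int.natAbs_pos.2 hb
  have key : b ∣ (Int.bmod t b.natAbs) ^ 2 - a := by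
    have h1 : (b.natAbs : ℤ) ∣ Int.bmod t b.natAbs - t := Int.dvd_bmod_sub_self
    rw [Int.natAbs_dvd] at h1
    have : (Int.bmod t b.natAbs) ^ 2 - a =
        (t ^ 2 - a) + (Int.bmod t b.natAbs - t) * (Int.bmod t b.natAbs + t) := by ring
    rw [this]
    exact dvd_add ⟨c, h⟩ (h1.mul_right _)
  obtain ⟨d, hd⟩ := key
  refine ⟨_, d, hd, ?_⟩
  have h1 := Int.le_bmod (x := t) hpos
  have h2 := Int.bmod_le (x := t) hpos
  rw [Int.abs_eq_natAbs b]
  have := abs_le.2 (⟨by omega, by omega⟩ : -((b.natAbs : ℤ) / 2) ≤ Int.bmod t b.natAbs ∧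
    Int.bmod t b.natAbs ≤ (b.natAbs : ℤ) / 2)
  omega

theorem not_isNormForm_neg_one_neg_one_padic_two : ¬ IsNormForm (-1 : ℚ_[2]) (-1) := by
  have key (x y : ℚ_[2]) (hx : ‖x‖ ≤ 1) (hy : ‖y‖ ≤ 1) : x ^ 2 + y ^ 2 + 1 ≠ 0 := by
    intro h
    obtain ⟨x, rfl⟩ : ∃ u : ℤ_[2], (u : ℚ_[2]) = x := ⟨⟨x, hx⟩, rfl⟩
    obtain ⟨y, rfl⟩ : ∃ u : ℤ_[2], (u : ℚ_[2]) = y := ⟨⟨y, hy⟩, rfl⟩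
    have h' : x ^ 2 + y ^ 2 + 1 = 0 := PadicInt.ext (by push_cast; exact h)
    have h4 := congrArg (PadicInt.toZModPow (p := 2) 2) h'
    simp only [map_add, map_pow, map_one, map_zero] at h4
    revert h4
    generalize PadicInt.toZModPow 2 x = u
    generalize PadicInt.toZModPow 2 y = v
    revert u v
    decide
  have key' (x y : ℚ_[2]) (h : x ^ 2 + y ^ 2 + 1 = 0) (hle : ‖y‖ ≤ ‖x‖) : False := by
    by_cases hx : ‖x‖ ≤ 1
    · exact key x y hx (hle.trans hx) h
    · have hx0 : x ≠ 0 := by rintro rfl; simp at hx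
      refine key (y / x) (1 / x) ?_ ?_ ?_
      · rw [norm_div]; exact div_le_one_of_le₀ hle (norm_nonneg _)
      · rw [norm_div, norm_one]
        exact div_le_one_of_le₀ (not_le.1 hx).le (norm_nonneg _)
      · field_simp
        linear_combination h
  rintro ⟨x, y, h⟩
  rcases le_total ‖y‖ ‖x‖ with hle | hle
  · exact key' x y (by linear_combination h) hle
  · exact key' y x (by linear_combination h) hle

/-- The Hasse principle for ternary quadratic forms, by Legendre's descent. -/
theorem IsNormForm.of_forall_padic_of_squarefree (n : ℕ) : ∀ a b : ℤ, a.natAbs + b.natAbs ≤ n →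
    Squarefree a → Squarefree b →
    (∀ (p : ℕ) [Fact p.Prime], IsNormForm (a : ℚ_[p]) b) → IsNormForm (a : ℚ) b := by
  induction n with
  | zero =>
    intro a b h ha
    have := ha.ne_zero
    omega
  | succ n ih =>
    intro a b hn ha hb hab
    wlog hle : a.natAbs ≤ b.natAbs generalizing a b
    · have ha0 : (a : ℚ) ≠ 0 := by exact_mod_cast ha.ne_zero
      refine (this b a (by omega) hb ha (fun p _ ↦ ?_) (by omega)).symm ha0
      exact (hab p).symm (by exact_mod_cast hb.ne_zero)
    have ha0 : a ≠ 0 := ha.ne_zero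
    have hb0 : b ≠ 0 := hb.ne_zero
    rcases Nat.lt_or_ge b.natAbs 2 with hb1 | hb2
    · have ha' : a = 1 ∨ a = -1 := by omega
      have hb' : b = 1 ∨ b = -1 := by omega
      rcases hb' with rfl | rfl
      · exact of_isSquare_right ⟨1, by simp⟩
      rcases ha' with rfl | rfl
      · exact of_isSquare_left ⟨1, by simp⟩ (by simp)
      · exact absurd (by simpa using hab 2) not_isNormForm_neg_one_neg_one_padic_two
    obtain ⟨t, d, htd, ht⟩ := Int.exists_sq_sub_eq_mul (a := a) hb0 <| by
      obtain ⟨t, ht⟩ := Nat.exists_sq_sub_of_squarefree a b.natAbs (Int.squarefree_natAbs.2 hb)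
        fun p hp hpb ↦ by
          have : Fact p.Prime := ⟨hp⟩
          exact (hab p).exists_sq_sub_of_padic hb (Int.natCast_dvd.2 hpb)
      exact ⟨t, Int.natAbs_dvd.1 ht⟩
    rcases eq_or_ne d 0 with rfl | hd
    · refine of_isSquare_left ⟨t, ?_⟩ (by exact_mod_cast ha0)
      have : a = t * t := by linarith [pow_two t]
      exact_mod_cast this
    obtain ⟨c, e, hc, he, rfl⟩ := Int.exists_sq_mul_squarefree hd
    have iff_e (K : Type) [Field K] [CharZero K] :
        IsNormForm (a : K) b ↔ IsNormForm (a : K) e := by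
      have h : (t : K) ^ 2 - a = b * (e * c ^ 2) := by exact_mod_cast congrArg (Int.cast : ℤ → K) htd
      rw [← mul_sq_right_iff (b := (e : K)) (c := (c : K)) (by exact_mod_cast hc)]
      exact iff_of_sq_sub (by exact_mod_cast hb0) (by exact_mod_cast hd) h
    refine (iff_e ℚ).2 (ih a e ?_ ha he fun p _ ↦ (iff_e _).1 (hab p))
    suffices e.natAbs < b.natAbs by omega
    have hc2 : 0 < c ^ 2 := by positivity
    have h1 : |b| * |e| ≤ |t| ^ 2 + |a| :=
      calc |b| * |e| ≤ |b| * |e| * c ^ 2 :=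
            le_mul_of_one_le_right (by positivity) hc2
        _ = |t ^ 2 - a| := by rw [htd, abs_mul, abs_mul, abs_of_pos hc2, mul_assoc]
        _ ≤ |t ^ 2| + |a| := abs_sub _ _
        _ = |t| ^ 2 + |a| := by rw [abs_pow]
    zify at hb2 hle ⊢
    nlinarith [abs_nonneg t]

theorem IsNormForm.of_forall_padic {a b : ℚ} (ha : a ≠ 0) (hb : b ≠ 0)
    (h : ∀ (p : ℕ) [Fact p.Prime], IsNormForm (a : ℚ_[p]) b) : IsNormForm a b := by
  obtain ⟨c, m, hc, hm, rfl⟩ := Rat.exists_sq_mul_squarefree ha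
  obtain ⟨d, n, hd, hn, rfl⟩ := Rat.exists_sq_mul_squarefree hb
  rw [mul_sq_left_iff hc, mul_sq_right_iff hd]
  refine of_forall_padic_of_squarefree _ m n le_rfl hm hn fun p _ ↦ ?_
  have := h p
  push_cast at this
  rwa [mul_sq_left_iff (by exact_mod_cast hc), mul_sq_right_iff (by exact_mod_cast hd)] at this

theorem exists_not_isNormForm_padic_of_neg {a b : ℚ} (ha : a < 0) (hb : b < 0) :
    ∃ (p : ℕ) (_ : Fact p.Prime), ¬ IsNormForm (a : ℚ_[p]) b := by
  by_contra! h
  obtain ⟨x, y, hxy⟩ := IsNormForm.of_forall_padic ha.ne hb.ne fun p hp ↦ h p hp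
  nlinarith [sq_nonneg x, sq_nonneg y, mul_nonneg (neg_pos.2 ha).le (sq_nonneg y)]

section Local

variable {p : ℕ} [hp : Fact p.Prime]

theorem PadicInt.isSquare_of_norm_sub_lt {z a : ℤ_[p]} (h : ‖a ^ 2 - z‖ < ‖2 * a‖ ^ 2) :
    IsSquare z := by
  obtain ⟨w, hw, -⟩ := hensels_lemma (p := p) (R := ℤ_[p]) (F := Polynomial.X ^ 2 - Polynomial.C z)
    (a := a) (by simpa [Polynomial.derivative_X_pow, one_add_one_eq_two] using h)
  exact ⟨w, by simpa [sub_eq_zero, pow_two, eq_comm] using hw⟩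

theorem PadicInt.norm_eq_one_of_toZMod_ne_zero {z : ℤ_[p]} (hz : PadicInt.toZMod z ≠ 0) :
    ‖z‖ = 1 := by
  rw [← PadicInt.isUnit_iff]
  by_contra h
  rw [← mem_nonunits_iff, ← IsLocalRing.mem_maximalIdeal, ← PadicInt.ker_toZMod] at h
  exact hz h

theorem PadicInt.toZMod_ne_zero {z : ℤ_[p]} (hz : IsUnit z) : PadicInt.toZMod z ≠ 0 :=
  (hz.map PadicInt.toZMod).ne_zero

theorem PadicInt.toZMod_surjective' (x : ZMod p) : ∃ z : ℤ_[p], PadicInt.toZMod z = x :=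
  ZMod.ringHom_surjective _ x

theorem PadicInt.isSquare_of_toZMod (h2 : p ≠ 2) {z : ℤ_[p]} (hz : PadicInt.toZMod z ≠ 0)
    (h : IsSquare (PadicInt.toZMod z)) : IsSquare z := by
  obtain ⟨r, hr⟩ := h
  obtain ⟨a, rfl⟩ := PadicInt.toZMod_surjective' r
  have ha : ‖a‖ = 1 := norm_eq_one_of_toZMod_ne_zero fun h ↦ hz (by rw [hr, h, zero_mul])
  have h2' : ‖(2 : ℤ_[p])‖ = 1 := by
    apply norm_eq_one_of_toZMod_ne_zero
    rw [map_ofNat]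
    have : ((2 : ℕ) : ZMod p) ≠ 0 := by
      rw [Ne, ZMod.natCast_eq_zero_iff, Nat.prime_dvd_prime_iff_eq hp.out Nat.prime_two]
      exact h2
    exact_mod_cast this
  refine isSquare_of_norm_sub_lt (a := a) ?_
  rw [norm_mul, ha, h2', one_mul, one_pow]
  rw [← PadicInt.mem_nonunits, ← IsLocalRing.mem_maximalIdeal, ← PadicInt.ker_toZMod,
    RingHom.mem_ker, map_sub, map_pow, hr, pow_two, sub_self]

theorem PadicInt.isSquare_of_toZModPow_two {z : ℤ_[2]} (h : PadicInt.toZModPow 3 z = 1) :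
    IsSquare z := by
  refine isSquare_of_norm_sub_lt (a := 1) ?_
  have : (1 : ℤ_[2]) ^ 2 - z ∈ RingHom.ker (PadicInt.toZModPow (p := 2) 3) := by
    rw [RingHom.mem_ker, map_sub, map_pow, map_one, h, one_pow, sub_self]
  rw [PadicInt.ker_toZModPow, ← PadicInt.norm_le_pow_iff_mem_span_pow] at this
  refine this.trans_lt ?_
  have : ‖(2 : ℤ_[2])‖ = 2⁻¹ := by
    have := PadicInt.norm_p (p := 2)
    simpa using this
  rw [mul_one, this]
  norm_num

theorem Padic.exists_padicInt_of_valuation {x : ℚ_[p]} (hx : 0 ≤ x.valuation) :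
    ∃ z : ℤ_[p], (z : ℚ_[p]) = x :=
  ⟨⟨x, (Padic.norm_le_one_iff_val_nonneg x).2 hx⟩, rfl⟩

theorem Padic.exists_unit_of_valuation {x : ℚ_[p]} (h0 : x ≠ 0) (hx : x.valuation = 0) :
    ∃ z : ℤ_[p], IsUnit z ∧ (z : ℚ_[p]) = x := by
  obtain ⟨z, rfl⟩ := exists_padicInt_of_valuation hx.ge
  refine ⟨z, ?_, rfl⟩
  rw [PadicInt.isUnit_iff, ← PadicInt.padic_norm_e_of_padicInt, norm_eq_zpow_neg_valuation h0, hx]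
  simp

theorem PadicInt.toZMod_eq_zero_of_valuation {z : ℤ_[p]} (hz : 0 < (z : ℚ_[p]).valuation) :
    PadicInt.toZMod z = 0 := by
  have h0 : (z : ℚ_[p]) ≠ 0 := by intro h; simp [h] at hz
  by_contra h
  have h1 := norm_eq_one_of_toZMod_ne_zero h
  rw [← PadicInt.padic_norm_e_of_padicInt, Padic.norm_eq_zpow_neg_valuation h0] at h1
  have h2 : ((p : ℝ)) ^ (-(z : ℚ_[p]).valuation) < 1 :=
    zpow_lt_one_of_neg₀ (by exact_mod_cast hp.out.one_lt) (by omega)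
  linarith

theorem PadicInt.isSquare_coe {z : ℤ_[p]} (h : IsSquare z) : IsSquare (z : ℚ_[p]) := by
  obtain ⟨r, rfl⟩ := h
  exact ⟨r, by push_cast; rfl⟩

theorem Padic.isSquare_one_add (h2 : p ≠ 2) {x : ℚ_[p]} (hx : 0 < x.valuation) :
    IsSquare (1 + x) := by
  obtain ⟨z, rfl⟩ := exists_padicInt_of_valuation hx.le
  have hz := PadicInt.toZMod_eq_zero_of_valuation hx
  have := PadicInt.isSquare_coe <| PadicInt.isSquare_of_toZMod (z := 1 + z) h2 (by simp [hz]) (by simp [hz])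
  simpa using this

theorem Padic.isNormForm_of_valuation_eq_zero (h2 : p ≠ 2) {a b : ℚ_[p]} (ha0 : a ≠ 0)
    (hb0 : b ≠ 0) (ha : a.valuation = 0) (hb : b.valuation = 0) : IsNormForm a b := by
  obtain ⟨a, hau, rfl⟩ := exists_unit_of_valuation ha0 ha
  obtain ⟨b, hbu, rfl⟩ := exists_unit_of_valuation hb0 hb
  have ha' := PadicInt.toZMod_ne_zero hau
  have hb' := PadicInt.toZMod_ne_zero hbu
  obtain ⟨x, y, hxy⟩ : ∃ x y : ZMod p, x ^ 2 = PadicInt.toZMod b + PadicInt.toZMod a * y ^ 2 := by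
    obtain ⟨x, y, h⟩ := FiniteField.exists_root_sum_quadratic (R := ZMod p)
      (f := Polynomial.X ^ 2 - Polynomial.C (PadicInt.toZMod b))
      (g := Polynomial.C (-PadicInt.toZMod a) * Polynomial.X ^ 2)
      (Polynomial.degree_X_pow_sub_C (by decide) _)
      (Polynomial.degree_C_mul_X_pow 2 (neg_ne_zero.2 ha'))
      (by rw [ZMod.card]; exact hp.out.eq_two_or_odd.resolve_left h2)
    refine ⟨x, y, ?_⟩
    simp only [Polynomial.eval_sub, Polynomial.eval_pow, Polynomial.eval_X, Polynomial.eval_C,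
      Polynomial.eval_mul] at h
    linear_combination h
  by_cases hx : x = 0
  · obtain ⟨r, hr⟩ := PadicInt.isSquare_coe <| PadicInt.isSquare_of_toZMod (z := -b * a) h2
      (by simp [ha', hb']) ⟨PadicInt.toZMod a * y, by
        rw [hx] at hxy
        simp only [map_mul, map_neg]
        linear_combination PadicInt.toZMod a * hxy⟩
    refine ⟨0, r / a, ?_⟩
    push_cast at hr
    field_simp
    linear_combination hr
  · obtain ⟨y, rfl⟩ := PadicInt.toZMod_surjective' y
    obtain ⟨r, hr⟩ := PadicInt.isSquare_coe <| PadicInt.isSquare_of_toZMod (z := b + a * y ^ 2) h2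
      (by simp [← hxy, hx]) ⟨x, by
        rw [map_add, map_mul, map_pow, ← hxy, pow_two]⟩
    refine ⟨r, y, ?_⟩
    push_cast at hr
    linear_combination -hr

theorem Padic.exists_two_adic_unit_class {x : ℚ_[2]} (h0 : x ≠ 0) (hx : x.valuation = 0) :
    ∃ c : ℕ, (c = 1 ∨ c = 3 ∨ c = 5 ∨ c = 7) ∧ ∃ r : ℚ_[2], r ≠ 0 ∧ x = c * r ^ 2 := by
  obtain ⟨z, hz, rfl⟩ := exists_unit_of_valuation h0 hx
  have hu := hz.map (PadicInt.toZModPow (p := 2) 3)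
  have key : ∀ u : ZMod (2 ^ 3), IsUnit u → u * 1 = 1 ∨ u * 3 = 1 ∨ u * 5 = 1 ∨ u * 7 = 1 := by
    decide
  have : ∃ c : ℕ, (c = 1 ∨ c = 3 ∨ c = 5 ∨ c = 7) ∧ PadicInt.toZModPow (p := 2) 3 (z * c) = 1 := by
    simp only [map_mul, map_natCast]
    rcases key _ hu with h | h | h | h
    · exact ⟨1, by simp, by exact_mod_cast h⟩
    · exact ⟨3, by simp, by exact_mod_cast h⟩
    · exact ⟨5, by simp, by exact_mod_cast h⟩
    · exact ⟨7, by simp, by exact_mod_cast h⟩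
  obtain ⟨c, hc, hzc⟩ := this
  obtain ⟨r, hr⟩ := PadicInt.isSquare_coe (PadicInt.isSquare_of_toZModPow_two hzc)
  push_cast at hr
  have hc0 : (c : ℚ_[2]) ≠ 0 := by
    have : c ≠ 0 := by omega
    exact_mod_cast this
  refine ⟨c, hc, r / c, div_ne_zero ?_ hc0, ?_⟩
  · rintro rfl
    rw [zero_mul] at hr
    exact mul_ne_zero h0 hc0 hr
  · field_simp
    linear_combination hr

/-- Every nonzero `p`-adic number is a power of `p` times a unit. -/
theorem Padic.exists_eq_zpow_mul {x : ℚ_[p]} (h0 : x ≠ 0) :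
    ∃ u : ℚ_[p], u ≠ 0 ∧ u.valuation = 0 ∧ x = (p : ℚ_[p]) ^ x.valuation * u := by
  have hp0 : (p : ℚ_[p]) ≠ 0 := by exact_mod_cast hp.out.ne_zero
  refine ⟨x * (p : ℚ_[p]) ^ (-x.valuation), mul_ne_zero h0 (zpow_ne_zero _ hp0), ?_, ?_⟩
  · rw [valuation_mul h0 (zpow_ne_zero _ hp0), valuation_zpow, valuation_p]; ring
  · rw [mul_comm x, ← mul_assoc, ← zpow_add₀ hp0]; simp

theorem Padic.exists_eq_mul_sq_of_even {x : ℚ_[p]} (h0 : x ≠ 0) (hx : Even x.valuation) :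
    ∃ u r : ℚ_[p], u ≠ 0 ∧ r ≠ 0 ∧ u.valuation = 0 ∧ x = u * r ^ 2 := by
  obtain ⟨u, hu0, hu, h⟩ := exists_eq_zpow_mul h0
  obtain ⟨k, hk⟩ := hx
  refine ⟨u, (p : ℚ_[p]) ^ k, hu0, zpow_ne_zero _ (by exact_mod_cast hp.out.ne_zero), hu, ?_⟩
  rw [h, hk, pow_two, ← zpow_add₀ (by exact_mod_cast hp.out.ne_zero), mul_comm]

theorem Padic.isNormForm_of_even (h2 : p ≠ 2) {a b : ℚ_[p]} (ha0 : a ≠ 0)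
    (hb0 : b ≠ 0) (ha : Even a.valuation) (hb : Even b.valuation) : IsNormForm a b := by
  obtain ⟨u, r, hu0, hr, hu, rfl⟩ := exists_eq_mul_sq_of_even ha0 ha
  obtain ⟨v, s, hv0, hs, hv, rfl⟩ := exists_eq_mul_sq_of_even hb0 hb
  rw [IsNormForm.mul_sq_left_iff hr, IsNormForm.mul_sq_right_iff hs]
  exact isNormForm_of_valuation_eq_zero h2 hu0 hv0 hu hv

theorem Padic.valuation_neg (x : ℚ_[p]) : (-x).valuation = x.valuation := by
  rcases eq_or_ne x 0 with rfl | h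
  · simp
  · have h1 : ((-1 : ℚ_[p]) ^ 2).valuation = 0 := by simp
    rw [valuation_pow] at h1
    rw [← neg_one_mul, valuation_mul (by simp) h]
    push_cast at h1
    omega

theorem Padic.valuation_add_of_lt {x y : ℚ_[p]} (hx : x ≠ 0)
    (h : x.valuation < y.valuation) : x + y ≠ 0 ∧ (x + y).valuation = x.valuation := by
  have h0 : x + y ≠ 0 := by
    intro h'
    rw [eq_neg_of_add_eq_zero_left h', valuation_neg] at h
    exact lt_irrefl _ h
  refine ⟨h0, ?_⟩
  have h1 := le_valuation_add h0
  have h2 := le_valuation_add (x := x + y) (y := -y) (by simpa using hx)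
  rw [valuation_neg, add_neg_cancel_right] at h2
  omega

/-- If `a` is a `p`-adic unit and `b` has odd valuation, then `b` can only be a norm
if `a` is a square. -/
theorem Padic.isSquare_of_isNormForm_of_odd (h2 : p ≠ 2) {a b : ℚ_[p]} (ha0 : a ≠ 0)
    (hb0 : b ≠ 0) (ha : Even a.valuation) (hb : ¬ Even b.valuation) (h : IsNormForm a b) :
    IsSquare a := by
  obtain ⟨x, y, h⟩ := h
  have hy : y ≠ 0 := by
    rintro rfl
    apply hb
    rw [← h]
    simp
  have hx : x ≠ 0 := by
    rintro rfl
    apply hb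
    rw [← h, zero_pow two_ne_zero, zero_sub, valuation_neg, valuation_mul ha0 (by simpa using hy),
      valuation_pow]
    exact ha.add (by simp)
  have h1 : x ^ 2 = b + a * y ^ 2 := by linear_combination h
  have hay : a * y ^ 2 ≠ 0 := mul_ne_zero ha0 (pow_ne_zero 2 hy)
  have hv : (a * y ^ 2).valuation = a.valuation + 2 * y.valuation := by
    rw [valuation_mul ha0 (pow_ne_zero 2 hy), valuation_pow]; rfl
  have hvx : (x ^ 2).valuation = 2 * x.valuation := by rw [valuation_pow]; rfl
  have hlt : (a * y ^ 2).valuation < b.valuation := by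
    rcases lt_trichotomy (a * y ^ 2).valuation b.valuation with h3 | h3 | h3
    · exact h3
    · exact absurd (by rw [← h3, hv]; exact ha.add (by simp)) hb
    · have := (valuation_add_of_lt hb0 h3).2
      rw [← h1, hvx] at this
      exact absurd (by rw [← this]; simp) hb
  have hpos : 0 < (b / (a * y ^ 2)).valuation := by
    rw [div_eq_mul_inv, valuation_mul hb0 (inv_ne_zero hay), valuation_inv]; omega
  obtain ⟨r, hr⟩ := isSquare_one_add h2 hpos
  have hr0 : r ≠ 0 := by
    rintro rfl
    have h5 : x ^ 2 = 0 := by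
      rw [h1]
      field_simp at hr
      linear_combination hr
    exact hx (pow_eq_zero_iff two_ne_zero |>.1 h5)
  refine ⟨x / (y * r), ?_⟩
  have h6 : b + a * y ^ 2 = a * y ^ 2 * r ^ 2 := by
    field_simp at hr
    linear_combination hr
  field_simp
  linear_combination -h1 - h6

end Local

section Local

variable {p : ℕ} [hp : Fact p.Prime]

theorem Padic.valuation_natCast_of_not_dvd {n : ℕ} (h : ¬ p ∣ n) : (n : ℚ_[p]).valuation = 0 := by
  rw [valuation_natCast, padicValNat.eq_zero_of_not_dvd h]; rfl

theorem Padic.valuation_mul_sq {a r : ℚ_[p]} (ha : a ≠ 0) (hr : r ≠ 0) :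
    (a * r ^ 2).valuation = a.valuation + 2 * r.valuation := by
  rw [valuation_mul ha (pow_ne_zero 2 hr), valuation_pow]; rfl

theorem Padic.exists_two_adic_class_of_even {x : ℚ_[2]} (h0 : x ≠ 0) (hx : Even x.valuation) :
    ∃ c : ℕ, (c = 1 ∨ c = 3 ∨ c = 5 ∨ c = 7) ∧ ∃ r : ℚ_[2], r ≠ 0 ∧ x = c * r ^ 2 := by
  obtain ⟨u, r, hu0, hr0, hu, rfl⟩ := exists_eq_mul_sq_of_even h0 hx
  obtain ⟨c, hc, s, hs0, rfl⟩ := exists_two_adic_unit_class hu0 hu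
  exact ⟨c, hc, s * r, mul_ne_zero hs0 hr0, by ring⟩

theorem Padic.isSquare_of_modEq_one {n : ℤ} (h : n ≡ 1 [ZMOD 8]) : IsSquare (n : ℚ_[2]) := by
  have := PadicInt.isSquare_coe <| PadicInt.isSquare_of_toZModPow_two (z := (n : ℤ_[2])) (by
    rw [map_intCast]
    have := (ZMod.intCast_eq_intCast_iff n 1 (2 ^ 3)).2 (by exact_mod_cast h)
    exact_mod_cast this)
  simpa using this

theorem Padic.isNormForm_neg_eleven_of_even {b : ℚ_[2]} (h0 : b ≠ 0) (hb : Even b.valuation) :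
    IsNormForm (-11) b := by
  obtain ⟨c, hc, r, hr0, rfl⟩ := exists_two_adic_class_of_even h0 hb
  rw [IsNormForm.mul_sq_right_iff hr0]
  have key (d : ℕ) (hd : d ≠ 0) (hm : (c * d : ℤ) ≡ 1 [ZMOD 8]) (h : IsNormForm (-11 : ℚ_[2]) d) :
      IsNormForm (-11 : ℚ_[2]) c := by
    refine h.of_mul_left (IsNormForm.of_isSquare_right ?_) (by exact_mod_cast hd)
    have := isSquare_of_modEq_one hm
    push_cast at this
    rwa [mul_comm]
  rcases hc with rfl | rfl | rfl | rfl
  · exact key 1 (by simp) (by decide) ⟨1, 0, by norm_num⟩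
  · exact key 11 (by simp) (by decide) ⟨0, 1, by norm_num⟩
  · exact key 45 (by simp) (by decide) ⟨1, 2, by norm_num⟩
  · exact key 15 (by simp) (by decide) ⟨2, 1, by norm_num⟩

theorem Padic.valuation_sq_add_eleven {w : ℚ_[2]} (h0 : w ≠ 0) (hw : w.valuation = 0) :
    w ^ 2 + 11 ≠ 0 ∧ (w ^ 2 + 11).valuation = 2 := by
  obtain ⟨z, hz, rfl⟩ := exists_unit_of_valuation h0 hw
  have h1 : PadicInt.toZMod (z - 1) = 0 := by
    have hu := hz.map (PadicInt.toZMod (p := 2))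
    have key : ∀ u : ZMod 2, IsUnit u → u - 1 = 0 := by decide
    rw [map_sub, map_one]
    exact key _ hu
  rw [← RingHom.mem_ker, PadicInt.ker_toZMod, PadicInt.maximalIdeal_eq_span_p,
    Ideal.mem_span_singleton] at h1
  obtain ⟨s, hs⟩ := h1
  have hz' : z = 1 + 2 * s := by push_cast at hs; linear_combination hs
  have e : (z : ℚ_[2]) ^ 2 + 11 = ((s ^ 2 + s + 3 : ℤ_[2]) : ℚ_[2]) * 2 ^ 2 := by
    have c2 : ((2 : ℤ_[2]) : ℚ_[2]) = 2 := rfl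
    have c3 : ((3 : ℤ_[2]) : ℚ_[2]) = 3 := rfl
    rw [hz']; push_cast; rw [c2, c3]; ring
  have hu : ‖s ^ 2 + s + 3‖ = 1 := by
    apply PadicInt.norm_eq_one_of_toZMod_ne_zero
    simp only [map_add, map_pow, map_ofNat]
    generalize PadicInt.toZMod s = v
    revert v
    decide
  have hne : ((s ^ 2 + s + 3 : ℤ_[2]) : ℚ_[2]) ≠ 0 := by
    intro h
    rw [← PadicInt.padic_norm_e_of_padicInt, h] at hu
    simp at hu
  have hv : ((s ^ 2 + s + 3 : ℤ_[2]) : ℚ_[2]).valuation = 0 := by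
    rw [← PadicInt.padic_norm_e_of_padicInt, norm_eq_zpow_neg_valuation hne] at hu
    have := (zpow_eq_one_iff_right₀ (by norm_num) (by norm_num)).1 hu
    simpa using this
  rw [e]
  refine ⟨mul_ne_zero hne (by norm_num), ?_⟩
  have h2 := valuation_p (p := 2)
  rw [valuation_mul_sq hne two_ne_zero, hv]
  push_cast at h2
  rw [h2]; norm_num

theorem Padic.even_valuation_of_isNormForm_neg_eleven {b : ℚ_[2]} (h0 : b ≠ 0)
    (h : IsNormForm (-11) b) : Even b.valuation := by
  obtain ⟨x, y, rfl⟩ := h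
  have h11 : (11 : ℚ_[2]).valuation = 0 := by
    exact_mod_cast valuation_natCast_of_not_dvd (p := 2) (n := 11) (by norm_num)
  rcases eq_or_ne y 0 with rfl | hy
  · simp
  have hy2 : (11 * y ^ 2).valuation = 2 * y.valuation := by
    rw [valuation_mul_sq (by norm_num) hy, h11, zero_add]
  have hy3 : 11 * y ^ 2 ≠ 0 := mul_ne_zero (by norm_num) (pow_ne_zero 2 hy)
  rw [show x ^ 2 - -11 * y ^ 2 = x ^ 2 + 11 * y ^ 2 by ring]
  rcases eq_or_ne x 0 with rfl | hx
  · rw [zero_pow two_ne_zero, zero_add, hy2]; simp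
  have hx2 : (x ^ 2).valuation = 2 * x.valuation := by rw [valuation_pow]; rfl
  have hx3 : x ^ 2 ≠ 0 := pow_ne_zero 2 hx
  rcases lt_trichotomy (x ^ 2).valuation (11 * y ^ 2).valuation with h | h | h
  · rw [(valuation_add_of_lt hx3 h).2, hx2]; simp
  · have hw : (x / y).valuation = 0 := by
      rw [div_eq_mul_inv, valuation_mul hx (inv_ne_zero hy), valuation_inv]; omega
    obtain ⟨h5, h6⟩ := valuation_sq_add_eleven (div_ne_zero hx hy) hw
    rw [show x ^ 2 + 11 * y ^ 2 = ((x / y) ^ 2 + 11) * y ^ 2 by field_simp,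
      valuation_mul_sq h5 hy, h6]
    exact even_two.add (by simp)
  · rw [add_comm, (valuation_add_of_lt hy3 h).2, hy2]; simp

theorem Padic.isSquare_of_isNormForm {γ : ℚ_[2]} (h0 : γ ≠ 0) (h1 : IsNormForm (-1) γ)
    (h2 : IsNormForm (-2) γ) (h11 : IsNormForm (-11) γ) : IsSquare γ := by
  obtain ⟨c, hc, r, hr0, rfl⟩ :=
    exists_two_adic_class_of_even h0 (even_valuation_of_isNormForm_neg_eleven h0 h11)
  rw [IsNormForm.mul_sq_right_iff hr0] at h1 h2
  have key (d : ℕ) (hd : d ≠ 0) {a : ℚ_[2]} (hm : (-(c * d) : ℤ) ≡ 1 [ZMOD 8]) (h : IsNormForm a d)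
      (hc : IsNormForm a c) : IsNormForm a (-1) := by
    have hc0 : c ≠ 0 := by omega
    obtain ⟨s, hs⟩ := isSquare_of_modEq_one hm
    have hs0 : s ≠ 0 := by
      rintro rfl
      simp [hc0, hd] at hs
    rw [← IsNormForm.mul_sq_right_iff hs0]
    push_cast at hs
    rw [show -1 * s ^ 2 = (c : ℚ_[2]) * d by linear_combination hs]
    exact hc.mul h
  rcases hc with rfl | rfl | rfl | rfl
  · exact ⟨r, by push_cast; ring⟩
  · exact absurd (key 5 (by simp) (by decide) ⟨1, 2, by norm_num⟩ h1)
      not_isNormForm_neg_one_neg_one_padic_two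
  · have h := (key 3 (by simp) (by decide) ⟨1, 1, by norm_num⟩ h2).symm (by norm_num)
    have h' : IsNormForm (-1 : ℚ_[2]) 2 := ⟨1, 1, by norm_num⟩
    refine absurd (h'.of_mul_left ?_ two_ne_zero) not_isNormForm_neg_one_neg_one_padic_two
    simpa using h
  · exact absurd (key 1 (by simp) (by decide) ⟨1, 0, by norm_num⟩ h1)
      not_isNormForm_neg_one_neg_one_padic_two

theorem Padic.valuation_nonneg_of_not_isNormForm (h2 : p ≠ 2) {a c : ℚ_[p]} (hc : c ≠ 0)
    (h : IsNormForm a (1 + c)) (hn : ¬ IsNormForm a c) : 0 ≤ c.valuation := by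
  by_contra! hlt
  apply hn
  have hs := isSquare_one_add h2 (x := c⁻¹) (by rw [valuation_inv]; omega)
  have hne : 1 + c⁻¹ ≠ 0 := by
    intro h0
    have : c = -1 := by field_simp at h0; linear_combination h0
    rw [this, valuation_neg, valuation_one] at hlt
    exact lt_irrefl _ hlt
  refine (IsNormForm.of_isSquare_right hs).of_mul_left ?_ hne
  rwa [show (1 + c⁻¹) * c = 1 + c by field_simp; ring]

theorem Padic.isNormForm_neg_two_neg_eleven (h2 : p ≠ 2) : IsNormForm (-2 : ℚ_[p]) (-11) := by
  by_cases h : p = 11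
  · subst h
    have h11 := valuation_p (p := 11)
    have h9 : (9 : ℚ_[11]).valuation = 0 := by
      exact_mod_cast valuation_natCast_of_not_dvd (p := 11) (n := 9) (by norm_num)
    obtain ⟨r, hr⟩ := isSquare_one_add h2 (x := (-11 / 9 : ℚ_[11])) (by
      rw [neg_div, valuation_neg, div_eq_mul_inv, valuation_mul (by norm_num) (by norm_num),
        valuation_inv, h9]
      push_cast at h11
      rw [h11]; norm_num)
    exact IsNormForm.of_isSquare_left ⟨3 * r, by linear_combination 9 * hr⟩ (by norm_num)
  · have v2 := valuation_natCast_of_not_dvd (p := p) (n := 2)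
      (by rwa [Nat.prime_dvd_prime_iff_eq hp.out Nat.prime_two])
    have v11 := valuation_natCast_of_not_dvd (p := p) (n := 11)
      (by rwa [Nat.prime_dvd_prime_iff_eq hp.out (by norm_num)])
    push_cast at v2 v11
    exact isNormForm_of_valuation_eq_zero h2 (by norm_num) (by norm_num)
      (by rw [valuation_neg, v2]) (by rw [valuation_neg, v11])

theorem Padic.valuation_bounds_odd (h2 : p ≠ 2) {γ β δ ξ t : ℚ_[p]} (hγ : γ ≠ 0) (hβ : β ≠ 0)
    (hδ : δ ≠ 0) (hξ : ξ ≠ 0) (ht : t ≠ 0) (hγ2 : IsNormForm (-2) γ)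
    (hN : ¬ IsNormForm (-(11 * γ)) (-β)) (hδβ : IsNormForm (-β) (δ * (11 * γ)))
    (h1 : IsNormForm (-(11 * γ)) (1 + 2 * β * 1 ^ 2))
    (h3 : IsNormForm (-(11 * γ)) (1 + 2 * β * (ξ / β ^ 5) ^ 2))
    (h4 : IsNormForm (-(11 * γ)) (1 + 2 * β * (t ^ 5) ^ 2))
    (h5 : IsNormForm (-(11 * γ)) (1 + 2 * β * δ ^ 2))
    (h6 : IsNormForm (-(11 * γ)) (1 + 2 * β * (ξ / δ) ^ 2)) :
    0 < ξ.valuation ∧ 0 ≤ β.valuation ∧ 9 * β.valuation ≤ 2 * ξ.valuation ∧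
      0 ≤ β.valuation + 10 * t.valuation := by
  have hα : -(11 * γ) ≠ 0 := neg_ne_zero.2 (mul_ne_zero (by norm_num) hγ)
  have hα2 : IsNormForm (-(11 * γ)) (-2) := by
    have := (isNormForm_neg_two_neg_eleven h2).mul hγ2
    rw [neg_mul] at this
    exact this.symm hα
  have v2 := valuation_natCast_of_not_dvd (p := p) (n := 2)
      (by rwa [Nat.prime_dvd_prime_iff_eq hp.out Nat.prime_two])
  push_cast at v2
  have hn2 : ¬ IsNormForm (-(11 * γ)) (2 * β) := fun h ↦ hN <|
    hα2.of_mul_left (by rwa [neg_mul_neg]) (by norm_num)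
  have key (m : ℚ_[p]) (hm : m ≠ 0) (h : IsNormForm (-(11 * γ)) (1 + 2 * β * m ^ 2)) :
      0 ≤ β.valuation + 2 * m.valuation := by
    have h2β : 2 * β ≠ 0 := mul_ne_zero two_ne_zero hβ
    have := valuation_nonneg_of_not_isNormForm h2 (mul_ne_zero h2β (pow_ne_zero 2 hm)) h
      (by rwa [IsNormForm.mul_sq_right_iff hm])
    rwa [valuation_mul_sq h2β hm, valuation_mul two_ne_zero hβ, v2, zero_add] at this
  have k1 := key 1 one_ne_zero h1
  have k3 := key _ (div_ne_zero hξ (pow_ne_zero 5 hβ)) h3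
  have k4 := key _ (pow_ne_zero 5 ht) h4
  have k5 := key _ hδ h5
  have k6 := key _ (div_ne_zero hξ hδ) h6
  rw [valuation_one] at k1
  rw [div_eq_mul_inv, valuation_mul hξ (inv_ne_zero (pow_ne_zero 5 hβ)), valuation_inv,
    valuation_pow] at k3
  rw [valuation_pow] at k4
  rw [div_eq_mul_inv, valuation_mul hξ (inv_ne_zero hδ), valuation_inv] at k6
  push_cast at k3 k4
  refine ⟨?_, by omega, by omega, by omega⟩
  by_contra! hle
  have hB : β.valuation = 0 := by omega
  have hD : δ.valuation = 0 := by omega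
  have hB' : (-β).valuation = 0 := by rw [valuation_neg, hB]
  by_cases hA : Even (11 * γ).valuation
  · exact hN (isNormForm_of_even h2 hα (neg_ne_zero.2 hβ) (by rwa [valuation_neg])
      (by rw [hB']; exact Even.zero))
  · have h11γ : 11 * γ ≠ 0 := neg_ne_zero.1 hα
    refine hN (IsNormForm.of_isSquare_right (isSquare_of_isNormForm_of_odd h2 (neg_ne_zero.2 hβ)
      (mul_ne_zero hδ h11γ) (by rw [hB']; exact Even.zero) ?_ hδβ))
    rwa [valuation_mul hδ h11γ, hD, zero_add]

theorem Padic.valuation_bounds_two {γ β ξ t : ℚ_[2]} (hγ : γ ≠ 0) (hβ : β ≠ 0)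
    (hξ : ξ ≠ 0) (ht : t ≠ 0) (hγ1 : IsNormForm (-1) γ)
    (hγ2 : IsNormForm (-2) γ) (hγ11 : IsNormForm (-11) γ)
    (hN : ¬ IsNormForm (-(11 * γ)) (-β))
    (h1 : IsNormForm (-(11 * γ)) (1 + 13 * β * 1 ^ 2))
    (h3 : IsNormForm (-(11 * γ)) (1 + 13 * β * (ξ / β ^ 5) ^ 2))
    (h4 : IsNormForm (-(11 * γ)) (1 + 13 * β * (t ^ 5) ^ 2)) :
    0 < ξ.valuation ∧ 0 ≤ β.valuation ∧ 9 * β.valuation ≤ 2 * ξ.valuation ∧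
      0 ≤ β.valuation + 10 * t.valuation := by
  obtain ⟨g, rfl⟩ := isSquare_of_isNormForm hγ hγ1 hγ2 hγ11
  have hg : g ≠ 0 := by rintro rfl; simp at hγ
  rw [show -(11 * (g * g)) = -11 * g ^ 2 by ring, IsNormForm.mul_sq_left_iff hg] at *
  have hB : ¬ Even β.valuation := fun h ↦ hN <|
    isNormForm_neg_eleven_of_even (neg_ne_zero.2 hβ) (by rwa [valuation_neg])
  have v13 := valuation_natCast_of_not_dvd (p := 2) (n := 13) (by norm_num)
  push_cast at v13
  have h13β : 13 * β ≠ 0 := mul_ne_zero (by norm_num) hβ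
  have key (m : ℚ_[2]) (hm : m ≠ 0) (h : IsNormForm (-11) (1 + 13 * β * m ^ 2)) :
      0 < β.valuation + 2 * m.valuation := by
    have hc0 : 13 * β * m ^ 2 ≠ 0 := mul_ne_zero h13β (pow_ne_zero 2 hm)
    have hv : (13 * β * m ^ 2).valuation = β.valuation + 2 * m.valuation := by
      rw [valuation_mul_sq h13β hm, valuation_mul (by norm_num) hβ, v13, zero_add]
    have hodd : ¬ Even (13 * β * m ^ 2).valuation := by
      rw [hv, Int.even_add]
      simpa using hB
    rw [← hv]
    rcases lt_trichotomy (13 * β * m ^ 2).valuation 0 with hlt | hz | hgt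
    · obtain ⟨h5, h6⟩ := valuation_add_of_lt hc0 (y := 1) (by rwa [valuation_one])
      rw [add_comm] at h5 h6
      exact absurd (by rw [← h6]; exact even_valuation_of_isNormForm_neg_eleven h5 h) hodd
    · exact absurd (by rw [hz]; exact Even.zero) hodd
    · exact hgt
  have k1 := key 1 one_ne_zero h1
  have k3 := key _ (div_ne_zero hξ (pow_ne_zero 5 hβ)) h3
  have k4 := key _ (pow_ne_zero 5 ht) h4
  rw [valuation_one] at k1
  rw [div_eq_mul_inv, valuation_mul hξ (inv_ne_zero (pow_ne_zero 5 hβ)), valuation_inv,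
    valuation_pow] at k3
  rw [valuation_pow] at k4
  push_cast at k3 k4
  refine ⟨by omega, by omega, by omega, by omega⟩

end Local

/-- The existential condition on `x` and `t` whose validity at a prime `x = p` forces `t` to be
`p`-integral. -/
def IntegralityWitness (x t : ℚ) : Prop :=
  ∃ γ β δ ξ : ℚ, γ ≠ 0 ∧ 0 < β ∧ δ ≠ 0 ∧ ξ = (x ^ 2 / (x ^ 2 + x + 1)) ^ 5 ∧
    IsNormForm (-1) γ ∧ IsNormForm (-2) γ ∧ IsNormForm (-11) γ ∧
    IsNormForm (-β) (δ * (11 * γ)) ∧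
    IsNormForm (-(11 * γ)) (1 + 13 * β * 1 ^ 2) ∧
    IsNormForm (-(11 * γ)) (1 + 13 * β * (ξ / β ^ 5) ^ 2) ∧
    IsNormForm (-(11 * γ)) (1 + 13 * β * (t ^ 5) ^ 2) ∧
    IsNormForm (-(11 * γ)) (1 + 2 * β * 1 ^ 2) ∧
    IsNormForm (-(11 * γ)) (1 + 2 * β * (ξ / β ^ 5) ^ 2) ∧
    IsNormForm (-(11 * γ)) (1 + 2 * β * (t ^ 5) ^ 2) ∧
    IsNormForm (-(11 * γ)) (1 + 2 * β * δ ^ 2) ∧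
    IsNormForm (-(11 * γ)) (1 + 2 * β * (ξ / δ) ^ 2)

theorem IntegralityWitness.exists_prime {x t : ℚ} (h : IntegralityWitness x t) (hx : x ≠ 0)
    (ht : t ≠ 0) : ∃ (l : ℕ) (_ : Fact l.Prime) (B : ℤ),
      0 < padicValRat l ((x ^ 2 / (x ^ 2 + x + 1)) ^ 5) ∧
      0 ≤ B ∧ 9 * B ≤ 2 * padicValRat l ((x ^ 2 / (x ^ 2 + x + 1)) ^ 5) ∧
      0 ≤ B + 10 * padicValRat l t := by
  obtain ⟨γ, β, δ, ξ, hγ, hβ, hδ, rfl, hγ1, hγ2, hγ11, hδβ, a1, a2, a3, b1, b2, b3, b4, b5⟩ := h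
  have hγpos : 0 < γ := by
    obtain ⟨u, v, rfl⟩ := hγ1
    exact lt_of_le_of_ne (by nlinarith [sq_nonneg u, sq_nonneg v]) (Ne.symm hγ)
  have hxx : x ^ 2 + x + 1 ≠ 0 := by nlinarith [sq_nonneg (x + 1 / 2)]
  have hξ : (x ^ 2 / (x ^ 2 + x + 1)) ^ 5 ≠ 0 := by positivity
  obtain ⟨l, hl, hN⟩ := exists_not_isNormForm_padic_of_neg (a := -(11 * γ)) (b := -β)
    (by linarith) (by linarith)
  have cast {a b : ℚ} (h : IsNormForm a b) : IsNormForm (a : ℚ_[l]) (b : ℚ_[l]) :=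
    h.map (Rat.castHom ℚ_[l])
  refine ⟨l, hl, (β : ℚ_[l]).valuation, ?_⟩
  rw [← Padic.valuation_ratCast, ← Padic.valuation_ratCast]
  generalize (x ^ 2 / (x ^ 2 + x + 1)) ^ 5 = ξ at *
  have c1 := cast hγ1
  have c2 := cast hγ2
  have c3 := cast hγ11
  have c4 := cast hδβ
  have d1 := cast a1
  have d2 := cast a2
  have d3 := cast a3
  have e1 := cast b1
  have e2 := cast b2
  have e3 := cast b3
  have e4 := cast b4
  have e5 := cast b5
  push_cast at *
  have ne {a : ℚ} (h : a ≠ 0) : (a : ℚ_[l]) ≠ 0 := by exact_mod_cast h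
  by_cases hl2 : l = 2
  · subst hl2
    exact Padic.valuation_bounds_two (ne hγ) (ne hβ.ne') (ne hξ) (ne ht) c1 c2 c3 hN d1 d2 d3
  · exact Padic.valuation_bounds_odd hl2 (ne hγ) (ne hβ.ne') (ne hδ) (ne hξ) (ne ht) c2 hN c4
      e1 e2 e3 e4 e5

theorem IntegralityWitness.padicValRat_nonneg {p : ℕ} (hp : p.Prime) {t : ℚ}
    (h : IntegralityWitness p t) (ht : t ≠ 0) : 0 ≤ padicValRat p t := by
  have hp0 : (p : ℚ) ≠ 0 := by exact_mod_cast hp.ne_zero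
  obtain ⟨l, hl, B, h1, h2, h3, h4⟩ := h.exists_prime hp0 ht
  have hd0 : (p : ℚ) ^ 2 + p + 1 ≠ 0 := by positivity
  have e : padicValRat l (((p : ℚ) ^ 2 / (p ^ 2 + p + 1)) ^ 5) =
      10 * padicValNat l p - 5 * padicValNat l (p ^ 2 + p + 1) := by
    rw [padicValRat.pow, padicValRat.div (pow_ne_zero 2 hp0) hd0,
      padicValRat.pow, padicValRat.of_nat]
    rw [show ((p : ℚ) ^ 2 + p + 1) = ((p ^ 2 + p + 1 : ℕ) : ℚ) by push_cast; ring,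
      padicValRat.of_nat]
    push_cast; ring
  rw [e] at h1 h3
  have hlp : l ∣ p := by
    by_contra hlp
    rw [padicValNat.eq_zero_of_not_dvd hlp] at h1
    omega
  obtain rfl := (Nat.prime_dvd_prime_iff_eq hl.out hp).1 hlp
  rw [padicValNat_self] at h3
  omega

section Local

variable {p : ℕ} [hp : Fact p.Prime]

theorem Padic.isSquare_of_jacobiSym (h2 : p ≠ 2) {a : ℤ} (h : jacobiSym a p = 1) :
    IsSquare (a : ℚ_[p]) := by
  have h0 : (a : ZMod p) ≠ 0 := by
    intro h0
    rw [← jacobiSym.legendreSym.to_jacobiSym, (legendreSym.eq_zero_iff p a).2 h0] at h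
    exact zero_ne_one h
  have := PadicInt.isSquare_coe <| PadicInt.isSquare_of_toZMod (z := (a : ℤ_[p])) h2
    (by simpa using h0) (by simpa using ZMod.isSquare_of_jacobiSym_eq_one h)
  simpa using this

theorem Padic.valuation_intCast_of_not_dvd {a : ℤ} (h : ¬ (p : ℤ) ∣ a) :
    (a : ℚ_[p]).valuation = 0 := by
  rw [valuation_intCast, padicValInt, padicValNat.eq_zero_of_not_dvd]
  · rfl
  · rwa [Int.natCast_dvd] at h

theorem Padic.jacobiSym_of_isSquare {a : ℤ} (ha : ¬ (p : ℤ) ∣ a) (h : IsSquare (a : ℚ_[p])) :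
    jacobiSym a p = 1 := by
  have h0 : (a : ZMod p) ≠ 0 := by rwa [Ne, ZMod.intCast_zmod_eq_zero_iff_dvd]
  rw [← jacobiSym.legendreSym.to_jacobiSym, legendreSym.eq_one_iff p h0]
  obtain ⟨r, hr⟩ := h
  have hr0 : r ≠ 0 := by
    rintro rfl
    simp at hr
    exact ha (by simp [hr])
  have hv := valuation_intCast_of_not_dvd ha
  rw [hr, valuation_mul hr0 hr0] at hv
  obtain ⟨r, rfl⟩ := exists_padicInt_of_valuation (x := r) (by omega)
  refine ⟨PadicInt.toZMod r, ?_⟩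
  have : (a : ℤ_[p]) = r * r := PadicInt.ext (by push_cast; exact hr)
  rw [← map_mul, ← this, map_intCast]

theorem Padic.not_dvd_of_even {a : ℤ} (ha : Squarefree a) (h : Even (a : ℚ_[p]).valuation) :
    ¬ (p : ℤ) ∣ a := by
  rintro ⟨c, rfl⟩
  have hc : ¬ (p : ℤ) ∣ c := by
    intro hc
    have := ha p (mul_dvd_mul_left _ hc)
    exact (Nat.prime_iff_prime_int.1 hp.out).not_isUnit this
  have hc0 : (c : ℚ_[p]) ≠ 0 := by
    have : c ≠ 0 := by rintro rfl; simp at hc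
    exact_mod_cast this
  rw [Int.cast_mul, Int.cast_natCast, valuation_mul (by exact_mod_cast hp.out.ne_zero) hc0,
    valuation_p, valuation_intCast_of_not_dvd hc] at h
  simp at h

end Local

theorem jacobiSym_neg_of_mod_four_eq_three {a b : ℕ} (ha : a % 4 = 3) (hb : Odd b) :
    jacobiSym (-a) b = jacobiSym b a := by
  have ha' : Odd a := Nat.odd_iff.2 (by omega)
  rw [jacobiSym.neg _ hb]
  rcases Nat.odd_mod_four_iff.1 (Nat.odd_iff.1 hb) with h | h
  · rw [ZMod.χ₄_nat_one_mod_four h, one_mul, jacobiSym.quadratic_reciprocity_one_mod_four' ha' h]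
  · rw [ZMod.χ₄_nat_three_mod_four h, jacobiSym.quadratic_reciprocity_three_mod_four ha h]
    ring

theorem jacobiSym_congr {a b : ℤ} {n : ℕ} (h : a ≡ b [ZMOD n]) : jacobiSym a n = jacobiSym b n :=
  jacobiSym.mod_left' h

/-- For integers, the Hasse principle only requires a check at `2` and at the prime divisors. -/
theorem IsNormForm.of_forall_dvd {a b : ℤ} (ha : a ≠ 0) (hb : b ≠ 0)
    (h : ∀ (p : ℕ) [Fact p.Prime], p = 2 ∨ (p : ℤ) ∣ a ∨ (p : ℤ) ∣ b → IsNormForm (a : ℚ_[p]) b) :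
    IsNormForm (a : ℚ) b := by
  refine of_forall_padic (by exact_mod_cast ha) (by exact_mod_cast hb) fun p _ ↦ ?_
  by_cases hp : p = 2 ∨ (p : ℤ) ∣ a ∨ (p : ℤ) ∣ b
  · exact_mod_cast h p hp
  · push Not at hp
    rw [Rat.cast_intCast, Rat.cast_intCast]
    exact Padic.isNormForm_of_valuation_eq_zero hp.1 (by exact_mod_cast ha) (by exact_mod_cast hb)
      (Padic.valuation_intCast_of_not_dvd hp.2.1) (Padic.valuation_intCast_of_not_dvd hp.2.2)

theorem jacobiSym_neg_eleven_eq_one {q : ℕ} (hq8 : q % 8 = 1) (hq11 : q % 11 = 1) :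
    jacobiSym (-11) q = 1 := by
  have h := jacobiSym_neg_of_mod_four_eq_three (a := 11) (b := q) (by norm_num)
    (Nat.odd_iff.2 (by omega))
  push_cast at h
  rw [h, jacobiSym_congr (b := 1) (by change _ = _; push_cast; omega), jacobiSym.one_left]

theorem isNormForm_prime_of_mod_eq_one {q : ℕ} (hq : q.Prime) (hq8 : q % 8 = 1) (hq11 : q % 11 = 1)
    {a : ℤ} (ha : a = -1 ∨ a = -2 ∨ a = -11) :
    IsNormForm (a : ℚ) q := by
  have hodd : Odd q := Nat.odd_iff.2 (by omega)
  have := IsNormForm.of_forall_dvd (a := a) (b := q) (by omega)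
    (by exact_mod_cast hq.ne_zero) fun l hl hlq ↦ ?_
  · exact_mod_cast this
  by_cases hl2 : l = 2
  · subst hl2
    exact IsNormForm.of_isSquare_right (Padic.isSquare_of_modEq_one (by change _ = _; omega))
  have hl1 := hl.out.one_lt
  have hlq' : l = 11 ∨ l = q := by
    rcases hlq with h | h | h
    · contradiction
    · left
      rw [Int.natCast_dvd] at h
      rcases ha with rfl | rfl | rfl
      · exact absurd (Nat.le_of_dvd (by norm_num) h) (by simp; omega)
      · exact absurd ((Nat.prime_dvd_prime_iff_eq hl.out Nat.prime_two).1 h) hl2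
      · exact (Nat.prime_dvd_prime_iff_eq hl.out (by norm_num)).1 h
    · exact Or.inr <| (Nat.prime_dvd_prime_iff_eq hl.out hq).1 (by exact_mod_cast h)
  rcases hlq' with rfl | rfl
  · refine IsNormForm.of_isSquare_right (Padic.isSquare_of_jacobiSym hl2 ?_)
    rw [jacobiSym_congr (b := 1) (by change _ = _; push_cast; omega), jacobiSym.one_left]
  · refine IsNormForm.of_isSquare_left (Padic.isSquare_of_jacobiSym hl2 ?_)
      (by have : a ≠ 0 := by omega
          exact_mod_cast this)
    rcases ha with rfl | rfl | rfl
    · rw [jacobiSym.at_neg_one hodd, ZMod.χ₄_nat_one_mod_four (by omega)]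
    · rw [jacobiSym.at_neg_two hodd, ZMod.χ₈'_nat_eq_if_mod_eight]
      simp [hq8]
      omega
    · exact jacobiSym_neg_eleven_eq_one hq8 hq11

theorem isNormForm_of_modEq_neg_eleven {q : ℕ} (hq : q.Prime) (hq8 : q % 8 = 1)
    (hq11 : q % 11 = 1) {M : ℕ} (hM : Odd M) (hM11 : ¬ 11 ∣ M)
    (hJ : jacobiSym M 11 = 1) (hqM : (q : ℤ) ≡ -11 [ZMOD M]) :
    IsNormForm (-(11 * q) : ℚ) M := by
  have hodd : Odd q := Nat.odd_iff.2 (by omega)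
  have hM0 : M ≠ 0 := by rintro rfl; simp at hM
  have hcop : ∀ l : ℕ, l.Prime → l ∣ M → ¬ l ∣ 11 := fun l hl h h' ↦
    hM11 ((Nat.prime_dvd_prime_iff_eq hl (by norm_num)).1 h' ▸ h)
  have := IsNormForm.of_forall_dvd (a := -(11 * q)) (b := M)
    (by have := hq.ne_zero; omega) (by exact_mod_cast hM0) fun l hl hlq ↦ ?_
  · exact_mod_cast this
  by_cases hl2 : l = 2
  · subst hl2
    obtain ⟨g, hg⟩ := Padic.isSquare_of_modEq_one (n := q) (by change _ = _; omega)
    have hg0 : g ≠ 0 := by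
      rintro rfl
      simp [hq.ne_zero] at hg
    rw [show ((-(11 * q) : ℤ) : ℚ_[2]) = -11 * g ^ 2 by push_cast at hg ⊢; rw [hg]; ring,
      IsNormForm.mul_sq_left_iff hg0]
    refine Padic.isNormForm_neg_eleven_of_even (by exact_mod_cast hM0) ?_
    rw [Padic.valuation_intCast_of_not_dvd]
    · exact Even.zero
    · have := Nat.odd_iff.1 hM
      omega
  by_cases hlM : l ∣ M
  · have h11 := hcop l hl.out hlM
    have hmod : (-(11 * q) : ℤ) ≡ 11 ^ 2 [ZMOD l] := by
      have := (hqM.of_dvd (by exact_mod_cast hlM : (l : ℤ) ∣ M)).mul_left (-11)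
      rw [show (-(11 * q) : ℤ) = -11 * q by ring]
      exact this
    refine IsNormForm.of_isSquare_left (Padic.isSquare_of_jacobiSym hl2 ?_) ?_
    · rw [jacobiSym_congr hmod, jacobiSym.sq_one']
      exact ((Nat.Prime.coprime_iff_not_dvd hl.out).2 h11).symm
    · have := hq.ne_zero
      have : (-(11 * q) : ℤ) ≠ 0 := by omega
      exact_mod_cast this
  have hl' : l = 11 ∨ l = q := by
    rcases hlq with h | h | h
    · contradiction
    · rw [dvd_neg] at h
      have h : l ∣ 11 * q := by exact_mod_cast h
      exact ((Nat.Prime.dvd_mul hl.out).1 h).imp (Nat.prime_dvd_prime_iff_eq hl.out (by norm_num)).1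
        (Nat.prime_dvd_prime_iff_eq hl.out hq).1
    · exact absurd (by exact_mod_cast h) hlM
  refine IsNormForm.of_isSquare_right (Padic.isSquare_of_jacobiSym hl2 ?_)
  rcases hl' with rfl | rfl
  · exact hJ
  · have h := jacobiSym_neg_of_mod_four_eq_three (a := 11) (by norm_num) hM
    push_cast at h
    rw [← jacobiSym.quadratic_reciprocity_one_mod_four (by omega) hM, jacobiSym_congr hqM, h, hJ]

theorem Padic.valuation_natCast_pos {p : ℕ} [hp : Fact p.Prime] {e : ℕ} (he : e ≠ 0) (h : p ∣ e) :
    0 < (e : ℚ_[p]).valuation := by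
  rw [valuation_natCast]
  exact_mod_cast one_le_padicValNat_of_dvd he h

theorem Padic.valuation_one_add_mul_pow {p : ℕ} [hp : Fact p.Prime] {e k : ℚ_[p]} (he : e ≠ 0)
    (h : 0 < e.valuation) (hk : 0 ≤ k.valuation) : (1 + e * k ^ 10).valuation = 0 := by
  rcases eq_or_ne k 0 with rfl | hk0
  · simp
  · rw [(valuation_add_of_lt one_ne_zero _).2, valuation_one]
    rw [valuation_one, valuation_mul he (pow_ne_zero _ hk0), valuation_pow]
    positivity

theorem Padic.isSquare_one_add_mul_pow {p : ℕ} [hp : Fact p.Prime] (h2 : p ≠ 2) {e k : ℚ_[p]}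
    (he : e ≠ 0) (h : 0 < e.valuation) (hk : 0 ≤ k.valuation) : IsSquare (1 + e * k ^ 10) := by
  rcases eq_or_ne k 0 with rfl | hk0
  · simp
  · refine isSquare_one_add h2 ?_
    rw [valuation_mul he (pow_ne_zero _ hk0), valuation_pow]
    positivity

theorem Padic.isSquare_one_add_mul_pow_eleven [Fact (Nat.Prime 11)] {e : ℕ} (he : e % 11 = 3)
    (k : ℚ_[11]) : IsSquare (1 + e * k ^ 10) := by
  have hne2 : 11 ≠ 2 := by norm_num
  have he0 : (e : ℚ_[11]) ≠ 0 := by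
    have : e ≠ 0 := by omega
    exact_mod_cast this
  have hev : (e : ℚ_[11]).valuation = 0 := valuation_natCast_of_not_dvd (by omega)
  have hes : IsSquare (e : ℚ_[11]) := by
    have : jacobiSym (e : ℤ) 11 = 1 := by
      rw [jacobiSym_congr (b := 5 ^ 2) (by change _ = _; push_cast; omega), jacobiSym.sq_one']
      rfl
    exact_mod_cast isSquare_of_jacobiSym hne2 this
  rcases eq_or_ne k 0 with rfl | hk0
  · simp
  have hkv : (e * k ^ 10 : ℚ_[11]).valuation = 10 * k.valuation := by
    rw [valuation_mul he0 (pow_ne_zero _ hk0), valuation_pow, hev]; push_cast; ring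
  have hne : (e * k ^ 10 : ℚ_[11]) ≠ 0 := mul_ne_zero he0 (pow_ne_zero _ hk0)
  rcases lt_trichotomy k.valuation 0 with h | h | h
  · have h1 := isSquare_one_add hne2 (x := (e * k ^ 10 : ℚ_[11])⁻¹)
      (by rw [valuation_inv, hkv]; omega)
    have h2 : IsSquare (e * k ^ 10 : ℚ_[11]) := hes.mul ⟨k ^ 5, by ring⟩
    have := h1.mul h2
    rwa [add_mul, one_mul, inv_mul_cancel₀ hne, add_comm] at this
  · obtain ⟨z, hz, rfl⟩ := exists_unit_of_valuation hk0 h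
    have hz0 := PadicInt.toZMod_ne_zero hz
    have e3 : (e : ZMod 11) = 3 := by
      have := (ZMod.natCast_eq_natCast_iff e 3 11).2 he
      exact_mod_cast this
    have key : PadicInt.toZMod (1 + (e : ℤ_[11]) * z ^ 10) = 4 := by
      simp only [map_add, map_mul, map_pow, map_one, map_natCast, e3]
      have := ZMod.pow_card_sub_one_eq_one hz0
      simp only [Nat.add_one_sub_one] at this
      rw [this]; norm_num
    have h4 : (4 : ZMod 11) ≠ 0 := by
      intro h
      have h : ((4 : ℕ) : ZMod 11) = 0 := by exact_mod_cast h
      rw [ZMod.natCast_eq_zero_iff] at h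
      omega
    have := PadicInt.isSquare_coe <| PadicInt.isSquare_of_toZMod (z := 1 + (e : ℤ_[11]) * z ^ 10) hne2
      (by rwa [key]) (by rw [key]; exact ⟨2, by norm_num⟩)
    simpa using this
  · exact isSquare_one_add hne2 (by rw [hkv]; omega)

theorem Padic.even_valuation_one_add_mul_pow {e : ℕ} (he : e % 8 = 3) (k : ℚ_[2]) :
    Even (1 + e * k ^ 10 : ℚ_[2]).valuation := by
  rcases eq_or_ne (1 + e * k ^ 10 : ℚ_[2]) 0 with h | h
  · rw [h]; simp
  refine even_valuation_of_isNormForm_neg_eleven h ?_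
  obtain ⟨g, hg⟩ := isSquare_of_modEq_one (n := e * 11) (by change _ = _; omega)
  refine ⟨1, g / 11 * k ^ 5, ?_⟩
  push_cast at hg
  linear_combination -k ^ 10 / 11 * hg

theorem exists_squarefree_part_one_add {p e : ℕ} [hp : Fact p.Prime] [Fact (Nat.Prime 11)]
    (he : e ≠ 0) (k : ℚ) (hpe : p ∣ e) (hkp : 0 ≤ (k : ℚ_[p]).valuation)
    (hk2 : 0 ≤ (k : ℚ_[2]).valuation) (h2 : 2 ∣ e ∨ e % 8 = 3)
    (h11 : 11 ∣ e ∧ 0 ≤ (k : ℚ_[11]).valuation ∨ e % 11 = 3) :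
    ∃ M : ℕ, Odd M ∧ ¬ 11 ∣ M ∧ ¬ p ∣ M ∧ jacobiSym M 11 = 1 ∧
      ∃ s : ℚ, s ≠ 0 ∧ 1 + e * k ^ 10 = M * s ^ 2 := by
  have hn : 0 < 1 + e * k ^ 10 := by positivity
  obtain ⟨s, m, hs, hm, h⟩ := Rat.exists_sq_mul_squarefree hn.ne'
  have hm0 : 0 < m := by
    rw [h] at hn
    have := pos_of_mul_pos_left hn (sq_nonneg s)
    exact_mod_cast this
  lift m to ℕ using hm0.le
  have cast (l : ℕ) [Fact l.Prime] : (1 + e * (k : ℚ_[l]) ^ 10) = (m : ℤ) * (s : ℚ_[l]) ^ 2 := by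
    have := congrArg (Rat.cast : ℚ → ℚ_[l]) h
    exact_mod_cast this
  have cast_s (l : ℕ) [Fact l.Prime] : (s : ℚ_[l]) ≠ 0 := by exact_mod_cast hs
  have even (l : ℕ) [Fact l.Prime] (hev : Even (1 + e * (k : ℚ_[l]) ^ 10).valuation) :
      ¬ l ∣ m := by
    rw [cast, Padic.valuation_mul_sq (by exact_mod_cast hm0.ne') (cast_s l),
      Int.even_add] at hev
    have := Padic.not_dvd_of_even hm (hev.2 (by simp))
    exact_mod_cast this
  have e0 (l : ℕ) [Fact l.Prime] : (e : ℚ_[l]) ≠ 0 := by exact_mod_cast he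
  have small (l : ℕ) [Fact l.Prime] (hle : l ∣ e) (hk : 0 ≤ (k : ℚ_[l]).valuation) : ¬ l ∣ m := by
    apply even
    rw [Padic.valuation_one_add_mul_pow (e0 l) (Padic.valuation_natCast_pos he hle) hk]
    exact Even.zero
  have sq11 : IsSquare (m : ℚ_[11]) := by
    have : IsSquare (1 + e * (k : ℚ_[11]) ^ 10) := by
      rcases h11 with ⟨h, hk⟩ | h
      · exact Padic.isSquare_one_add_mul_pow (by norm_num) (e0 11)
          (Padic.valuation_natCast_pos he h) hk
      · exact Padic.isSquare_one_add_mul_pow_eleven h _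
    rw [cast] at this
    obtain ⟨r, hr⟩ := this
    have := cast_s 11
    refine ⟨r / s, ?_⟩
    field_simp
    push_cast at hr
    linear_combination hr
  have not11 : ¬ 11 ∣ m := by
    apply even
    rw [cast, Padic.valuation_mul_sq (by exact_mod_cast hm0.ne') (cast_s 11)]
    obtain ⟨r, hr⟩ := sq11
    rw [Int.cast_natCast, hr]
    rcases eq_or_ne r 0 with rfl | hr0
    · simp
    rw [Padic.valuation_mul hr0 hr0]
    exact Even.add ⟨_, rfl⟩ (by simp)
  refine ⟨m, ?_, not11, small p hpe hkp, ?_, s, hs, by exact_mod_cast h⟩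
  · rw [← Nat.not_even_iff_odd, even_iff_two_dvd]
    rcases h2 with h | h
    · exact small 2 h hk2
    · exact even 2 (Padic.even_valuation_one_add_mul_pow h _)
  · exact Padic.jacobiSym_of_isSquare (by exact_mod_cast not11) (by exact_mod_cast sq11)

theorem Int.exists_modEq_modEq {m n a b : ℤ} (h : IsCoprime m n) (ha : IsCoprime a m)
    (hb : IsCoprime b n) : ∃ c, c ≡ a [ZMOD m] ∧ c ≡ b [ZMOD n] ∧ IsCoprime c (m * n) := by
  obtain ⟨u, v, huv⟩ := h
  have hm : a * (v * n) + b * (u * m) = a + m * (u * (b - a)) := by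
    linear_combination a * huv
  have hn : a * (v * n) + b * (u * m) = b + n * (v * (a - b)) := by
    linear_combination b * huv
  refine ⟨a * (v * n) + b * (u * m), ?_, ?_, IsCoprime.mul_right ?_ ?_⟩
  · rw [hm]; exact Int.add_mul_emod_self_left ..
  · rw [hn]; exact Int.add_mul_emod_self_left ..
  · rw [hm]; exact ha.add_mul_left_left _
  · rw [hn]; exact hb.add_mul_left_left _

theorem Nat.exists_prime_gt_modEq_modEq {m n : ℕ} {a b : ℤ} (hm : m ≠ 0) (hn : n ≠ 0)
    (h : m.Coprime n) (ha : IsCoprime a m) (hb : IsCoprime b n) (N : ℕ) :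
    ∃ q > N, q.Prime ∧ q ≡ a [ZMOD m] ∧ q ≡ b [ZMOD n] := by
  obtain ⟨c, hca, hcb, hc⟩ := Int.exists_modEq_modEq (Nat.isCoprime_iff_coprime.2 h) ha hb
  obtain ⟨q, hqN, hq, hqc⟩ := Nat.forall_exists_prime_gt_and_zmodEq N (mul_ne_zero hm hn)
    (a := c) (by exact_mod_cast hc)
  push_cast at hqc
  exact ⟨q, hqN, hq, (hqc.of_mul_right _).trans hca, (hqc.of_mul_left _).trans hcb⟩

theorem Nat.exists_prime_gt_modEq_modEq_modEq {l m n : ℕ} {a b c : ℤ} (hl : l ≠ 0) (hm : m ≠ 0)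
    (hn : n ≠ 0) (hlm : l.Coprime m) (hln : l.Coprime n) (hmn : m.Coprime n) (ha : IsCoprime a l)
    (hb : IsCoprime b m) (hc : IsCoprime c n) (N : ℕ) :
    ∃ q > N, q.Prime ∧ q ≡ a [ZMOD l] ∧ q ≡ b [ZMOD m] ∧ q ≡ c [ZMOD n] := by
  obtain ⟨e, heb, hec, he⟩ := Int.exists_modEq_modEq (Nat.isCoprime_iff_coprime.2 hmn) hb hc
  obtain ⟨q, hqN, hq, hqa, hqe⟩ := exists_prime_gt_modEq_modEq (n := m * n) (b := e) hl
    (mul_ne_zero hm hn) (Nat.Coprime.mul_right hlm hln) ha (by exact_mod_cast he) N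
  push_cast at hqe
  exact ⟨q, hqN, hq, hqa, (hqe.of_mul_right _).trans heb, (hqe.of_mul_left _).trans hec⟩

/-- Local conditions at all relevant primes for the norm form equation linking the two
quaternion algebras. -/
theorem isNormForm_neg_mul_of_jacobiSym {p r d q : ℕ} (hp : p.Prime) (hr : r.Prime) (hd : d.Prime)
    (hq : q.Prime) (hr2 : r ≠ 2) (hd2 : d ≠ 2) (hq2 : q ≠ 2)
    (h2 : -(p * r : ℤ) ≡ 1 [ZMOD 8] ∨ (11 * q * d : ℤ) ≡ 1 [ZMOD 8])
    (h11 : ∀ [Fact (Nat.Prime 11)], IsNormForm (-(p * r) : ℚ_[11]) (11 * q * d))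
    (hJp : p = 2 ∨ p = 11 ∨ jacobiSym (11 * q * d) p = 1)
    (hJr : jacobiSym (11 * q * d) r = 1) (hJd : jacobiSym (-(p * r)) d = 1)
    (hJq : jacobiSym (-(p * r)) q = 1) : IsNormForm (-(p * r) : ℚ) (11 * q * d) := by
  have ha : (-(p * r) : ℤ) ≠ 0 :=
    neg_ne_zero.2 (mul_ne_zero (by exact_mod_cast hp.ne_zero) (by exact_mod_cast hr.ne_zero))
  have hb : (11 * q * d : ℤ) ≠ 0 :=
    mul_ne_zero (mul_ne_zero (by norm_num) (by exact_mod_cast hq.ne_zero))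
      (by exact_mod_cast hd.ne_zero)
  have := IsNormForm.of_forall_dvd ha hb fun l hl hl' ↦ ?_
  · exact_mod_cast this
  have left (hl2 : l ≠ 2) (h : jacobiSym (-(p * r)) l = 1) :
      IsNormForm ((-(p * r) : ℤ) : ℚ_[l]) (11 * q * d : ℤ) :=
    IsNormForm.of_isSquare_left (Padic.isSquare_of_jacobiSym hl2 h) (by exact_mod_cast ha)
  have right (hl2 : l ≠ 2) (h : jacobiSym (11 * q * d) l = 1) :
      IsNormForm ((-(p * r) : ℤ) : ℚ_[l]) (11 * q * d : ℤ) :=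
    IsNormForm.of_isSquare_right (Padic.isSquare_of_jacobiSym hl2 h)
  by_cases hl2 : l = 2
  · subst hl2
    rcases h2 with h | h
    · exact IsNormForm.of_isSquare_left (Padic.isSquare_of_modEq_one h) (by exact_mod_cast ha)
    · exact IsNormForm.of_isSquare_right (Padic.isSquare_of_modEq_one h)
  by_cases hl11 : l = 11
  · subst hl11
    exact_mod_cast h11
  have eq_of_dvd {s : ℕ} (hs : s.Prime) : l ∣ s → l = s := (Nat.prime_dvd_prime_iff_eq hl.out hs).1
  rcases hl' with h | h | h
  · contradiction
  · rw [dvd_neg] at h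
    rcases (Nat.Prime.dvd_mul hl.out).1 (by exact_mod_cast h : l ∣ p * r) with h | h
    · obtain rfl := eq_of_dvd hp h
      exact right hl2 (by tauto)
    · obtain rfl := eq_of_dvd hr h
      exact right hl2 hJr
  · rcases (Nat.Prime.dvd_mul hl.out).1 (by exact_mod_cast h : l ∣ 11 * q * d) with h | h
    · rcases (Nat.Prime.dvd_mul hl.out).1 h with h | h
      · exact absurd (eq_of_dvd (by norm_num) h) hl11
      · obtain rfl := eq_of_dvd hq h
        exact left hl2 hJq
    · obtain rfl := eq_of_dvd hd h
      exact left hl2 hJd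

theorem exists_jacobiSym_eq_neg_one_s18 {p : ℕ} (hp : p.Prime) (h2 : p ≠ 2) :
    ∃ u : ℤ, jacobiSym u p = -1 := by
  have : Fact p.Prime := ⟨hp⟩
  obtain ⟨u, hu⟩ := FiniteField.exists_nonsquare (F := ZMod p) (by rwa [ZMod.ringChar_zmod_n])
  obtain ⟨u, rfl⟩ := ZMod.intCast_surjective u
  exact ⟨u, by rw [← jacobiSym.legendreSym.to_jacobiSym, legendreSym.eq_neg_one_iff]; exact hu⟩

theorem jacobiSym_eleven_mul_eq_one {r : ℕ} {q d : ℤ} (hr : r.Prime) (hr11 : r ≠ 11)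
    (hq : q ≡ -11 [ZMOD r]) (hd : d ≡ -1 [ZMOD r]) : jacobiSym (11 * q * d) r = 1 := by
  rw [jacobiSym_congr (b := 11 ^ 2) ((hq.mul_left 11).mul hd), jacobiSym.sq_one']
  exact (Nat.coprime_primes (by norm_num) hr).2 hr11.symm

theorem jacobiSym_eq_one_of_modEq_neg_one {r d : ℕ} (hr : Odd r) (hd4 : d % 4 = 3)
    (hd : (d : ℤ) ≡ -1 [ZMOD r]) : jacobiSym r d = 1 := by
  rw [← jacobiSym_neg_of_mod_four_eq_three hd4 hr, jacobiSym_congr hd.neg, neg_neg,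
    jacobiSym.one_left]

theorem jacobiSym_neg_mul_eq_of_modEq {r q : ℕ} (p : ℤ) (hr : Odd r) (hq4 : q % 4 = 1)
    (hq : (q : ℤ) ≡ -11 [ZMOD r]) : jacobiSym (-(p * r)) q = jacobiSym p q * jacobiSym r 11 := by
  have hodd : Odd q := Nat.odd_iff.2 (by omega)
  have h := jacobiSym_neg_of_mod_four_eq_three (a := 11) (by norm_num) hr
  push_cast at h
  rw [jacobiSym.neg _ hodd, ZMod.χ₄_nat_one_mod_four hq4, one_mul, jacobiSym.mul_left,
    jacobiSym.quadratic_reciprocity_one_mod_four' hr hq4, jacobiSym_congr hq, h]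

/-- Auxiliary data attached to a prime `p`: `r` and `d` are primes, and `c` is the residue class
modulo `m` (a divisor of `p`) imposed on a third prime `q`. -/
structure AuxiliaryPrimes (p r d m : ℕ) (c : ℤ) : Prop where
  prime_r : r.Prime
  prime_d : d.Prime
  r_ne_two : r ≠ 2
  r_ne_eleven : r ≠ 11
  r_ne : r ≠ p
  d_ne_two : d ≠ 2
  d_ne : d ≠ p
  mod_eleven : p = 11 ∨ p * r % 11 = 7
  mod_eight : p = 2 ∨ p * r % 8 = 7
  m_eq : m = 1 ∨ m = p
  coprime_m : m.Coprime 88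
  coprime_c : IsCoprime c m
  isNormForm : ∀ q : ℕ, q.Prime → q % 8 = 1 → q % 11 = 1 → (q : ℤ) ≡ -11 [ZMOD r] →
    (q : ℤ) ≡ c [ZMOD m] → IsNormForm (-(p * r) : ℚ) (11 * q * d)

theorem isNormForm_eleven_of_mod_eq_seven [Fact (Nat.Prime 11)] {p r : ℕ} (h : p * r % 11 = 7)
    (b : ℚ_[11]) : IsNormForm (-(p * r) : ℚ_[11]) b := by
  have h1 : jacobiSym (-(p * r)) 11 = 1 := by
    rw [jacobiSym_congr (b := 2 ^ 2) (by
      have : ((p * r : ℕ) : ℤ) % 11 = 7 := by exact_mod_cast h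
      push_cast at this
      change _ = _
      push_cast
      omega), jacobiSym.sq_one']
    rfl
  have := Padic.isSquare_of_jacobiSym (p := 11) (by norm_num) h1
  push_cast at this
  refine IsNormForm.of_isSquare_left this ?_
  have : p * r ≠ 0 := by intro h'; simp [h'] at h
  exact neg_ne_zero.2 (by exact_mod_cast this)

theorem exists_auxiliaryPrimes_two : ∃ r d m c, AuxiliaryPrimes 2 r d m c := by
  obtain ⟨r, hr2, hr, hr11⟩ := Nat.forall_exists_prime_gt_and_zmodEq 11 (q := 11) (a := 9)
    (by norm_num) (by norm_num [Int.isCoprime_iff_gcd_eq_one])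
  have hrodd : Odd r := hr.odd_of_ne_two (by omega)
  obtain ⟨d, hd2, hd, hd8, hdr⟩ := Nat.exists_prime_gt_modEq_modEq (m := 8) (n := r) (a := 3)
    (b := -1) (by norm_num) hr.ne_zero
    (Nat.Coprime.pow_left 3 ((Nat.coprime_primes Nat.prime_two hr).2 (by omega)))
    (by norm_num [Int.isCoprime_iff_gcd_eq_one]) isCoprime_one_left.neg_left r
  have hr11' : r % 11 = 9 := by have := hr11.eq; omega
  have hd8' : d % 8 = 3 := by have := hd8.eq; omega
  refine ⟨r, d, 1, 0, hr, hd, by omega, by omega, by omega, by omega, by omega, Or.inr (by omega),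
    Or.inl rfl, Or.inl rfl, by simp, by simpa using isCoprime_one_right, fun q hq hq8 hq11 hqr _ ↦ ?_⟩
  have hqodd : Odd q := Nat.odd_iff.2 (by omega)
  have hdodd : Odd d := Nat.odd_iff.2 (by omega)
  refine isNormForm_neg_mul_of_jacobiSym Nat.prime_two hr hd hq (by omega) (by omega) (by omega)
    (Or.inr ?_) (isNormForm_eleven_of_mod_eq_seven (by omega) _) (Or.inl rfl)
    (jacobiSym_eleven_mul_eq_one hr (by omega) hqr hdr) ?_ ?_
  · have hq8' : (q : ℤ) ≡ 1 [ZMOD 8] := by change _ = _; omega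
    exact (hq8'.mul_left 11).mul hd8
  · have := jacobiSym.at_neg_two hdodd
    rw [ZMod.χ₈'_nat_eq_if_mod_eight] at this
    rw [Nat.cast_ofNat, ← neg_mul, jacobiSym.mul_left,
      jacobiSym_eq_one_of_modEq_neg_one hrodd (by omega) hdr, this]
    simp [hd8']
    omega
  · have := jacobiSym.at_two hqodd
    rw [ZMod.χ₈_nat_eq_if_mod_eight] at this
    rw [jacobiSym_neg_mul_eq_of_modEq _ hrodd (by omega) hqr, jacobiSym_congr (a := r) (b := 3 ^ 2) hr11,
      Nat.cast_ofNat, this]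
    rw [if_neg (by omega), if_pos (Or.inl hq8)]
    norm_num

theorem exists_auxiliaryPrimes_eleven : ∃ r d m c, AuxiliaryPrimes 11 r d m c := by
  obtain ⟨r, hr2, hr, hr8, hr11⟩ := Nat.exists_prime_gt_modEq_modEq (m := 8) (n := 11) (a := 5)
    (b := 1) (by norm_num) (by norm_num) (by norm_num)
    (by norm_num [Int.isCoprime_iff_gcd_eq_one]) isCoprime_one_left 11
  have hrodd : Odd r := hr.odd_of_ne_two (by omega)
  obtain ⟨d, hd2, hd, hd8, hdr, hd11⟩ := Nat.exists_prime_gt_modEq_modEq_modEq (l := 8) (m := r)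
    (n := 11) (a := 3) (b := -1) (c := 1) (by norm_num) hr.ne_zero (by norm_num)
    (Nat.Coprime.pow_left 3 ((Nat.coprime_primes Nat.prime_two hr).2 (by omega)))
    (by norm_num) ((Nat.coprime_primes hr (by norm_num)).2 (by omega))
    (by norm_num [Int.isCoprime_iff_gcd_eq_one]) isCoprime_one_left.neg_left isCoprime_one_left r
  have hr8' : r % 8 = 5 := by have := hr8.eq; omega
  have hr11' : r % 11 = 1 := by have := hr11.eq; omega
  have hd8' : d % 8 = 3 := by have := hd8.eq; omega
  have hd11' : d % 11 = 1 := by have := hd11.eq; omega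
  refine ⟨r, d, 1, 0, hr, hd, by omega, by omega, by omega, by omega, by omega, Or.inl rfl,
    Or.inr (by omega), Or.inl rfl, by simp, by simpa using isCoprime_one_right,
    fun q hq hq8 hq11 hqr _ ↦ ?_⟩
  have hqodd : Odd q := Nat.odd_iff.2 (by omega)
  have hdodd : Odd d := Nat.odd_iff.2 (by omega)
  have one_of_mod {a : ℕ} (h : a % 11 = 1) : jacobiSym a 11 = 1 := by
    rw [jacobiSym_congr (b := 1) (by change _ = _; push_cast; omega), jacobiSym.one_left]
  refine isNormForm_neg_mul_of_jacobiSym (by norm_num) hr hd hq (by omega) (by omega) (by omega)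
    (Or.inl ?_) ?_ (Or.inr (Or.inl rfl))
    (jacobiSym_eleven_mul_eq_one hr (by omega) hqr hdr) ?_ ?_
  · change _ = _
    push_cast
    omega
  · intro _
    have sq {a : ℕ} (h : a % 11 = 1) : IsSquare (a : ℚ_[11]) := by
      exact_mod_cast Padic.isSquare_of_jacobiSym (by norm_num) (one_of_mod h)
    have hr0 : (r : ℚ_[11]) ≠ 0 := by exact_mod_cast hr.ne_zero
    have h := (IsNormForm.neg_self (-(11 * r) : ℚ_[11])).mul
      (IsNormForm.of_isSquare_right (((sq hq11).mul (sq hd11')).div (sq hr11')))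
    push_cast
    convert h using 1
    field_simp
  · rw [jacobiSym.neg _ hdodd, ZMod.χ₄_nat_three_mod_four (by omega), jacobiSym.mul_left,
      jacobiSym_eq_one_of_modEq_neg_one hrodd (by omega) hdr,
      jacobiSym.quadratic_reciprocity_three_mod_four (by norm_num) (by omega), one_of_mod hd11']
    norm_num
  · rw [jacobiSym_neg_mul_eq_of_modEq _ hrodd (by omega) hqr, one_of_mod hr11',
      jacobiSym.quadratic_reciprocity_one_mod_four' (by decide) (by omega), one_of_mod hq11]
    norm_num

theorem exists_auxiliaryPrimes_of_ne {p : ℕ} (hp : p.Prime) (hp2 : p ≠ 2) (hp11 : p ≠ 11) :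
    ∃ r d m c, AuxiliaryPrimes p r d m c := by
  have hpodd := hp.odd_of_ne_two hp2
  have hp8 : p.Coprime 8 := Nat.Coprime.pow_right 3 ((Nat.coprime_primes hp Nat.prime_two).2 hp2)
  have hpc11 : p.Coprime 11 := (Nat.coprime_primes hp (by norm_num)).2 hp11
  have hp88 : p.Coprime 88 := Nat.Coprime.mul_right hp8 hpc11
  obtain ⟨v, w, hvw⟩ := Nat.isCoprime_iff_coprime.2 hp88
  obtain ⟨r, hrp, hr, hr88⟩ := Nat.forall_exists_prime_gt_and_zmodEq (11 + p) (q := 88) (a := 7 * v)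
    (by norm_num) (IsCoprime.mul_left (by norm_num [Int.isCoprime_iff_gcd_eq_one])
      ⟨p, w, by linear_combination hvw⟩)
  have hrodd : Odd r := hr.odd_of_ne_two (by omega)
  have hpr : p * r % 88 = 7 := by
    have : (p * r : ℤ) ≡ 7 [ZMOD 88] := by
      refine (hr88.mul_left p).trans (Int.modEq_iff_dvd.2 ⟨7 * w, ?_⟩)
      push_cast at hvw
      linear_combination -7 * hvw
    have : ((p * r : ℕ) : ℤ) % 88 = 7 := by exact_mod_cast this
    omega
  obtain ⟨u, hu⟩ := exists_jacobiSym_eq_neg_one_s18 hp hp2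
  have hup : IsCoprime (-u) p := by
    rw [IsCoprime.neg_left_iff, Int.isCoprime_iff_gcd_eq_one]
    by_contra h
    rw [jacobiSym.eq_zero_iff.2 ⟨hp.ne_zero, h⟩] at hu
    norm_num at hu
  obtain ⟨d, hd2, hd, hd8, hdr, hdp⟩ := Nat.exists_prime_gt_modEq_modEq_modEq (l := 8) (m := r)
    (n := p) (a := 3) (b := -1) (c := -u) (by norm_num) hr.ne_zero hp.ne_zero
    (Nat.Coprime.pow_left 3 ((Nat.coprime_primes Nat.prime_two hr).2 (by omega)))
    hp8.symm ((Nat.coprime_primes hr hp).2 (by omega))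
    (by norm_num [Int.isCoprime_iff_gcd_eq_one]) isCoprime_one_left.neg_left hup r
  have hd8' : d % 8 = 3 := by have := hd8.eq; omega
  have hcop : IsCoprime (11 * d : ℤ) p :=
    IsCoprime.mul_left (by exact_mod_cast Nat.isCoprime_iff_coprime.2 hpc11.symm)
      (Nat.isCoprime_iff_coprime.2 ((Nat.coprime_primes hd hp).2 (by omega)))
  refine ⟨r, d, p, 11 * d, hr, hd, by omega, by omega, by omega, by omega, by omega,
    Or.inr (by omega), Or.inr (by omega), Or.inr rfl, hp88, hcop, fun q hq hq8 hq11 hqr hqp ↦ ?_⟩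
  have hqodd : Odd q := Nat.odd_iff.2 (by omega)
  have hdodd : Odd d := Nat.odd_iff.2 (by omega)
  have hdp' : jacobiSym (-d) p = -1 := by
    rw [jacobiSym_congr hdp.neg, neg_neg, hu]
  refine isNormForm_neg_mul_of_jacobiSym hp hr hd hq (by omega) (by omega) (by omega)
    (Or.inl ?_) (isNormForm_eleven_of_mod_eq_seven (by omega) _) (Or.inr (Or.inr ?_))
    (jacobiSym_eleven_mul_eq_one hr (by omega) hqr hdr) ?_ ?_
  · have : ((p * r : ℕ) : ℤ) % 88 = 7 := by exact_mod_cast hpr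
    push_cast at this
    change _ = _
    omega
  · rw [jacobiSym_congr (b := (11 * d) ^ 2) (((hqp.mul_left 11).mul_right d).trans (by
      rw [show (11 * (11 * d) * d : ℤ) = (11 * d) ^ 2 by ring])), jacobiSym.sq_one']
    exact Int.isCoprime_iff_gcd_eq_one.1 hcop
  · rw [jacobiSym.neg _ hdodd, ZMod.χ₄_nat_three_mod_four (by omega), jacobiSym.mul_left,
      jacobiSym_eq_one_of_modEq_neg_one hrodd (by omega) hdr,
      ← jacobiSym_neg_of_mod_four_eq_three (by omega) hpodd, hdp']
    norm_num
  · have h11 := jacobiSym_neg_of_mod_four_eq_three (a := 11) (by norm_num) hpodd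
    have h7 : jacobiSym (p * r) 11 = -1 := by
      rw [jacobiSym_congr (b := 7) (by
        have : ((p * r : ℕ) : ℤ) % 88 = 7 := by exact_mod_cast hpr
        push_cast at this
        change _ = _
        push_cast
        omega)]
      norm_num
    push_cast at h11
    rw [jacobiSym.mul_left] at h7
    rw [jacobiSym_neg_mul_eq_of_modEq _ hrodd (by omega) hqr,
      jacobiSym.quadratic_reciprocity_one_mod_four' hpodd (by omega), jacobiSym_congr hqp,
      show (11 * d : ℤ) = -11 * -d by ring, jacobiSym.mul_left, h11, hdp']
    linear_combination -h7

theorem exists_auxiliaryPrimes {p : ℕ} (hp : p.Prime) : ∃ r d m c, AuxiliaryPrimes p r d m c := by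
  by_cases hp2 : p = 2
  · exact hp2 ▸ exists_auxiliaryPrimes_two
  by_cases hp11 : p = 11
  · exact hp11 ▸ exists_auxiliaryPrimes_eleven
  exact exists_auxiliaryPrimes_of_ne hp hp2 hp11

section Local

variable {p : ℕ} [hp : Fact p.Prime]

theorem Padic.valuation_div {x y : ℚ_[p]} (hx : x ≠ 0) (hy : y ≠ 0) :
    (x / y).valuation = x.valuation - y.valuation := by
  rw [div_eq_mul_inv, valuation_mul hx (inv_ne_zero hy), valuation_inv, sub_eq_add_neg]

theorem Padic.valuation_sq_div_of_pos {x : ℚ_[p]} (hx : 0 < x.valuation) :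
    (x ^ 2 / (x ^ 2 + x + 1)).valuation = 2 * x.valuation := by
  have hx0 : x ≠ 0 := by rintro rfl; simp at hx
  obtain ⟨h0, h1⟩ := valuation_add_of_lt one_ne_zero (y := x) (by rwa [valuation_one])
  rw [valuation_one] at h1
  obtain ⟨h0', h1'⟩ := valuation_add_of_lt one_ne_zero (y := x * (1 + x))
    (by rw [valuation_one, valuation_mul hx0 h0, h1]; omega)
  rw [valuation_one] at h1'
  rw [show x ^ 2 + x + 1 = 1 + x * (1 + x) by ring, valuation_div (pow_ne_zero 2 hx0) h0', h1',
    valuation_pow]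
  simp

theorem Padic.valuation_sq_div_two_nonneg (x : ℚ_[2]) :
    0 ≤ (x ^ 2 / (x ^ 2 + x + 1)).valuation := by
  rcases eq_or_ne x 0 with rfl | hx0
  · simp
  rcases le_or_gt 0 x.valuation with h | h
  · obtain ⟨z, rfl⟩ := exists_padicInt_of_valuation h
    have key : ∀ a : ZMod 2, a ^ 2 + a + 1 ≠ 0 := by decide
    have hn := PadicInt.norm_eq_one_of_toZMod_ne_zero (z := z ^ 2 + z + 1)
      (by simpa using key (PadicInt.toZMod z))
    rw [← Padic.norm_le_one_iff_val_nonneg, norm_div]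
    rw [← PadicInt.padic_norm_e_of_padicInt] at hn
    push_cast at hn
    rw [hn, div_one, norm_pow]
    exact pow_le_one₀ (norm_nonneg _) z.2
  · obtain ⟨h0, h1⟩ := valuation_add_of_lt hx0 (y := 1) (by rwa [valuation_one])
    obtain ⟨h0', h1'⟩ := valuation_add_of_lt (pow_ne_zero 2 hx0) (y := x + 1)
      (by rw [h1, valuation_pow]; push_cast; omega)
    rw [add_assoc, valuation_div (pow_ne_zero 2 hx0) h0', h1', sub_self]

end Local

/-- Finitely many rationals with suitable squarefree parts are norms from `ℚ(√(-11q))` for all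
primes `q` in a residue class. -/
theorem exists_modulus_forall_isNormForm {p : ℕ} (hp : p.Prime) (L : List ℚ)
    (h : ∀ a ∈ L, ∃ M : ℕ, Odd M ∧ ¬ 11 ∣ M ∧ ¬ p ∣ M ∧ jacobiSym M 11 = 1 ∧
      ∃ s : ℚ, s ≠ 0 ∧ a = M * s ^ 2) :
    ∃ N : ℕ, Odd N ∧ ¬ 11 ∣ N ∧ ¬ p ∣ N ∧ ∀ q : ℕ, q.Prime → q % 8 = 1 → q % 11 = 1 →
      (q : ℤ) ≡ -11 [ZMOD N] → ∀ a ∈ L, IsNormForm (-(11 * q) : ℚ) a := by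
  induction L with
  | nil => exact ⟨1, odd_one, by norm_num, hp.not_dvd_one, by simp⟩
  | cons a L ih =>
    obtain ⟨N, hN2, hN11, hNp, hN⟩ := ih fun b hb ↦ h b (List.mem_cons_of_mem a hb)
    obtain ⟨M, hM2, hM11, hMp, hJ, s, hs, rfl⟩ := h a List.mem_cons_self
    refine ⟨M * N, hM2.mul hN2, Nat.Prime.not_dvd_mul (by norm_num) hM11 hN11,
      hp.not_dvd_mul hMp hNp, fun q hq hq8 hq11 hqMN b hb ↦ ?_⟩
    push_cast at hqMN
    rcases List.mem_cons.1 hb with rfl | hb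
    · rw [IsNormForm.mul_sq_right_iff hs]
      exact isNormForm_of_modEq_neg_eleven hq hq8 hq11 hM2 hM11 hJ (hqMN.of_mul_right _)
    · exact hN q hq hq8 hq11 (hqMN.of_mul_left _) b hb

theorem Rat.exists_prime_valuation_pos {x : ℚ} (hx : 1 < |x|) :
    ∃ (p : ℕ) (_ : Fact p.Prime), 0 < (x : ℚ_[p]).valuation := by
  have h1 : x.num.natAbs ≠ 1 := by
    intro h
    rw [← Rat.num_div_den x, abs_div, ← Int.cast_abs, Int.abs_eq_natAbs, h] at hx
    have hd : (1 : ℚ) ≤ x.den := by exact_mod_cast x.den_pos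
    rw [Nat.abs_cast, lt_div_iff₀ (by positivity)] at hx
    push_cast at hx
    linarith
  obtain ⟨p, hp, hpx⟩ := Nat.exists_prime_and_dvd h1
  have := Fact.mk hp
  have hx0 : x ≠ 0 := by rintro rfl; norm_num at hx
  refine ⟨p, this, ?_⟩
  have hden : ¬ p ∣ x.den := fun h ↦ hp.not_dvd_one (x.reduced ▸ Nat.dvd_gcd hpx h)
  have hnum0 : x.num.natAbs ≠ 0 := by simpa using hx0
  rw [Padic.valuation_ratCast, padicValRat, padicValNat.eq_zero_of_not_dvd hden, padicValInt]
  have := one_le_padicValNat_of_dvd hnum0 hpx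
  rw [Nat.cast_zero, sub_zero]
  exact_mod_cast this

theorem integralityWitness_intCast {x : ℚ} (hx : 1 < |x|) (t : ℤ) : IntegralityWitness x t := by
  have : Fact (Nat.Prime 11) := ⟨by norm_num⟩
  obtain ⟨p, hp, hxp⟩ := Rat.exists_prime_valuation_pos hx
  obtain ⟨r, d, m, c, h⟩ := exists_auxiliaryPrimes hp.out
  have hx0 : x ≠ 0 := by rintro rfl; norm_num at hx
  set y : ℚ := x ^ 2 / (x ^ 2 + x + 1) with hy
  have hyp : 2 ≤ (y : ℚ_[p]).valuation := by
    have := Padic.valuation_sq_div_of_pos hxp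
    rw [hy]
    push_cast
    omega
  have hy2 : 0 ≤ (y : ℚ_[2]).valuation := by
    have := Padic.valuation_sq_div_two_nonneg (x : ℚ_[2])
    rw [hy]
    push_cast
    exact this
  have hy0 : y ≠ 0 := by rintro h0; simp [h0] at hyp
  have y0 (l : ℕ) [Fact l.Prime] : (y : ℚ_[l]) ≠ 0 := by exact_mod_cast hy0
  have hβ0 : p * r ≠ 0 := mul_ne_zero hp.out.ne_zero h.prime_r.ne_zero
  have not_dvd {l s : ℕ} (hl : l.Prime) (hs : s.Prime) (hsl : s ≠ l) : ¬ l ∣ s := fun h ↦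
    hsl ((Nat.prime_dvd_prime_iff_eq hl hs).1 h).symm
  have int_val (l : ℕ) [Fact l.Prime] (n : ℤ) : 0 ≤ (((n : ℤ) : ℚ) : ℚ_[l]).valuation := by
    rw [Rat.cast_intCast, Padic.valuation_intCast]
    positivity
  have part (e : ℕ) (he : e = 13 ∨ e = 2) (k : ℚ) (hkp : 0 ≤ (k : ℚ_[p]).valuation)
      (hk2 : 0 ≤ (k : ℚ_[2]).valuation) :
      ∃ M : ℕ, Odd M ∧ ¬ 11 ∣ M ∧ ¬ p ∣ M ∧ jacobiSym M 11 = 1 ∧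
        ∃ s : ℚ, s ≠ 0 ∧ 1 + (e * (p * r) : ℕ) * k ^ 10 = M * s ^ 2 := by
    refine exists_squarefree_part_one_add (mul_ne_zero (by omega) hβ0) k
      (Dvd.intro (e * r) (by ring)) hkp hk2 ?_ ?_
    · rcases he with rfl | rfl
      · rcases h.mod_eight with h | h
        · exact Or.inl (by rw [h]; exact Dvd.intro (13 * r) (by ring))
        · exact Or.inr (by omega)
      · exact Or.inl (Dvd.intro _ rfl)
    · rcases h.mod_eleven with h | h
      · subst h
        exact Or.inl ⟨Dvd.intro (e * r) (by ring), hkp⟩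
      · right
        rcases he with rfl | rfl <;> omega
  have div_val (l n : ℕ) [Fact l.Prime] (hn : n ≠ 0) :
      ((y / n : ℚ) : ℚ_[l]).valuation = (y : ℚ_[l]).valuation - padicValNat l n := by
    rw [Rat.cast_div, Rat.cast_natCast, Padic.valuation_div (y0 l) (by exact_mod_cast hn),
      Padic.valuation_natCast]
  have hyβp : 0 ≤ ((y / (p * r : ℕ) : ℚ) : ℚ_[p]).valuation := by
    rw [div_val p _ hβ0, padicValNat.mul hp.out.ne_zero h.prime_r.ne_zero, padicValNat_self,
      padicValNat.eq_zero_of_not_dvd (not_dvd hp.out h.prime_r h.r_ne)]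
    push_cast
    omega
  have hyβ2 : 0 ≤ ((y / (p * r : ℕ) : ℚ) : ℚ_[2]).valuation := by
    by_cases hp2 : p = 2
    · subst hp2
      exact hyβp
    · rw [div_val 2 _ hβ0, padicValNat.eq_zero_of_not_dvd (Nat.prime_two.not_dvd_mul
        (not_dvd Nat.prime_two hp.out hp2) (not_dvd Nat.prime_two h.prime_r h.r_ne_two))]
      simpa using hy2
  have hyd (l : ℕ) [hl : Fact l.Prime] (hdl : d ≠ l) (hyl : 0 ≤ (y : ℚ_[l]).valuation) :
      0 ≤ ((y / d : ℚ) : ℚ_[l]).valuation := by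
    rw [div_val l _ h.prime_d.ne_zero,
      padicValNat.eq_zero_of_not_dvd (not_dvd hl.out h.prime_d hdl)]
    simpa using hyl
  obtain ⟨N, hN2, hN11, hNp, hN⟩ := exists_modulus_forall_isNormForm hp.out
    [1 + (13 * (p * r) : ℕ) * (1 : ℤ) ^ 10, 1 + (13 * (p * r) : ℕ) * (y / (p * r : ℕ)) ^ 10,
      1 + (13 * (p * r) : ℕ) * t ^ 10,
      1 + (2 * (p * r) : ℕ) * (1 : ℤ) ^ 10, 1 + (2 * (p * r) : ℕ) * (y / (p * r : ℕ)) ^ 10,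
      1 + (2 * (p * r) : ℕ) * t ^ 10, 1 + (2 * (p * r) : ℕ) * (d : ℤ) ^ 10,
      1 + (2 * (p * r) : ℕ) * (y / d) ^ 10] (by
    intro a ha
    simp only [List.mem_cons, List.not_mem_nil, or_false] at ha
    rcases ha with rfl | rfl | rfl | rfl | rfl | rfl | rfl | rfl
    · exact part 13 (Or.inl rfl) _ (int_val p _) (int_val 2 _)
    · exact part 13 (Or.inl rfl) _ hyβp hyβ2
    · exact part 13 (Or.inl rfl) _ (int_val p _) (int_val 2 _)
    · exact part 2 (Or.inr rfl) _ (int_val p _) (int_val 2 _)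
    · exact part 2 (Or.inr rfl) _ hyβp hyβ2
    · exact part 2 (Or.inr rfl) _ (int_val p _) (int_val 2 _)
    · exact part 2 (Or.inr rfl) _ (int_val p _) (int_val 2 _)
    · exact part 2 (Or.inr rfl) _ (hyd p h.d_ne (by omega)) (hyd 2 h.d_ne_two hy2))
  have hc88 {s : ℕ} (hs2 : Odd s) (hs11 : ¬ 11 ∣ s) : Nat.Coprime 88 s :=
    Nat.Coprime.mul_left (Nat.Coprime.pow_left 3 hs2.coprime_two_left)
      ((Nat.Prime.coprime_iff_not_dvd (by norm_num)).2 hs11)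
  have hcm {s : ℕ} (hs : ¬ p ∣ s) : Nat.Coprime s m := by
    rcases h.m_eq with h | h
    · rw [h]; exact Nat.coprime_one_right s
    · rw [h]; exact ((Nat.Prime.coprime_iff_not_dvd hp.out).2 hs).symm
  have hr11 : ¬ 11 ∣ r := not_dvd (by norm_num) h.prime_r h.r_ne_eleven
  have h11 {s : ℕ} (hs11 : ¬ 11 ∣ s) : IsCoprime (-11 : ℤ) s :=
    IsCoprime.neg_left (by
      exact_mod_cast Nat.isCoprime_iff_coprime.2
        ((Nat.Prime.coprime_iff_not_dvd (by norm_num)).2 hs11))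
  have hrN11 : ¬ 11 ∣ r * N := Nat.Prime.not_dvd_mul (by norm_num) hr11 hN11
  have hN0 : N ≠ 0 := by rintro rfl; simp at hN2
  obtain ⟨q, -, hq, hq88, hqr, hqm⟩ := Nat.exists_prime_gt_modEq_modEq_modEq (l := 88) (m := r * N)
    (n := m) (a := 1) (b := -11) (c := c) (by norm_num) (mul_ne_zero h.prime_r.ne_zero hN0)
    (by rcases h.m_eq with h | h
        · omega
        · rw [h]; exact hp.out.ne_zero)
    (hc88 ((h.prime_r.odd_of_ne_two h.r_ne_two).mul hN2) hrN11) h.coprime_m.symm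
    (hcm (hp.out.not_dvd_mul (not_dvd hp.out h.prime_r h.r_ne) hNp)) isCoprime_one_left
    (h11 hrN11) h.coprime_c 0
  push_cast at hqr
  have hq88 := hq88.eq
  have hq8 : q % 8 = 1 := by omega
  have hq11 : q % 11 = 1 := by omega
  have key := hN q hq hq8 hq11 (hqr.of_mul_left _)
  have hd0 : (d : ℚ) ≠ 0 := by exact_mod_cast h.prime_d.ne_zero
  simp only [List.forall_mem_cons] at key
  obtain ⟨k1, k2, k3, k4, k5, k6, k7, k8, -⟩ := key
  refine ⟨(q : ℚ), ((p * r : ℕ) : ℚ), (d : ℚ) ^ 5, y ^ 5, by exact_mod_cast hq.ne_zero,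
    by exact_mod_cast Nat.pos_of_ne_zero hβ0, pow_ne_zero 5 hd0, rfl, ?_, ?_, ?_, ?_, ?_, ?_, ?_,
    ?_, ?_, ?_, ?_, ?_⟩
  · exact_mod_cast isNormForm_prime_of_mod_eq_one hq hq8 hq11 (Or.inl rfl)
  · exact_mod_cast isNormForm_prime_of_mod_eq_one hq hq8 hq11 (Or.inr (Or.inl rfl))
  · exact_mod_cast isNormForm_prime_of_mod_eq_one hq hq8 hq11 (Or.inr (Or.inr rfl))
  · have := (h.isNormForm q hq hq8 hq11 (hqr.of_mul_right _) hqm).mul (IsNormForm.sq _ ((d : ℚ) ^ 2))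
    push_cast
    convert this using 1
    ring
  · convert k1 using 1; push_cast; ring
  · convert k2 using 1; push_cast; ring
  · convert k3 using 1; push_cast; ring
  · convert k4 using 1; push_cast; ring
  · convert k5 using 1; push_cast; ring
  · convert k6 using 1; push_cast; ring
  · convert k7 using 1; push_cast; ring
  · convert k8 using 1; push_cast; ring

section Diophantine

variable {σ : Type}

/-- Rational functions given by evaluating a polynomial. -/
def IsPolyFun (f : (σ → ℚ) → ℚ) : Prop :=
  ∃ F : MvPolynomial σ ℚ, ∀ v, MvPolynomial.eval v F = f v

namespace IsPolyFun

variable {f g : (σ → ℚ) → ℚ}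

theorem const (c : ℚ) : IsPolyFun fun _ : σ → ℚ ↦ c := ⟨MvPolynomial.C c, by simp⟩

theorem coord (i : σ) : IsPolyFun fun v : σ → ℚ ↦ v i := ⟨MvPolynomial.X i, by simp⟩

theorem add (hf : IsPolyFun f) (hg : IsPolyFun g) : IsPolyFun fun v ↦ f v + g v := by
  obtain ⟨F, hF⟩ := hf
  obtain ⟨G, hG⟩ := hg
  exact ⟨F + G, by simp [hF, hG]⟩

theorem mul (hf : IsPolyFun f) (hg : IsPolyFun g) : IsPolyFun fun v ↦ f v * g v := by
  obtain ⟨F, hF⟩ := hf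
  obtain ⟨G, hG⟩ := hg
  exact ⟨F * G, by simp [hF, hG]⟩

theorem neg (hf : IsPolyFun f) : IsPolyFun fun v ↦ -f v := by
  obtain ⟨F, hF⟩ := hf
  exact ⟨-F, by simp [hF]⟩

theorem sub (hf : IsPolyFun f) (hg : IsPolyFun g) : IsPolyFun fun v ↦ f v - g v := by
  obtain ⟨F, hF⟩ := hf
  obtain ⟨G, hG⟩ := hg
  exact ⟨F - G, by simp [hF, hG]⟩

theorem pow (hf : IsPolyFun f) (n : ℕ) : IsPolyFun fun v ↦ f v ^ n := by
  obtain ⟨F, hF⟩ := hf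
  exact ⟨F ^ n, by simp [hF]⟩

theorem comp_some (hf : IsPolyFun f) : IsPolyFun fun v : Option σ → ℚ ↦ f fun i ↦ v (some i) := by
  obtain ⟨F, hF⟩ := hf
  exact ⟨F.rename some, fun v ↦ by rw [MvPolynomial.eval_rename, hF]; rfl⟩

end IsPolyFun

/-- Existentially definable predicates over `ℚ`, in one polynomial equation. -/
def IsDiophantine (P : (σ → ℚ) → Prop) : Prop :=
  ∃ (κ : Type) (_ : Finite κ) (F : MvPolynomial (σ ⊕ κ) ℚ),
    ∀ v, P v ↔ ∃ y : κ → ℚ, MvPolynomial.eval (Sum.elim v y) F = 0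

namespace IsDiophantine

variable {P Q : (σ → ℚ) → Prop} {f g : (σ → ℚ) → ℚ}

theorem eq (hf : IsPolyFun f) (hg : IsPolyFun g) : IsDiophantine fun v ↦ f v = g v := by
  obtain ⟨F, hF⟩ := hf.sub hg
  refine ⟨Empty, inferInstance, F.rename Sum.inl, fun v ↦ ?_⟩
  simp [MvPolynomial.eval_rename, hF, sub_eq_zero]

theorem congr (h : IsDiophantine P) (hPQ : ∀ v, Q v ↔ P v) : IsDiophantine Q := by
  rwa [show Q = P from funext fun v ↦ propext (hPQ v)]

theorem eval_rename_sumMap {κ₁ κ₂ : Type} (v : σ → ℚ) (y : κ₁ ⊕ κ₂ → ℚ) (F : MvPolynomial (σ ⊕ κ₁) ℚ)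
    (G : MvPolynomial (σ ⊕ κ₂) ℚ) :
    MvPolynomial.eval (Sum.elim v y) (F.rename (Sum.map id Sum.inl)) =
        MvPolynomial.eval (Sum.elim v (y ∘ Sum.inl)) F ∧
      MvPolynomial.eval (Sum.elim v y) (G.rename (Sum.map id Sum.inr)) =
        MvPolynomial.eval (Sum.elim v (y ∘ Sum.inr)) G := by
  simp [MvPolynomial.eval_rename, Sum.elim_comp_map]

theorem and (hP : IsDiophantine P) (hQ : IsDiophantine Q) : IsDiophantine fun v ↦ P v ∧ Q v := by
  obtain ⟨κ₁, _, F, hF⟩ := hP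
  obtain ⟨κ₂, _, G, hG⟩ := hQ
  refine ⟨κ₁ ⊕ κ₂, inferInstance,
    F.rename (Sum.map id Sum.inl) ^ 2 + G.rename (Sum.map id Sum.inr) ^ 2, fun v ↦ ?_⟩
  simp only [hF, hG, map_add, map_pow, (eval_rename_sumMap v _ F G).1, (eval_rename_sumMap v _ F G).2]
  constructor
  · rintro ⟨⟨y, hy⟩, z, hz⟩
    exact ⟨Sum.elim y z, by simp [hy, hz]⟩
  · rintro ⟨y, hy⟩
    rw [add_eq_zero_iff_of_nonneg (sq_nonneg _) (sq_nonneg _)] at hy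
    exact ⟨⟨_, pow_eq_zero_iff two_ne_zero |>.1 hy.1⟩, _, pow_eq_zero_iff two_ne_zero |>.1 hy.2⟩

theorem or (hP : IsDiophantine P) (hQ : IsDiophantine Q) : IsDiophantine fun v ↦ P v ∨ Q v := by
  obtain ⟨κ₁, _, F, hF⟩ := hP
  obtain ⟨κ₂, _, G, hG⟩ := hQ
  refine ⟨κ₁ ⊕ κ₂, inferInstance,
    F.rename (Sum.map id Sum.inl) * G.rename (Sum.map id Sum.inr), fun v ↦ ?_⟩
  simp only [hF, hG, map_mul, (eval_rename_sumMap v _ F G).1, (eval_rename_sumMap v _ F G).2, mul_eq_zero]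
  constructor
  · rintro (⟨y, hy⟩ | ⟨z, hz⟩)
    · exact ⟨Sum.elim y 0, by simp [hy]⟩
    · exact ⟨Sum.elim 0 z, by simp [hz]⟩
  · rintro ⟨y, hy | hy⟩
    · exact Or.inl ⟨_, hy⟩
    · exact Or.inr ⟨_, hy⟩

theorem ex {P : (σ → ℚ) → ℚ → Prop}
    (h : IsDiophantine fun v : Option σ → ℚ ↦ P (fun i ↦ v (some i)) (v none)) :
    IsDiophantine fun v ↦ ∃ a, P v a := by
  obtain ⟨κ, _, F, hF⟩ := h
  let e : Option σ ⊕ κ → σ ⊕ Option κ :=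
    Sum.elim (fun o ↦ o.elim (Sum.inr none) Sum.inl) (Sum.inr ∘ some)
  have key (v : σ → ℚ) (y : Option κ → ℚ) : MvPolynomial.eval (Sum.elim v y) (F.rename e) =
      MvPolynomial.eval (Sum.elim (fun o : Option σ ↦ o.elim (y none) v) (y ∘ some)) F := by
    rw [MvPolynomial.eval_rename]
    congr 2
    ext ((_ | _) | _) <;> rfl
  refine ⟨Option κ, inferInstance, F.rename e, fun v ↦ ?_⟩
  simp only [key]
  constructor
  · rintro ⟨a, ha⟩
    obtain ⟨y, hy⟩ := (hF fun o ↦ o.elim a v).1 ha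
    exact ⟨fun o ↦ o.elim a y, hy⟩
  · rintro ⟨y, hy⟩
    exact ⟨y none, (hF fun o ↦ o.elim (y none) v).2 ⟨_, hy⟩⟩

theorem isNormForm (hf : IsPolyFun f) (hg : IsPolyFun g) :
    IsDiophantine fun v ↦ IsNormForm (f v) (g v) :=
  ex (ex (eq (((IsPolyFun.coord _).pow 2).sub
    (hf.comp_some.comp_some.mul ((IsPolyFun.coord _).pow 2))) hg.comp_some.comp_some))

end IsDiophantine

theorem Rat.nonneg_iff_sum_four_squares {a : ℚ} :
    0 ≤ a ↔ ∃ w x y z : ℚ, a = w ^ 2 + x ^ 2 + y ^ 2 + z ^ 2 := by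
  constructor
  · intro h
    lift a to ℚ≥0 using h
    obtain ⟨w, x, y, z, h⟩ := Nat.sum_four_squares (a.num * a.den)
    have hd : (a.den : ℚ) ≠ 0 := by exact_mod_cast a.den_ne_zero
    have ha : ((a : ℚ≥0) : ℚ) = a.num / a.den := by
      conv_lhs => rw [← NNRat.num_div_den a]
      push_cast
      rfl
    have h' : (w ^ 2 + x ^ 2 + y ^ 2 + z ^ 2 : ℚ) = a.num * a.den := by exact_mod_cast h
    refine ⟨w / a.den, x / a.den, y / a.den, z / a.den, ?_⟩
    rw [ha]
    field_simp
    linear_combination -h'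
  · rintro ⟨w, x, y, z, rfl⟩
    positivity

theorem IsDiophantine.nonneg {f : (σ → ℚ) → ℚ} (hf : IsPolyFun f) :
    IsDiophantine fun v ↦ 0 ≤ f v := by
  refine congr ?_ fun v ↦ Rat.nonneg_iff_sum_four_squares
  refine ex (ex (ex (ex (eq hf.comp_some.comp_some.comp_some.comp_some ?_))))
  exact ((((IsPolyFun.coord _).pow 2).add ((IsPolyFun.coord _).pow 2)).add
    ((IsPolyFun.coord _).pow 2)).add ((IsPolyFun.coord _).pow 2)

theorem integralityWitness_iff (x t : ℚ) : IntegralityWitness x t ↔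
    ∃ γ β δ γ' β' δ' y : ℚ, γ * γ' = 1 ∧ β * β' = 1 ∧ δ * δ' = 1 ∧ 0 ≤ β ∧
      y * (x ^ 2 + x + 1) = x ^ 2 ∧
      IsNormForm (-1) γ ∧ IsNormForm (-2) γ ∧ IsNormForm (-11) γ ∧
      IsNormForm (-β) (δ * (11 * γ)) ∧
      IsNormForm (-(11 * γ)) (1 + 13 * β * 1 ^ 2) ∧
      IsNormForm (-(11 * γ)) (1 + 13 * β * (y ^ 5 * β' ^ 5) ^ 2) ∧
      IsNormForm (-(11 * γ)) (1 + 13 * β * (t ^ 5) ^ 2) ∧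
      IsNormForm (-(11 * γ)) (1 + 2 * β * 1 ^ 2) ∧
      IsNormForm (-(11 * γ)) (1 + 2 * β * (y ^ 5 * β' ^ 5) ^ 2) ∧
      IsNormForm (-(11 * γ)) (1 + 2 * β * (t ^ 5) ^ 2) ∧
      IsNormForm (-(11 * γ)) (1 + 2 * β * δ ^ 2) ∧
      IsNormForm (-(11 * γ)) (1 + 2 * β * (y ^ 5 * δ') ^ 2) := by
  have hx : x ^ 2 + x + 1 ≠ 0 := by nlinarith [sq_nonneg (x + 1 / 2)]
  constructor
  · rintro ⟨γ, β, δ, ξ, hγ, hβ, hδ, rfl, h⟩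
    refine ⟨γ, β, δ, γ⁻¹, β⁻¹, δ⁻¹, x ^ 2 / (x ^ 2 + x + 1), mul_inv_cancel₀ hγ,
      mul_inv_cancel₀ hβ.ne', mul_inv_cancel₀ hδ, hβ.le, div_mul_cancel₀ _ hx, ?_⟩
    simpa only [inv_pow, ← div_eq_mul_inv] using h
  · rintro ⟨γ, β, δ, γ', β', δ', y, hγ, hβ, hδ, hβ0, hy, h⟩
    obtain rfl := eq_inv_of_mul_eq_one_right hβ
    obtain rfl := eq_inv_of_mul_eq_one_right hδ
    obtain rfl := (eq_div_iff hx).2 hy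
    refine ⟨γ, β, δ, _, left_ne_zero_of_mul_eq_one hγ,
      hβ0.lt_of_ne (left_ne_zero_of_mul_eq_one hβ).symm, left_ne_zero_of_mul_eq_one hδ, rfl, ?_⟩
    simpa only [inv_pow, ← div_eq_mul_inv] using h

theorem isDiophantine_integralityWitness (i j : σ) :
    IsDiophantine fun v : σ → ℚ ↦ IntegralityWitness (v i) (v j) := by
  refine IsDiophantine.congr ?_ fun v ↦ integralityWitness_iff (v i) (v j)
  iterate 7 refine IsDiophantine.ex ?_
  beta_reduce
  repeat' apply IsDiophantine.and
  all_goals first | apply IsDiophantine.nonneg | apply IsDiophantine.isNormForm |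
    apply IsDiophantine.eq
  all_goals
    repeat' first
      | exact IsPolyFun.const _
      | exact IsPolyFun.coord _
      | apply IsPolyFun.add
      | apply IsPolyFun.mul
      | apply IsPolyFun.neg
      | apply IsPolyFun.pow

end Diophantine

theorem isInt_iff_forall_integralityWitness (t : ℚ) :
    (∃ n : ℤ, t = n) ↔ ∀ x : ℚ, 0 ≤ 1 - x ^ 2 ∨ IntegralityWitness x t := by
  constructor
  · rintro ⟨n, rfl⟩ x
    rcases le_or_gt |x| 1 with h | h
    · exact Or.inl (sub_nonneg.2 ((sq_le_one_iff_abs_le_one x).2 h))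
    · exact Or.inr (integralityWitness_intCast h n)
  · intro h
    suffices hden : t.den = 1 from ⟨t.num, (Rat.den_eq_one_iff t).1 hden |>.symm⟩
    by_contra hden
    obtain ⟨p, hp, hpt⟩ := Nat.exists_prime_and_dvd hden
    have hp1 : (1 : ℚ) < p := by exact_mod_cast hp.one_lt
    have hw := (h p).resolve_left (by nlinarith)
    have ht : t ≠ 0 := by rintro rfl; simp at hden
    have hv := hw.padicValRat_nonneg hp ht
    have hnum : ¬ p ∣ t.num.natAbs := fun h ↦ hp.not_dvd_one (t.reduced ▸ Nat.dvd_gcd h hpt)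
    have : Fact p.Prime := ⟨hp⟩
    have := one_le_padicValNat_of_dvd t.den_ne_zero hpt
    rw [padicValRat, padicValInt, padicValNat.eq_zero_of_not_dvd hnum] at hv
    omega

/-- (Koenigsmann) `ℤ` is definable over `ℚ` by a `∀∃`-formula with a single universal
quantifier: there are `k ∈ ℕ` and a polynomial `F` over `ℚ` in `2 + k` variables such
that for every `t ∈ ℚ`, `t ∈ ℤ` iff `∀ x ∃ y₁ … y_k, F(t, x, y₁, …, y_k) = 0`. -/
theorem koenigsmann_one_universal_quantifier :
    ∃ (k : ℕ) (F : MvPolynomial (Fin 2 ⊕ Fin k) ℚ),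
      ∀ t : ℚ,
        (∃ n : ℤ, t = (n : ℚ)) ↔
          ∀ x : ℚ, ∃ y : Fin k → ℚ,
            MvPolynomial.eval (Sum.elim ![t, x] y) F = 0 := by
  have h : IsDiophantine fun v : Fin 2 → ℚ ↦ 0 ≤ 1 - v 1 ^ 2 ∨ IntegralityWitness (v 1) (v 0) :=
    (IsDiophantine.nonneg ((IsPolyFun.const 1).sub ((IsPolyFun.coord 1).pow 2))).or
      (isDiophantine_integralityWitness 1 0)
  obtain ⟨κ, _, F, hF⟩ := h
  obtain ⟨k, ⟨e⟩⟩ := Finite.exists_equiv_fin κ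
  refine ⟨k, F.rename (Sum.map id e), fun t ↦ ?_⟩
  rw [isInt_iff_forall_integralityWitness]
  refine forall_congr' fun x ↦ (hF ![t, x]).trans ?_
  simp only [MvPolynomial.eval_rename, Sum.elim_comp_map, Function.comp_id]
  exact ⟨fun ⟨y, hy⟩ ↦ ⟨y ∘ e.symm, by simpa [Function.comp_assoc] using hy⟩,
    fun ⟨y, hy⟩ ↦ ⟨y ∘ e, hy⟩⟩
end
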